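/- Let d≥2, γ>1 and α>1/3. Let (ρ,v) be a weak solution of the isentropic compressible Euler equations on (0,T)×𝕋^d with ρ≥c>0 a.e. for some constant c. If ρ ∈ L^{(3γ−1)/2}(0,T;L^{(3γ−1)/2}(𝕋^d)), ∂_t ρ ∈ L^{(3γ−1)/2}(0,T;L^{(3γ−1)/2}(𝕋^d)), ∇ρ ∈ L^{(3γ−1)/2}(0,T;L^{(3γ−1)/2}(𝕋^d)) and v ∈ L^{(3γ−1)/(γ−1)}(0,T;B^α_{(3γ−1)/(γ−1),∞}(𝕋^d)), then the energy is locally conserved: for every φ ∈ C_c^∞((0,T)), ∫₀^T φ'(t) ∫_{𝕋^d} (½ρ|v|² + κρ^γ/(γ−1)) dx dt = 0. -/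

import Mathlib

open MeasureTheory ENNReal

noncomputable section

namespace CompressibleEuler

variable {d : ℕ} {E : Type*} [NormedAddCommGroup E]

/-- Euclidean norm on `Fin d → ℝ`. -/
def euNorm (x : Fin d → ℝ) : ℝ := Real.sqrt (∑ i, x i ^ 2)

/-- The fundamental domain `[0,1)^d` of the torus `𝕋^d = [0,1]^d`. -/
def unitCube (d : ℕ) : Set (Fin d → ℝ) := Set.univ.pi fun _ => Set.Ico (0 : ℝ) 1

/-- Lebesgue measure on the torus `𝕋^d`, realized on the fundamental domain. -/
def cubeVol (d : ℕ) : Measure (Fin d → ℝ) := volume.restrict (unitCube d)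

/-- Product measure on `(0,T) × 𝕋^d`. -/
def spaceTime (d : ℕ) (T : ℝ) : Measure (ℝ × (Fin d → ℝ)) :=
  (volume.restrict (Set.Ioo 0 T)).prod (cubeVol d)

/-- `ℤ^d`-periodicity of a function on `ℝ^d` (i.e. a function on the torus `𝕋^d`). -/
def SpacePeriodic (f : (Fin d → ℝ) → E) : Prop :=
  ∀ (x : Fin d → ℝ) (n : Fin d → ℤ), f (x + fun i => (n i : ℝ)) = f x

/-- The `L^p` norm in time (exponent possibly `∞`) of an `ℝ≥0∞`-valued quantity,
over a time set `s`. -/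
def timeLpOn (s : Set ℝ) (p : ℝ≥0∞) (F : ℝ → ℝ≥0∞) : ℝ≥0∞ :=
  if p = ∞ then essSup F (volume.restrict s)
  else (∫⁻ t in s, F t ^ p.toReal) ^ (1 / p.toReal)

/-- The `L^p(0,T;L^q(𝕋^d))` norm. -/
def LpLqNorm (T : ℝ) (p q : ℝ≥0∞) (u : ℝ → (Fin d → ℝ) → E) : ℝ≥0∞ :=
  timeLpOn (Set.Ioo 0 T) p fun t => eLpNorm (u t) q (cubeVol d)

/-- `u ∈ L^p(0,T;L^q(𝕋^d))`. -/
def MemLpLq (T : ℝ) (p q : ℝ≥0∞) (u : ℝ → (Fin d → ℝ) → E) : Prop :=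
  LpLqNorm T p q u < ∞

/-- The homogeneous Besov seminorm `‖·‖_{Ḃ^α_{q,∞}(𝕋^d)}`. -/
def besovSeminorm (α : ℝ) (q : ℝ≥0∞) (f : (Fin d → ℝ) → E) : ℝ≥0∞ :=
  ⨆ (y : Fin d → ℝ) (_ : y ≠ 0),
    eLpNorm (fun x => f (x - y) - f x) q (cubeVol d) / ENNReal.ofReal (euNorm y ^ α)

/-- The Besov norm of `B^α_{q,∞}(𝕋^d)`. -/
def besovNorm (α : ℝ) (q : ℝ≥0∞) (f : (Fin d → ℝ) → E) : ℝ≥0∞ :=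
  eLpNorm f q (cubeVol d) + besovSeminorm α q f

/-- The `L^p(0,T;B^α_{q,∞}(𝕋^d))` norm. -/
def LpBesovNorm (T : ℝ) (p : ℝ≥0∞) (α : ℝ) (q : ℝ≥0∞) (u : ℝ → (Fin d → ℝ) → E) : ℝ≥0∞ :=
  timeLpOn (Set.Ioo 0 T) p fun t => besovNorm α q (u t)

/-- `u ∈ L^p(0,T;B^α_{q,∞}(𝕋^d))`. -/
def MemLpBesov (T : ℝ) (p : ℝ≥0∞) (α : ℝ) (q : ℝ≥0∞) (u : ℝ → (Fin d → ℝ) → E) : Prop :=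
  LpBesovNorm T p α q u < ∞

/-- The norm of the space-time Besov space `B^β_{p,∞}((0,T);B^α_{q,∞}(𝕋^d))`:
the `L^p(0,T;B^α_{q,∞})` norm plus the time-translation seminorm
`sup_{τ≠0} |τ|^{-β} ‖u(·-τ)-u(·)‖_{L^p(B^α_{q,∞})}`, the inner norm being taken
over the times where both terms are defined. -/
def besovBesovNorm (T β : ℝ) (p : ℝ≥0∞) (α : ℝ) (q : ℝ≥0∞)
    (u : ℝ → (Fin d → ℝ) → E) : ℝ≥0∞ :=
  LpBesovNorm T p α q u
    + ⨆ (τ : ℝ) (_ : τ ≠ 0),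
        timeLpOn (Set.Ioo (max 0 τ) (min T (T + τ))) p
            (fun t => besovNorm α q fun x => u (t - τ) x - u t x)
          / ENNReal.ofReal (|τ| ^ β)

/-- `u ∈ B^β_{p,∞}((0,T);B^α_{q,∞}(𝕋^d))`. -/
def MemBesovBesov (T β : ℝ) (p : ℝ≥0∞) (α : ℝ) (q : ℝ≥0∞)
    (u : ℝ → (Fin d → ℝ) → E) : Prop :=
  besovBesovNorm T β p α q u < ∞

/-- Classical partial derivative in time of a space-time function. -/
def pderivT (φ : ℝ → (Fin d → ℝ) → ℝ) (t : ℝ) (x : Fin d → ℝ) : ℝ :=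
  deriv (fun s => φ s x) t

/-- Classical partial derivative in the `i`-th space direction of a space-time function. -/
def pderivX (i : Fin d) (φ : ℝ → (Fin d → ℝ) → ℝ) (t : ℝ) (x : Fin d → ℝ) : ℝ :=
  fderiv ℝ (φ t) x (Pi.single i 1)

/-- Smooth test functions on `(0,T) × 𝕋^d`, compactly supported away from `t = 0` and
`t = T`, and periodic in space. -/
structure IsTestFunction (T : ℝ) (φ : ℝ → (Fin d → ℝ) → ℝ) : Prop where
  smooth : ContDiff ℝ (⊤ : ℕ∞) (Function.uncurry φ)
  periodic : ∀ t, SpacePeriodic (φ t)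
  supp : ∃ a b : ℝ, 0 < a ∧ b < T ∧ ∀ t x, t ∉ Set.Icc a b → φ t x = 0

/-- Smooth test functions on `[0,T) × 𝕋^d` (allowed to be nonzero at the initial time),
vanishing near `t = T`, and periodic in space. -/
structure IsTestFunctionIC (T : ℝ) (φ : ℝ → (Fin d → ℝ) → ℝ) : Prop where
  smooth : ContDiff ℝ (⊤ : ℕ∞) (Function.uncurry φ)
  periodic : ∀ t, SpacePeriodic (φ t)
  supp : ∃ b : ℝ, b < T ∧ ∀ t x, b ≤ t → φ t x = 0

/-- `g` is the weak time derivative of `f` on `(0,T) × 𝕋^d`. -/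
def HasWeakDerivT (T : ℝ) (f g : ℝ → (Fin d → ℝ) → ℝ) : Prop :=
  ∀ φ : ℝ → (Fin d → ℝ) → ℝ, IsTestFunction T φ →
    ∫ t in Set.Ioo 0 T, ∫ x in unitCube d, f t x * pderivT φ t x
      = - ∫ t in Set.Ioo 0 T, ∫ x in unitCube d, g t x * φ t x

/-- `g` is the weak `i`-th spatial derivative of `f` on `(0,T) × 𝕋^d`. -/
def HasWeakDerivX (T : ℝ) (i : Fin d) (f g : ℝ → (Fin d → ℝ) → ℝ) : Prop :=
  ∀ φ : ℝ → (Fin d → ℝ) → ℝ, IsTestFunction T φ →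
    ∫ t in Set.Ioo 0 T, ∫ x in unitCube d, f t x * pderivX i φ t x
      = - ∫ t in Set.Ioo 0 T, ∫ x in unitCube d, g t x * φ t x

/-- The weak time derivative of `f` belongs to `L^a(0,T;L^b(𝕋^d))`. -/
def DtInLpLq (T : ℝ) (a b : ℝ≥0∞) (f : ℝ → (Fin d → ℝ) → ℝ) : Prop :=
  ∃ g : ℝ → (Fin d → ℝ) → ℝ, HasWeakDerivT T f g ∧ MemLpLq T a b g

/-- The weak spatial gradient of `f` belongs to `L^a(0,T;L^b(𝕋^d))`. -/
def GradInLpLq (T : ℝ) (a b : ℝ≥0∞) (f : ℝ → (Fin d → ℝ) → ℝ) : Prop :=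
  ∃ G : ℝ → (Fin d → ℝ) → Fin d → ℝ,
    (∀ i, HasWeakDerivX T i f fun t x => G t x i) ∧ MemLpLq T a b G

/-- The constant `κ = (γ-1)²/(4γ)` in the pressure law `π(ρ) = κ ρ^γ`. -/
def kappa (γ : ℝ) : ℝ := (γ - 1) ^ 2 / (4 * γ)

/-- The total energy `E(t) = ∫_{𝕋^d} (½ ρ|v|² + κργ/(γ-1)) dx` at time `t`. -/
def energyAt (d : ℕ) (γ : ℝ) (ρ : ℝ → (Fin d → ℝ) → ℝ)
    (v : ℝ → (Fin d → ℝ) → Fin d → ℝ) (t : ℝ) : ℝ :=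
  ∫ x in unitCube d,
    ((1 / 2 : ℝ) * ρ t x * euNorm (v t x) ^ 2 + (kappa γ / (γ - 1)) * ρ t x ^ γ)

/-- The initial energy `E(0)`. -/
def energyInit (d : ℕ) (γ : ℝ) (ρ₀ : (Fin d → ℝ) → ℝ)
    (v₀ : (Fin d → ℝ) → Fin d → ℝ) : ℝ :=
  ∫ x in unitCube d,
    ((1 / 2 : ℝ) * ρ₀ x * euNorm (v₀ x) ^ 2 + (kappa γ / (γ - 1)) * ρ₀ x ^ γ)

/-- A weak solution of the isentropic compressible Euler equations
`∂ₜρ + div(ρv) = 0`, `∂ₜ(ρv) + div(ρv⊗v) + ∇(κρ^γ) = 0` on `(0,T) × 𝕋^d`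
with initial data `ρ(0) = ρ₀`, `(ρv)(0) = ρ₀v₀`:
both equations hold in the sense of distributions, `ρ^γ, ρ|v|² ∈ L^∞(0,T;L¹(𝕋^d))`,
`ρ` is a renormalized solution of the continuity equation, and the energy
inequality `E(t) ≤ E(0)` holds. -/
structure IsWeakSolution (d : ℕ) (T γ : ℝ) (ρ : ℝ → (Fin d → ℝ) → ℝ)
    (v : ℝ → (Fin d → ℝ) → Fin d → ℝ) (ρ₀ : (Fin d → ℝ) → ℝ)
    (v₀ : (Fin d → ℝ) → Fin d → ℝ) : Prop where
  rho_meas : Measurable (Function.uncurry ρ)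
  v_meas : Measurable (Function.uncurry v)
  rho_periodic : ∀ t, SpacePeriodic (ρ t)
  v_periodic : ∀ t, SpacePeriodic (v t)
  rho0_periodic : SpacePeriodic ρ₀
  v0_periodic : SpacePeriodic v₀
  rho_nonneg : ∀ t x, 0 ≤ ρ t x
  rho0_nonneg : ∀ x, 0 ≤ ρ₀ x
  v0_vacuum : ∀ x, ρ₀ x = 0 → v₀ x = 0
  pressure_int : MemLpLq T ∞ 1 fun t x => ρ t x ^ γ
  kinetic_int : MemLpLq T ∞ 1 fun t x => ρ t x * euNorm (v t x) ^ 2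
  mass : ∀ φ : ℝ → (Fin d → ℝ) → ℝ, IsTestFunctionIC T φ →
    (∫ t in Set.Ioo 0 T, ∫ x in unitCube d,
        (ρ t x * pderivT φ t x + ρ t x * (∑ i, v t x i * pderivX i φ t x)))
      + (∫ x in unitCube d, ρ₀ x * φ 0 x) = 0
  momentum : ∀ Φ : ℝ → (Fin d → ℝ) → Fin d → ℝ,
    (∀ j, IsTestFunctionIC T fun s y => Φ s y j) →
    (∫ t in Set.Ioo 0 T, ∫ x in unitCube d,
        ((∑ j, ρ t x * v t x j * pderivT (fun s y => Φ s y j) t x)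
          + (∑ i, ∑ j, ρ t x * v t x i * v t x j * pderivX i (fun s y => Φ s y j) t x)
          + kappa γ * ρ t x ^ γ * (∑ j, pderivX j (fun s y => Φ s y j) t x)))
      + (∫ x in unitCube d, (∑ j, ρ₀ x * v₀ x j * Φ 0 x j)) = 0
  renormalized : ∃ w : ℝ → (Fin d → ℝ) → ℝ,
    (∀ φ : ℝ → (Fin d → ℝ) → ℝ, IsTestFunction T φ →
      ∫ t in Set.Ioo 0 T, ∫ x in unitCube d, (∑ i, v t x i * pderivX i φ t x)
        = - ∫ t in Set.Ioo 0 T, ∫ x in unitCube d, w t x * φ t x) ∧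
    ∀ b : ℝ → ℝ, ContDiff ℝ 1 b → HasCompactSupport (deriv b) →
      ∀ φ : ℝ → (Fin d → ℝ) → ℝ, IsTestFunctionIC T φ →
        (∫ t in Set.Ioo 0 T, ∫ x in unitCube d,
            (b (ρ t x) * pderivT φ t x + b (ρ t x) * (∑ i, v t x i * pderivX i φ t x)
              - (deriv b (ρ t x) * ρ t x - b (ρ t x)) * w t x * φ t x))
          + (∫ x in unitCube d, b (ρ₀ x) * φ 0 x) = 0
  energy_ineq : ∀ᵐ t ∂(volume.restrict (Set.Ioo 0 T)),
    energyAt d γ ρ v t ≤ energyInit d γ ρ₀ v₀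

/-- The exponent `p/(p-3)`, read as `∞` when `p ≤ 3`. -/
def div3Exp (p : ℝ) : ℝ≥0∞ := if p ≤ 3 then ∞ else ENNReal.ofReal (p / (p - 3))

/-- The standard (non-normalized) spatial bump `e^{-1/(1-|x|²)}` for `|x| < 1`. -/
def bump (d : ℕ) (x : Fin d → ℝ) : ℝ :=
  if euNorm x < 1 then Real.exp (-(1 - euNorm x ^ 2)⁻¹) else 0

/-- The normalizing constant `C₀` with `∫ C₀ e^{-1/(1-|x|²)} dx = 1`. -/
def bumpConst (d : ℕ) : ℝ := (∫ x : Fin d → ℝ, bump d x)⁻¹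

/-- The rescaled standard spatial mollifier `η_ε(x) = ε^{-d} η(x/ε)`,
`η(x) = C₀ e^{-1/(1-|x|²)}`. -/
def sKer (d : ℕ) (ε : ℝ) (x : Fin d → ℝ) : ℝ :=
  (ε ^ d)⁻¹ * (bumpConst d * bump d (ε⁻¹ • x))

/-- Mollification in the space variable: `f^ε = f * η_ε`. -/
def sMollify {d : ℕ} {E : Type*} [NormedAddCommGroup E] [NormedSpace ℝ E]
    (ε : ℝ) (f : (Fin d → ℝ) → E) (x : Fin d → ℝ) : E :=
  ∫ y : Fin d → ℝ, sKer d ε (x - y) • f y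

/-- A space-time mollifying kernel: nonnegative, smooth, supported in the unit ball of
`ℝ^{1+d}`, with integral 1. -/
structure IsSTMollifier (d : ℕ) (η : ℝ → (Fin d → ℝ) → ℝ) : Prop where
  smooth : ContDiff ℝ (⊤ : ℕ∞) (Function.uncurry η)
  nonneg : ∀ t x, 0 ≤ η t x
  supp : ∀ t x, 1 ≤ t ^ 2 + euNorm x ^ 2 → η t x = 0
  integral_one : (∫ z : ℝ × (Fin d → ℝ), η z.1 z.2) = 1

/-- The rescaled space-time kernel `η_ε(t,x) = ε^{-(d+1)} η(t/ε, x/ε)`. -/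
def stKer (d : ℕ) (η : ℝ → (Fin d → ℝ) → ℝ) (ε : ℝ) (t : ℝ) (x : Fin d → ℝ) : ℝ :=
  (ε ^ (d + 1))⁻¹ * η (t / ε) (ε⁻¹ • x)

/-- Space-time mollification `f^ε(t,x) = ∫∫ η_ε(t-s, x-y) f(s,y) dy ds`. -/
def stMollify {d : ℕ} {E : Type*} [NormedAddCommGroup E] [NormedSpace ℝ E]
    (η : ℝ → (Fin d → ℝ) → ℝ) (ε : ℝ) (f : ℝ → (Fin d → ℝ) → E)
    (t : ℝ) (x : Fin d → ℝ) : E :=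
  ∫ z : ℝ × (Fin d → ℝ), stKer d η ε (t - z.1) (x - z.2) • f z.1 z.2


section part1

/-! ### Translation invariance on the torus -/

/-- The lattice `ℤ^d`. -/
abbrev latt (d : ℕ) : AddSubgroup (Fin d → ℝ) :=
  (Submodule.span ℤ (Set.range (Pi.basisFun ℝ (Fin d)))).toAddSubgroup

instance latt_countable (d : ℕ) : Countable (latt d) :=
  inferInstanceAs (Countable (Submodule.span ℤ (Set.range (Pi.basisFun ℝ (Fin d)))))

theorem latt_mem {d : ℕ} (g : latt d) : ∃ n : Fin d → ℤ, (g : Fin d → ℝ) = fun i => (n i : ℝ) := by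
  have h := g.2
  have h2 : (g : Fin d → ℝ) ∈ Submodule.span ℤ (Set.range (Pi.basisFun ℝ (Fin d))) := h
  rw [Module.Basis.mem_span_iff_repr_mem] at h2
  choose n hn using h2
  refine ⟨n, ?_⟩
  funext i
  have := hn i
  simpa using this.symm

theorem isFund_cube (d : ℕ) : IsAddFundamentalDomain (latt d) (unitCube d) volume := by
  have h := ZSpan.isAddFundamentalDomain (Pi.basisFun ℝ (Fin d)) (volume : Measure (Fin d → ℝ))
  rw [ZSpan.fundamentalDomain_pi_basisFun] at h
  exact h

theorem measurableSet_unitCube (d : ℕ) : MeasurableSet (unitCube d) :=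
  MeasurableSet.univ_pi fun _ => measurableSet_Ico

theorem isFund_cube_shift (d : ℕ) (y : Fin d → ℝ) :
    IsAddFundamentalDomain (latt d) ((fun x => x + y) ⁻¹' unitCube d) volume := by
  refine (isFund_cube d).preimage_of_equiv (f := fun x => x + y)
    (measurePreserving_add_right volume y).quasiMeasurePreserving (e := id) Function.bijective_id ?_
  intro g x
  simp [AddSubgroup.vadd_def, add_assoc]

theorem measurePreserving_shift (d : ℕ) (y : Fin d → ℝ) :
    MeasurePreserving (fun x => x + y) (volume.restrict ((fun x => x + y) ⁻¹' unitCube d))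
      (cubeVol d) :=
  (measurePreserving_add_right volume y).restrict_preimage (measurableSet_unitCube d)

theorem lintegral_cube_add {d : ℕ} (f : (Fin d → ℝ) → ℝ≥0∞)
    (hp : ∀ (x : Fin d → ℝ) (n : Fin d → ℤ), f (x + fun i => (n i : ℝ)) = f x) (y : Fin d → ℝ) :
    ∫⁻ x in unitCube d, f (x + y) = ∫⁻ x in unitCube d, f x := by
  have hinv : ∀ (g : latt d) x, f (g +ᵥ x) = f x := by
    intro g x
    obtain ⟨n, hn⟩ := latt_mem g
    rw [AddSubgroup.vadd_def, vadd_eq_add, add_comm, hn, hp]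
  have h1 : ∫⁻ x in ((fun x => x + y) ⁻¹' unitCube d), f (x + y) = ∫⁻ x in unitCube d, f x := by
    have := (measurePreserving_shift d y).lintegral_comp_emb
      (MeasurableEquiv.addRight y).measurableEmbedding f
    simpa [cubeVol] using this
  rw [← h1]
  refine (isFund_cube d).setLIntegral_eq (isFund_cube_shift d y) (fun x => f (x + y)) ?_
  intro g x
  have := hinv g (x + y)
  rw [AddSubgroup.vadd_def, vadd_eq_add] at this ⊢
  rw [add_assoc, this]

theorem integral_cube_add {d : ℕ} {E : Type*} [NormedAddCommGroup E] [NormedSpace ℝ E]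
    (f : (Fin d → ℝ) → E) (hp : SpacePeriodic f) (y : Fin d → ℝ) :
    ∫ x in unitCube d, f (x + y) = ∫ x in unitCube d, f x := by
  have hinv : ∀ (g : latt d) x, f (g +ᵥ x) = f x := by
    intro g x
    obtain ⟨n, hn⟩ := latt_mem g
    rw [AddSubgroup.vadd_def, vadd_eq_add, add_comm, hn, hp]
  have h1 : ∫ x in ((fun x => x + y) ⁻¹' unitCube d), f (x + y) = ∫ x in unitCube d, f x := by
    have := (measurePreserving_shift d y).integral_comp
      (MeasurableEquiv.addRight y).measurableEmbedding f
    simpa [cubeVol] using this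
  rw [← h1]
  refine (isFund_cube d).setIntegral_eq (isFund_cube_shift d y) (f := fun x => f (x + y)) ?_
  intro g x
  have := hinv g (x + y)
  rw [AddSubgroup.vadd_def, vadd_eq_add] at this ⊢
  rw [add_assoc, this]

theorem integrable_cube_add {d : ℕ}
    (f : (Fin d → ℝ) → ℝ) (hf : Measurable f) (hp : SpacePeriodic f)
    (hi : Integrable f (cubeVol d)) (y : Fin d → ℝ) :
    Integrable (fun x => f (x + y)) (cubeVol d) := by
  refine ⟨(hf.comp (measurable_add_const y)).aestronglyMeasurable, ?_⟩
  have h2 := hi.2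
  unfold HasFiniteIntegral cubeVol at *
  rwa [lintegral_cube_add (fun x => ‖f x‖ₑ) (fun x n => by simp only [hp x n])]

instance cubeVol_isProb (d : ℕ) : IsProbabilityMeasure (cubeVol d) := by
  constructor
  simp [cubeVol, unitCube, volume_pi_pi]

theorem continuous_integrable_cube {d : ℕ} {f : (Fin d → ℝ) → ℝ} (hf : Continuous f) :
    Integrable f (cubeVol d) := by
  have : IntegrableOn f (Set.univ.pi fun _ : Fin d => Set.Icc (0 : ℝ) 1) volume :=
    hf.continuousOn.integrableOn_compact (isCompact_univ_pi fun _ => isCompact_Icc)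
  exact this.mono_set (Set.pi_mono fun _ _ => Set.Ico_subset_Icc_self)

/-- Integration by parts on the torus. -/
theorem integral_cube_deriv {d : ℕ} (i : Fin d) (H D : (Fin d → ℝ) → ℝ)
    (hp : SpacePeriodic H) (hpD : SpacePeriodic D) (hD : Continuous D)
    (hder : ∀ x, HasDerivAt (fun s : ℝ => H (x + s • (Pi.single i 1 : Fin d → ℝ))) (D x) 0) :
    ∫ x in unitCube d, D x = 0 := by
  set e : Fin d → ℝ := Pi.single i 1 with he
  have h1 : ∀ x (s : ℝ), HasDerivAt (fun s : ℝ => H (x + s • e)) (D (x + s • e)) s := by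
    intro x s
    have h := hder (x + s • e)
    have h2 : HasDerivAt (fun r : ℝ => H (x + s • e + r • e)) (D (x + s • e)) (s - s) := by
      simpa using h
    have h3 := h2.comp_sub_const s s
    refine h3.congr_of_eventuallyEq (Filter.Eventually.of_forall fun r => ?_)
    simp only
    congr 1
    rw [add_assoc, ← add_smul]; congr 2; ring
  have h2 : ∀ x, ∫ s in (0 : ℝ)..1, D (x + s • e) = 0 := by
    intro x
    rw [intervalIntegral.integral_eq_sub_of_hasDerivAt (fun s _ => h1 x s)
      (by apply Continuous.intervalIntegrable; fun_prop)]
    have := hp x (Pi.single i 1)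
    have h3 : (fun j => ((Pi.single i 1 : Fin d → ℤ) j : ℝ)) = e := by
      funext j; by_cases hj : j = i
      · subst hj; simp [he]
      · simp [he, hj]
    rw [h3] at this
    simp [this]
  have h3 : ∫ s in (0 : ℝ)..1, ∫ x in unitCube d, D (x + s • e) = ∫ x in unitCube d, D x := by
    rw [intervalIntegral.integral_congr (g := fun _ => ∫ x in unitCube d, D x)
      (fun s _ => integral_cube_add D hpD (s • e))]
    simp
  rw [← h3]
  rw [intervalIntegral_integral_swap]
  · simp [h2]
  · have hc : Continuous (Function.uncurry fun (s : ℝ) (x : Fin d → ℝ) => D (x + s • e)) := by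
      unfold Function.uncurry; fun_prop
    have hInt0 : IntegrableOn (Function.uncurry fun (s : ℝ) (x : Fin d → ℝ) => D (x + s • e))
        (Set.Icc (0:ℝ) 1 ×ˢ (Set.univ.pi fun _ : Fin d => Set.Icc (0 : ℝ) 1)) volume :=
      hc.continuousOn.integrableOn_compact
        (isCompact_Icc.prod (isCompact_univ_pi fun _ => isCompact_Icc))
    have := hInt0.mono_set (s := (Set.uIoc (0:ℝ) 1 ×ˢ unitCube d)) (by
      apply Set.prod_mono
      · rw [Set.uIoc_of_le zero_le_one]; exact Set.Ioc_subset_Icc_self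
      · exact (Set.pi_mono fun _ _ => Set.Ico_subset_Icc_self))
    rw [IntegrableOn, Measure.volume_eq_prod, ← Measure.prod_restrict] at this
    exact this

end part1

section part2

/-! ### Periodic kernels and convolution on the torus -/

/-- Partial derivative of a kernel. -/
def dKer {d : ℕ} (K : (Fin d → ℝ) → ℝ) (i : Fin d) (w : Fin d → ℝ) : ℝ :=
  fderiv ℝ K w (Pi.single i 1)

/-- A normalized positive periodic smooth kernel with `|∇K| ≤ L K`. -/
structure IsKer (d : ℕ) (L : ℝ) (K : (Fin d → ℝ) → ℝ) : Prop where
  smooth : ContDiff ℝ (⊤ : ℕ∞) K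
  periodic : SpacePeriodic K
  pos : ∀ w, 0 < K w
  int_one : ∫ w in unitCube d, K w = 1
  der : ∀ i w, |dKer K i w| ≤ L * K w

/-- Convolution on the torus. -/
def conv {d : ℕ} (K h : (Fin d → ℝ) → ℝ) (x : Fin d → ℝ) : ℝ :=
  ∫ w in unitCube d, K (w - x) * h w

theorem periodic_bounded {d : ℕ} {f : (Fin d → ℝ) → ℝ} (hp : SpacePeriodic f)
    (hc : Continuous f) : ∃ B, 0 ≤ B ∧ ∀ x, |f x| ≤ B := by
  obtain ⟨B, hB⟩ := (isCompact_univ_pi fun _ : Fin d => isCompact_Icc (a := (0:ℝ)) (b := 1)).exists_bound_of_continuousOn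
    hc.continuousOn
  have h0 : ∀ x, |f x| ≤ B := by
    intro x
    have h := hp (fun i => Int.fract (x i)) (fun i => ⌊x i⌋)
    have h2 : ((fun i => Int.fract (x i)) + fun i => ((⌊x i⌋ : ℤ) : ℝ)) = x := by
      funext i; simp
    rw [h2] at h
    rw [h]
    exact hB _ (fun i _ => ⟨Int.fract_nonneg _, (Int.fract_lt_one _).le⟩)
  exact ⟨B, (abs_nonneg _).trans (h0 0), h0⟩

theorem IsKer.continuous {d : ℕ} {L : ℝ} {K : (Fin d → ℝ) → ℝ} (hK : IsKer d L K) : Continuous K :=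
  hK.smooth.continuous

theorem IsKer.d_continuous {d : ℕ} {L : ℝ} {K : (Fin d → ℝ) → ℝ} (hK : IsKer d L K) (i : Fin d) :
    Continuous (dKer K i) := by
  unfold dKer
  have := hK.smooth.continuous_fderiv (by simp)
  fun_prop

theorem periodic_fderiv {d : ℕ} {K : (Fin d → ℝ) → ℝ} (hK : SpacePeriodic K) (i : Fin d) :
    SpacePeriodic (dKer K i) := by
  intro x n
  unfold dKer
  have : (fun y => K (y + fun i => (n i : ℝ))) = K := by funext y; exact hK y n
  conv_rhs => rw [← this]
  rw [fderiv_comp_add_right]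

theorem periodic_sub_int {d : ℕ} {E : Type*} [NormedAddCommGroup E]
    {f : (Fin d → ℝ) → E} (hp : SpacePeriodic f) (x : Fin d → ℝ) (n : Fin d → ℤ) :
    f (x - fun i => (n i : ℝ)) = f x := by
  have := hp x (-n)
  rw [← this]; congr 1; funext i; simp [sub_eq_add_neg]

theorem conv_periodic {d : ℕ} {K h : (Fin d → ℝ) → ℝ} (hp : SpacePeriodic K) :
    SpacePeriodic (conv K h) := by
  intro x n
  unfold conv
  congr 1; funext w
  rw [← sub_sub, periodic_sub_int hp]

theorem conv_integrand_integrable {d : ℕ} {K h : (Fin d → ℝ) → ℝ} (hp : SpacePeriodic K)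
    (hc : Continuous K) (hh : Integrable h (cubeVol d)) (x : Fin d → ℝ) :
    Integrable (fun w => K (w - x) * h w) (cubeVol d) := by
  obtain ⟨B, _, hB⟩ := periodic_bounded hp hc
  exact hh.bdd_mul (c := B) (by fun_prop : Continuous fun w => K (w - x)).aestronglyMeasurable
    (Filter.Eventually.of_forall fun w => hB _)

theorem conv_continuous {d : ℕ} {K h : (Fin d → ℝ) → ℝ} (hp : SpacePeriodic K)
    (hc : Continuous K) (hh : Integrable h (cubeVol d)) : Continuous (conv K h) := by
  obtain ⟨B, _, hB⟩ := periodic_bounded hp hc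
  unfold conv
  refine continuous_of_dominated (bound := fun w => B * |h w|) ?_ ?_ ?_ ?_
  · intro x; exact (conv_integrand_integrable hp hc hh x).aestronglyMeasurable
  · intro x
    refine Filter.Eventually.of_forall fun w => ?_
    rw [Real.norm_eq_abs, abs_mul]
    gcongr
    exact hB _
  · exact (hh.abs.const_mul B)
  · refine Filter.Eventually.of_forall fun w => ?_
    fun_prop

theorem conv_abs_le {d : ℕ} {K h : (Fin d → ℝ) → ℝ} {B : ℝ} (hB : ∀ x, |K x| ≤ B)
    (hh : Integrable h (cubeVol d)) (x : Fin d → ℝ) :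
    |conv K h x| ≤ B * ∫ w in unitCube d, |h w| := by
  unfold conv
  rw [← integral_const_mul]
  refine norm_integral_le_of_norm_le (f := fun w => K (w - x) * h w) (hh.abs.const_mul B) ?_
  refine Filter.Eventually.of_forall fun w => ?_
  rw [Real.norm_eq_abs, abs_mul]
  gcongr
  exact hB _

theorem conv_hasDerivAt {d : ℕ} {L : ℝ} {K h : (Fin d → ℝ) → ℝ} (hK : IsKer d L K)
    (hh : Integrable h (cubeVol d)) (i : Fin d) (x : Fin d → ℝ) :
    HasDerivAt (fun s : ℝ => conv K h (x + s • (Pi.single i 1 : Fin d → ℝ)))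
      (conv (fun w => - dKer K i w) h x) 0 := by
  set e : Fin d → ℝ := Pi.single i 1 with he
  obtain ⟨B, _, hB⟩ := periodic_bounded (periodic_fderiv hK.periodic i) (hK.d_continuous i)
  have hdiff : ∀ w, HasFDerivAt K (fderiv ℝ K w) w := fun w =>
    (hK.smooth.differentiable (by simp) w).hasFDerivAt
  have hd : ∀ w (s : ℝ), HasDerivAt (fun s : ℝ => K (w - (x + s • e)))
      (- dKer K i (w - (x + s • e))) s := by
    intro w s
    have h1 : HasDerivAt (fun s : ℝ => w - (x + s • e)) (-e) s := by
      have := (((hasDerivAt_id s).smul_const e).const_add x).const_sub w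
      simpa using this
    have := (hdiff (w - (x + s • e))).comp_hasDerivAt s h1
    rw [map_neg] at this
    exact this
  have key := hasDerivAt_integral_of_dominated_loc_of_deriv_le
    (μ := cubeVol d) (F := fun (s : ℝ) w => K (w - (x + s • e)) * h w)
    (F' := fun (s : ℝ) w => - dKer K i (w - (x + s • e)) * h w) (x₀ := 0)
    (s := Set.univ) (bound := fun w => B * |h w|) Filter.univ_mem
    (Filter.Eventually.of_forall fun s =>
      (conv_integrand_integrable hK.periodic hK.continuous hh (x + s • e)).aestronglyMeasurable)
    (conv_integrand_integrable hK.periodic hK.continuous hh _) ?_ ?_ (hh.abs.const_mul B) ?_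
  · have := key.2
    simpa [conv, cubeVol] using this
  · have := conv_integrand_integrable (K := fun w => - dKer K i w)
      (fun x n => by simp only [periodic_fderiv hK.periodic i x n])
      (hK.d_continuous i).neg hh (x + (0:ℝ) • e)
    exact this.aestronglyMeasurable
  · refine Filter.Eventually.of_forall fun w s _ => ?_
    rw [Real.norm_eq_abs, abs_mul, abs_neg]
    gcongr
    exact hB _
  · refine Filter.Eventually.of_forall fun w s _ => ?_
    exact (hd w s).mul_const (h w)

/-- Shifted form of the convolution. -/
theorem conv_eq_shift {d : ℕ} {K h : (Fin d → ℝ) → ℝ} (hp : SpacePeriodic K)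
    (hh : SpacePeriodic h) (x : Fin d → ℝ) :
    conv K h x = ∫ w in unitCube d, K w * h (x + w) := by
  unfold conv
  rw [← integral_cube_add (fun w => K (w - x) * h w) ?_ x]
  · congr 1; funext w; rw [add_sub_cancel_right, add_comm w x]
  · intro w n
    simp only
    rw [hh, add_sub_right_comm, hp]

/-- The probability measure with density `K` on the torus. -/
def kerMeas {d : ℕ} (K : (Fin d → ℝ) → ℝ) : Measure (Fin d → ℝ) :=
  (cubeVol d).withDensity fun w => ENNReal.ofReal (K w)

theorem IsKer.isProb {d : ℕ} {L : ℝ} {K : (Fin d → ℝ) → ℝ} (hK : IsKer d L K) :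
    IsProbabilityMeasure (kerMeas K) := by
  constructor
  rw [kerMeas, withDensity_apply _ MeasurableSet.univ, Measure.restrict_univ,
    ← ofReal_integral_eq_lintegral_ofReal (continuous_integrable_cube hK.continuous)
      (Filter.Eventually.of_forall fun w => (hK.pos w).le)]
  have := hK.int_one
  rw [cubeVol, this]; simp

theorem IsKer.integral_kerMeas {d : ℕ} {L : ℝ} {K : (Fin d → ℝ) → ℝ} (hK : IsKer d L K)
    (h : (Fin d → ℝ) → ℝ) : ∫ w, h w ∂(kerMeas K) = ∫ w in unitCube d, K w * h w := by
  have := integral_withDensity_eq_integral_toReal_smul (μ := cubeVol d)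
    (f := fun w => ENNReal.ofReal (K w)) (hK.continuous.measurable.ennreal_ofReal)
    (Filter.Eventually.of_forall fun w => by simp) h
  rw [kerMeas, this]
  simp [cubeVol, (hK.pos _).le]

theorem IsKer.lintegral_kerMeas {d : ℕ} {L : ℝ} {K : (Fin d → ℝ) → ℝ} (hK : IsKer d L K)
    (h : (Fin d → ℝ) → ℝ≥0∞) (hh : Measurable h) :
    ∫⁻ w, h w ∂(kerMeas K) = ∫⁻ w in unitCube d, ENNReal.ofReal (K w) * h w := by
  rw [kerMeas, lintegral_withDensity_eq_lintegral_mul _ hK.continuous.measurable.ennreal_ofReal hh]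
  rfl

theorem IsKer.integrable_kerMeas {d : ℕ} {L : ℝ} {K : (Fin d → ℝ) → ℝ} (hK : IsKer d L K)
    {h : (Fin d → ℝ) → ℝ} (hh : Integrable h (cubeVol d)) : Integrable h (kerMeas K) := by
  rw [kerMeas, integrable_withDensity_iff_integrable_smul' (hK.continuous.measurable.ennreal_ofReal)
    (Filter.Eventually.of_forall fun w => by simp)]
  have := conv_integrand_integrable hK.periodic hK.continuous hh 0
  simpa [(hK.pos _).le] using this

theorem IsKer.conv_eq {d : ℕ} {L : ℝ} {K h : (Fin d → ℝ) → ℝ} (hK : IsKer d L K)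
    (hh : SpacePeriodic h) (x : Fin d → ℝ) : conv K h x = ∫ w, h (x + w) ∂(kerMeas K) := by
  rw [conv_eq_shift hK.periodic hh, hK.integral_kerMeas (fun w => h (x + w))]

theorem IsKer.dconv_abs_le {d : ℕ} {L : ℝ} {K h : (Fin d → ℝ) → ℝ} (hK : IsKer d L K)
    (i : Fin d) (hi : Integrable h (cubeVol d)) :
    |∫ w in unitCube d, - dKer K i w * h w| ≤ L * ∫ w, |h w| ∂(kerMeas K) := by
  rw [hK.integral_kerMeas, ← integral_const_mul]
  have h1 := conv_integrand_integrable hK.periodic hK.continuous hi.abs 0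
  simp only [sub_zero] at h1
  refine norm_integral_le_of_norm_le (f := fun w => - dKer K i w * h w) (h1.const_mul L) ?_
  refine Filter.Eventually.of_forall fun w => ?_
  rw [Real.norm_eq_abs, abs_mul, abs_neg, ← mul_assoc]
  gcongr
  exact hK.der i w

end part2

section part3

/-! ### A concrete kernel -/

/-- one-dimensional profile -/
def hker (ε s : ℝ) : ℝ := Real.sqrt (1 + (Real.sin (Real.pi * s) / ε) ^ 2)

theorem hker_contDiff (ε : ℝ) : ContDiff ℝ (⊤ : ℕ∞) (hker ε) := by
  unfold hker
  refine ContDiff.sqrt ?_ ?_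
  · exact contDiff_const.add (((Real.contDiff_sin.comp (contDiff_const.mul contDiff_id)).div_const _).pow 2)
  · intro s; positivity

theorem hker_periodic (ε s : ℝ) (n : ℤ) : hker ε (s + n) = hker ε s := by
  unfold hker
  congr 2
  rw [div_pow, div_pow, mul_add, mul_comm Real.pi (n : ℝ), Real.sin_add_int_mul_pi, mul_pow]
  congr 1
  rcases Int.even_or_odd n with h | h
  · simp [h.neg_one_zpow]
  · simp [h.neg_one_zpow]

theorem hker_nonneg (ε s : ℝ) : 0 ≤ hker ε s := Real.sqrt_nonneg _

theorem hker_deriv_le {ε : ℝ} (hε : 0 < ε) (s : ℝ) : |deriv (hker ε) s| ≤ Real.pi / ε := by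
  have h1 : HasDerivAt (fun s : ℝ => Real.sin (Real.pi * s) / ε)
      (Real.cos (Real.pi * s) * Real.pi / ε) s := by
    have := ((Real.hasDerivAt_sin (Real.pi * s)).comp s ((hasDerivAt_id s).const_mul Real.pi)).div_const ε
    simpa using this
  set u := Real.sin (Real.pi * s) / ε with hu
  have h2 : HasDerivAt (hker ε) _ s := (((h1.fun_pow 2).const_add 1).sqrt
    (by show 1 + (Real.sin (Real.pi * s) / ε) ^ 2 ≠ 0; positivity))
  rw [h2.deriv]
  have hpos : 0 < Real.sqrt (1 + u ^ 2) := Real.sqrt_pos.2 (by positivity)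
  have hle : |u| ≤ Real.sqrt (1 + u ^ 2) := by
    rw [← Real.sqrt_sq_eq_abs]; exact Real.sqrt_le_sqrt (by linarith)
  rw [abs_div, div_le_iff₀ (by positivity)]
  simp only [Nat.cast_ofNat, Nat.add_one_sub_one, pow_one]
  rw [← hu]
  clear_value u
  rw [abs_mul, abs_mul, abs_div, abs_mul, abs_of_pos hε, abs_of_pos Real.pi_pos, abs_mul, abs_two, abs_of_pos hpos]
  have := Real.abs_cos_le_one (Real.pi * s)
  calc 2 * |u| * (|Real.cos (Real.pi * s)| * Real.pi / ε) ≤ 2 * Real.sqrt (1 + u^2) * (1 * Real.pi / ε) := by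
        gcongr
    _ = _ := by ring

theorem hker_lower {ε : ℝ} (hε : 0 < ε) (s : ℝ) : 2 * |s - round s| / ε ≤ hker ε s := by
  have h1 : hker ε s = hker ε (s - round s) := by
    have := hker_periodic ε (s - round s) (round s)
    rw [← this]; congr 1; ring
  rw [h1]
  set r := s - round s with hr
  have hr2 : |r| ≤ 1 / 2 := abs_sub_round s
  have h2 : 2 / Real.pi * |Real.pi * r| ≤ |Real.sin (Real.pi * r)| := by
    apply Real.mul_abs_le_abs_sin
    rw [abs_mul, abs_of_pos Real.pi_pos]
    nlinarith [Real.pi_pos]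
  rw [abs_mul, abs_of_pos Real.pi_pos] at h2
  have h3 : 2 / Real.pi * (Real.pi * |r|) = 2 * |r| := by
    field_simp
  rw [h3] at h2
  unfold hker
  calc 2 * |r| / ε ≤ |Real.sin (Real.pi * r)| / ε := by gcongr
    _ = |Real.sin (Real.pi * r) / ε| := by rw [abs_div, abs_of_pos hε]
    _ = Real.sqrt ((Real.sin (Real.pi * r) / ε) ^ 2) := (Real.sqrt_sq_eq_abs _).symm
    _ ≤ _ := Real.sqrt_le_sqrt (by linarith)

theorem hker_upper {ε s : ℝ} (hε : 0 < ε) (h0 : 0 ≤ s) (h1 : s ≤ ε) : hker ε s ≤ 5 := by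
  unfold hker
  rw [show (5:ℝ) = Real.sqrt (5 ^ 2) from (Real.sqrt_sq (by norm_num)).symm]
  apply Real.sqrt_le_sqrt
  have h2 : |Real.sin (Real.pi * s) / ε| ≤ 4 := by
    rw [abs_div, abs_of_pos hε, div_le_iff₀ hε]
    have h3 : |Real.sin (Real.pi * s)| ≤ |Real.pi * s| := Real.abs_sin_le_abs
    rw [abs_of_nonneg (by positivity : 0 ≤ Real.pi * s)] at h3
    nlinarith [Real.pi_le_four, Real.pi_pos]
  have := sq_le_sq' (by linarith [(abs_le.1 h2).1]) (abs_le.1 h2).2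
  linarith

/-- Integral of a product over the cube. -/
theorem integral_cube_prod {d : ℕ} (f : ℝ → ℝ) :
    ∫ w in unitCube d, ∏ i, f (w i) = (∫ s in Set.Ico (0:ℝ) 1, f s) ^ d := by
  rw [unitCube, volume_pi, Measure.restrict_pi_pi, integral_fintype_prod_eq_pow]
  simp

theorem hker_int_upper {ε : ℝ} (hε : 0 < ε) :
    ∫ s in Set.Ico (0:ℝ) 1, Real.exp (-(hker ε s / 2)) ≤ 2 * ε := by
  have hc : Continuous (hker ε) := (hker_contDiff ε).continuous
  have e1 : ∫ s in (0:ℝ)..1, Real.exp (-s / ε) = ε - ε * Real.exp (-1 / ε) := by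
    have hd : ∀ s ∈ Set.uIcc (0:ℝ) 1, HasDerivAt (fun s => - ε * Real.exp (-s / ε)) (Real.exp (-s / ε)) s := by
      intro s _
      have := ((((hasDerivAt_id s).neg).div_const ε).exp).const_mul (-ε)
      refine HasDerivAt.congr_deriv this ?_
      show -ε * (Real.exp (-s/ε) * (-1 / ε)) = _
      field_simp
    rw [intervalIntegral.integral_eq_sub_of_hasDerivAt hd]
    · simp; ring
    · exact (by fun_prop : Continuous fun s : ℝ => Real.exp (-s / ε)).intervalIntegrable _ _
  have e2 : ∫ s in (0:ℝ)..1, Real.exp (-(1 - s) / ε) = ε - ε * Real.exp (-1 / ε) := by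
    rw [← e1]
    have := intervalIntegral.integral_comp_sub_left (fun s => Real.exp (-s/ε)) (a := 0) (b := 1) (1:ℝ)
    simpa using this
  rw [integral_Ico_eq_integral_Ioc, ← intervalIntegral.integral_of_le zero_le_one]
  calc ∫ s in (0:ℝ)..1, Real.exp (-(hker ε s / 2))
      ≤ ∫ s in (0:ℝ)..1, (Real.exp (-s / ε) + Real.exp (-(1 - s) / ε)) := by
        refine intervalIntegral.integral_mono_on zero_le_one ?_ ?_ ?_
        · exact (by fun_prop : Continuous fun s : ℝ => Real.exp (-(hker ε s / 2))).intervalIntegrable _ _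
        · exact (by fun_prop : Continuous fun s : ℝ => Real.exp (-s / ε) + Real.exp (-(1 - s) / ε)).intervalIntegrable _ _
        · intro s hs
          have hl := hker_lower hε s
          have hmin : s ≤ |s - round s| ∨ 1 - s ≤ |s - round s| := by
            rcases le_or_gt (round s) 0 with h | h
            · left
              have : (round s : ℝ) ≤ 0 := by exact_mod_cast h
              exact le_trans (by linarith) (le_abs_self _)
            · right
              have : (1:ℝ) ≤ round s := by exact_mod_cast h
              exact le_trans (by linarith) (neg_le_abs _)
          rcases hmin with h | h
          · have : Real.exp (-(hker ε s / 2)) ≤ Real.exp (-s / ε) := by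
              apply Real.exp_le_exp.2
              have : s / ε ≤ |s - round s| / ε := by gcongr
              rw [neg_div]; rw [mul_div_assoc] at hl; linarith
            linarith [Real.exp_pos (-(1 - s) / ε)]
          · have : Real.exp (-(hker ε s / 2)) ≤ Real.exp (-(1-s) / ε) := by
              apply Real.exp_le_exp.2
              have : (1 - s) / ε ≤ |s - round s| / ε := by gcongr
              rw [neg_div]; rw [mul_div_assoc] at hl; linarith
            linarith [Real.exp_pos (-s / ε)]
    _ = (ε - ε * Real.exp (-1 / ε)) + (ε - ε * Real.exp (-1 / ε)) := by
        rw [intervalIntegral.integral_add, e1, e2]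
        · exact (by fun_prop : Continuous fun s : ℝ => Real.exp (-s / ε)).intervalIntegrable _ _
        · exact (by fun_prop : Continuous fun s : ℝ => Real.exp (-(1 - s) / ε)).intervalIntegrable _ _
    _ ≤ _ := by nlinarith [Real.exp_pos (-1/ε)]

theorem hker_int_lower {ε : ℝ} (hε : 0 < ε) (hε1 : ε ≤ 1) :
    ε * Real.exp (-5) ≤ ∫ s in Set.Ico (0:ℝ) 1, Real.exp (-(hker ε s)) := by
  have hc : Continuous (hker ε) := (hker_contDiff ε).continuous
  have hcont : Continuous fun s : ℝ => Real.exp (-(hker ε s)) := by fun_prop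
  calc ε * Real.exp (-5) = ∫ s in Set.Ico (0:ℝ) ε, Real.exp (-5) := by
        simp [hε.le]
    _ ≤ ∫ s in Set.Ico (0:ℝ) ε, Real.exp (-(hker ε s)) := by
        refine setIntegral_mono_on ?_ ?_ measurableSet_Ico ?_
        · simp
        · exact (hcont.integrableOn_Icc).mono_set Set.Ico_subset_Icc_self
        · intro s hs
          apply Real.exp_le_exp.2
          linarith [hker_upper hε hs.1 hs.2.le]
    _ ≤ _ := by
        refine setIntegral_mono_set ((hcont.integrableOn_Icc).mono_set Set.Ico_subset_Icc_self) ?_ ?_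
        · exact Filter.Eventually.of_forall fun s => (Real.exp_pos _).le
        · exact (Set.Ico_subset_Ico_right hε1).eventuallyLE

/-- un-normalized kernel -/
def kraw (d : ℕ) (ε : ℝ) (w : Fin d → ℝ) : ℝ := Real.exp (-∑ i, hker ε (w i))

/-- normalized kernel -/
def ker (d : ℕ) (ε : ℝ) (w : Fin d → ℝ) : ℝ := (∫ z in unitCube d, kraw d ε z)⁻¹ * kraw d ε w

/-- torus distance to zero (ℓ¹) -/
def tN {d : ℕ} (w : Fin d → ℝ) : ℝ := ∑ i, |w i - round (w i)|

theorem tN_nonneg {d : ℕ} (w : Fin d → ℝ) : 0 ≤ tN w := Finset.sum_nonneg fun _ _ => abs_nonneg _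

theorem tN_measurable {d : ℕ} : Measurable (tN : (Fin d → ℝ) → ℝ) := by
  unfold tN
  have hr : Measurable (fun s : ℝ => (round s : ℝ)) := by
    have : (fun s : ℝ => (round s : ℝ)) = fun s => ((⌊s + 1/2⌋ : ℤ) : ℝ) := by
      funext s; rw [round_eq]
    rw [this]
    exact (measurable_from_top (f := fun n : ℤ => (n:ℝ))).comp (Int.measurable_floor.comp (measurable_id.add_const _))
  refine Finset.measurable_sum _ fun i _ => ?_
  have h1 : Measurable fun w : Fin d → ℝ => w i := measurable_pi_apply i
  have h2 := (h1.sub (hr.comp h1))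
  exact continuous_abs.measurable.comp h2

theorem kraw_contDiff (d : ℕ) (ε : ℝ) : ContDiff ℝ (⊤ : ℕ∞) (kraw d ε) := by
  unfold kraw
  refine Real.contDiff_exp.comp (ContDiff.neg (ContDiff.sum fun i _ => ?_))
  exact (hker_contDiff ε).comp (contDiff_apply ℝ ℝ i)

theorem kraw_integral_lower {d : ℕ} {ε : ℝ} (hε : 0 < ε) (hε1 : ε ≤ 1) :
    (ε * Real.exp (-5)) ^ d ≤ ∫ z in unitCube d, kraw d ε z := by
  have : (fun z : Fin d → ℝ => kraw d ε z) = fun z => ∏ i, Real.exp (-(hker ε (z i))) := by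
    funext z
    rw [kraw, ← Finset.sum_neg_distrib, Real.exp_sum]
  rw [this, integral_cube_prod (fun s => Real.exp (-(hker ε s)))]
  have := hker_int_lower hε hε1
  gcongr

theorem kraw_half_integral {d : ℕ} {ε : ℝ} (hε : 0 < ε) :
    ∫ z in unitCube d, Real.exp (-((∑ i, hker ε (z i)) / 2)) ≤ (2 * ε) ^ d := by
  have : (fun z : Fin d → ℝ => Real.exp (-((∑ i, hker ε (z i)) / 2))) = fun z => ∏ i, Real.exp (-(hker ε (z i) / 2)) := by
    funext z
    rw [Finset.sum_div, ← Finset.sum_neg_distrib, Real.exp_sum]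
  rw [this, integral_cube_prod (fun s => Real.exp (-(hker ε s / 2)))]
  have := hker_int_upper hε
  have h0 : 0 ≤ ∫ s in Set.Ico (0:ℝ) 1, Real.exp (-(hker ε s / 2)) := integral_nonneg fun s => (Real.exp_pos _).le
  gcongr

theorem ker_isKer {d : ℕ} {ε : ℝ} (hε : 0 < ε) (hε1 : ε ≤ 1) : IsKer d (Real.pi / ε) (ker d ε) := by
  have hI : 0 < ∫ z in unitCube d, kraw d ε z :=
    lt_of_lt_of_le (by positivity) (kraw_integral_lower hε hε1)
  have hsm : ContDiff ℝ (⊤ : ℕ∞) (ker d ε) := contDiff_const.mul (kraw_contDiff d ε)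
  have hpos : ∀ w, 0 < ker d ε w := fun w => mul_pos (inv_pos.2 hI) (Real.exp_pos _)
  refine ⟨hsm, ?_, hpos, ?_, ?_⟩
  · intro x n
    simp only [ker, kraw, Pi.add_apply, hker_periodic]
  · simp only [ker]
    rw [integral_const_mul, inv_mul_cancel₀ hI.ne']
  · intro i w
    have hdiff : DifferentiableAt ℝ (ker d ε) w := hsm.differentiable (by simp) w
    have h1 : HasDerivAt (fun s : ℝ => ker d ε (w + s • (Pi.single i 1 : Fin d → ℝ)))
        (dKer (ker d ε) i w) 0 := hdiff.hasFDerivAt.hasLineDerivAt _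
    have hh : ∀ s, HasDerivAt (hker ε) (deriv (hker ε) s) s := fun s =>
      ((hker_contDiff ε).differentiable (by simp) s).hasDerivAt
    have h2 : HasDerivAt (fun s : ℝ => ker d ε (w + s • (Pi.single i 1 : Fin d → ℝ)))
        (ker d ε w * - deriv (hker ε) (w i)) 0 := by
      have h3 : ∀ j ∈ Finset.univ, HasDerivAt (fun s : ℝ => hker ε ((w + s • (Pi.single i 1 : Fin d → ℝ)) j))
          (deriv (hker ε) (w j) * (Pi.single i 1 : Fin d → ℝ) j) 0 := by
        intro j _
        have h4 : HasDerivAt (fun s : ℝ => (w + s • (Pi.single i 1 : Fin d → ℝ)) j)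
            ((Pi.single i 1 : Fin d → ℝ) j) 0 := by
          have := ((hasDerivAt_id (0:ℝ)).mul_const ((Pi.single i 1 : Fin d → ℝ) j)).const_add (w j)
          simpa using this
        have h5 : HasDerivAt (hker ε) (deriv (hker ε) (w j)) ((w + (0:ℝ) • (Pi.single i 1 : Fin d → ℝ)) j) := by
          simpa using hh (w j)
        exact HasDerivAt.comp (h₂ := hker ε) (h := fun s : ℝ => (w + s • (Pi.single i 1 : Fin d → ℝ)) j) (0:ℝ) h5 h4
      have h6 := ((HasDerivAt.fun_sum h3).neg.exp).const_mul (∫ z in unitCube d, kraw d ε z)⁻¹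
      refine HasDerivAt.congr_deriv h6 ?_
      simp [ker, kraw, Pi.single_apply, mul_assoc]
    rw [h1.unique h2, abs_mul, abs_neg, abs_of_pos (hpos w), mul_comm]
    exact mul_le_mul_of_nonneg_right (hker_deriv_le hε _) (hpos w).le

theorem rpow_le_exp_half {β : ℝ} (hβ : 0 < β) {x : ℝ} (hx : 0 ≤ x) :
    x ^ β ≤ (2 * β) ^ β * Real.exp (x / 2) := by
  have h1 : x / (2 * β) ≤ Real.exp (x / (2 * β)) := by
    linarith [Real.add_one_le_exp (x / (2 * β))]
  have h2 : (x / (2 * β)) ^ β ≤ (Real.exp (x / (2*β))) ^ β :=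
    Real.rpow_le_rpow (by positivity) h1 hβ.le
  rw [← Real.exp_mul, Real.div_rpow hx (by positivity), div_le_iff₀ (by positivity)] at h2
  rw [mul_comm]
  have h3 : x / (2 * β) * β = x / 2 := by field_simp
  rwa [h3] at h2

/-- Moment bounds. -/
theorem ker_moment (d : ℕ) {β : ℝ} (hβ : 0 < β) : ∃ C : ℝ, 0 ≤ C ∧ ∀ ε : ℝ, 0 < ε → ε ≤ 1 →
    ∫⁻ w, ENNReal.ofReal (tN w ^ β) ∂(kerMeas (ker d ε)) ≤ ENNReal.ofReal (C * ε ^ β) := by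
  refine ⟨(2 * β) ^ β * (2 * Real.exp 5) ^ d, by positivity, ?_⟩
  intro ε hε hε1
  have hK := ker_isKer (d := d) hε hε1
  have hlow := kraw_integral_lower (d := d) hε hε1
  have hI : 0 < ∫ z in unitCube d, kraw d ε z := lt_of_lt_of_le (by positivity) hlow
  have hc : Continuous (hker ε) := (hker_contDiff ε).continuous
  rw [hK.lintegral_kerMeas _ ((tN_measurable.pow_const β).ennreal_ofReal)]
  have hpt : ∀ w : Fin d → ℝ, ker d ε w * tN w ^ β ≤
      ((∫ z in unitCube d, kraw d ε z)⁻¹ * ((2 * β) ^ β * ε ^ β)) * Real.exp (-((∑ i, hker ε (w i)) / 2)) := by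
    intro w
    set X := ∑ i, hker ε (w i) with hX
    have hX0 : 0 ≤ X := Finset.sum_nonneg fun i _ => hker_nonneg _ _
    have hN : tN w ≤ ε * X := by
      have : tN w / ε ≤ X := by
        rw [hX, tN, Finset.sum_div]
        refine Finset.sum_le_sum fun i _ => ?_
        have h1 := hker_lower hε (w i)
        have h2 : 0 ≤ |w i - round (w i)| / ε := by positivity
        rw [mul_div_assoc] at h1
        linarith
      rw [div_le_iff₀ hε] at this; linarith
    have h1 : tN w ^ β ≤ ε ^ β * ((2 * β) ^ β * Real.exp (X / 2)) := by
      calc tN w ^ β ≤ (ε * X) ^ β := Real.rpow_le_rpow (tN_nonneg w) hN hβ.le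
        _ = ε ^ β * X ^ β := Real.mul_rpow hε.le hX0
        _ ≤ _ := by gcongr; exact rpow_le_exp_half hβ hX0
    have h2 : Real.exp (-X) * Real.exp (X / 2) = Real.exp (-(X/2)) := by
      rw [← Real.exp_add]; congr 1; ring
    calc ker d ε w * tN w ^ β ≤ ker d ε w * (ε ^ β * ((2 * β) ^ β * Real.exp (X / 2))) := by
          gcongr; exact (hK.pos w).le
      _ = ((∫ z in unitCube d, kraw d ε z)⁻¹ * ((2 * β) ^ β * ε ^ β)) * (Real.exp (-X) * Real.exp (X/2)) := by
          simp only [ker, kraw, ← hX]; ring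
      _ = _ := by rw [h2]
  calc ∫⁻ w in unitCube d, ENNReal.ofReal (ker d ε w) * ENNReal.ofReal (tN w ^ β)
      ≤ ∫⁻ w in unitCube d, ENNReal.ofReal (((∫ z in unitCube d, kraw d ε z)⁻¹ * ((2 * β) ^ β * ε ^ β)) * Real.exp (-((∑ i, hker ε (w i)) / 2))) := by
        refine lintegral_mono fun w => ?_
        rw [← ENNReal.ofReal_mul (hK.pos w).le]
        exact ENNReal.ofReal_le_ofReal (hpt w)
    _ = ENNReal.ofReal (∫ w in unitCube d, ((∫ z in unitCube d, kraw d ε z)⁻¹ * ((2 * β) ^ β * ε ^ β)) * Real.exp (-((∑ i, hker ε (w i)) / 2))) := by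
        refine (ofReal_integral_eq_lintegral_ofReal ?_ ?_).symm
        · exact continuous_integrable_cube (by fun_prop)
        · exact Filter.Eventually.of_forall fun w => by positivity
    _ ≤ _ := by
        apply ENNReal.ofReal_le_ofReal
        rw [integral_const_mul]
        calc _ ≤ (((ε * Real.exp (-5)) ^ d)⁻¹ * ((2 * β) ^ β * ε ^ β)) * (2 * ε) ^ d := by
              gcongr
              exact kraw_half_integral hε
          _ = _ := by
              have : ((ε * Real.exp (-5)) ^ d)⁻¹ * (2 * ε) ^ d = (2 * Real.exp 5) ^ d := by
                rw [← inv_pow, ← mul_pow]; congr 1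
                rw [Real.exp_neg]; field_simp
              rw [← this]; ring

end part3

section part4

set_option linter.unusedSectionVars false

/-! ### Mollification with bump functions -/

/-- shrinking bumps -/
def bumpSeq (G : Type*) [NormedAddCommGroup G] (n : ℕ) : ContDiffBump (0 : G) :=
  ⟨1 / ((n : ℝ) + 1), 2 / ((n : ℝ) + 1), by positivity, by gcongr; norm_num⟩

/-- mollifier -/
def eta (G : Type*) [NormedAddCommGroup G] [NormedSpace ℝ G] [FiniteDimensional ℝ G]
    [MeasureSpace G] (n : ℕ) : G → ℝ :=
  (bumpSeq G n).normed volume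

/-- mollification -/
def moll {G : Type*} [NormedAddCommGroup G] [NormedSpace ℝ G] [FiniteDimensional ℝ G]
    [MeasureSpace G] (n : ℕ) (h : G → ℝ) : G → ℝ :=
  convolution (eta G n) h (ContinuousLinearMap.lsmul ℝ ℝ) volume

section
variable {G : Type*} [NormedAddCommGroup G] [NormedSpace ℝ G] [FiniteDimensional ℝ G]
    [MeasureSpace G] [BorelSpace G] [(volume : Measure G).IsAddHaarMeasure]

theorem eta_nonneg (n : ℕ) (x : G) : 0 ≤ eta G n x := ContDiffBump.nonneg_normed _ _

theorem eta_contDiff (n : ℕ) : ContDiff ℝ (⊤ : ℕ∞) (eta G n) := ContDiffBump.contDiff_normed _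

theorem eta_compact (n : ℕ) : HasCompactSupport (eta G n) := ContDiffBump.hasCompactSupport_normed _

theorem eta_integral (n : ℕ) : ∫ x, eta G n x = 1 := ContDiffBump.integral_normed _

theorem eta_integrable (n : ℕ) : Integrable (eta G n) volume :=
  (eta_contDiff n).continuous.integrable_of_hasCompactSupport (eta_compact n)

theorem eta_zero (n : ℕ) {x : G} (hx : 2 / ((n:ℝ) + 1) ≤ ‖x‖) : eta G n x = 0 := by
  have h : x ∉ Function.support ((bumpSeq G n).normed (volume : Measure G)) := by
    rw [ContDiffBump.support_normed_eq]
    simp only [Metric.mem_ball, dist_zero_right, not_lt]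
    exact hx
  exact Function.notMem_support.1 h

theorem moll_eq (n : ℕ) (h : G → ℝ) (x : G) : moll n h x = ∫ s, eta G n s * h (x - s) := rfl

theorem moll_eq_swap (n : ℕ) (h : G → ℝ) (x : G) : moll n h x = ∫ s, eta G n (x - s) * h s := by
  unfold moll; rw [convolution_eq_swap]; rfl

theorem bdd_locInt {h : G → ℝ} (hm : Measurable h) {B : ℝ} (hB : ∀ x, |h x| ≤ B) :
    LocallyIntegrable h volume := by
  rw [locallyIntegrable_iff]
  intro k hk
  refine Measure.integrableOn_of_bounded (M := B) hk.measure_lt_top.ne hm.aestronglyMeasurable ?_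
  exact Filter.Eventually.of_forall hB

theorem moll_integrand (n : ℕ) {h : G → ℝ} (hm : Measurable h) {B : ℝ} (hB : ∀ x, |h x| ≤ B) (x : G) :
    Integrable (fun s => eta G n s * h (x - s)) volume := by
  refine (eta_integrable n).mul_bdd (c := B) (hm.comp (by fun_prop)).aestronglyMeasurable
    (Filter.Eventually.of_forall fun s => hB _)

theorem moll_le (n : ℕ) {h : G → ℝ} (hm : Measurable h) {B : ℝ} (hB : ∀ x, |h x| ≤ B) {hi : ℝ}
    (hhi : ∀ x, h x ≤ hi) (x : G) : moll n h x ≤ hi := by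
  rw [moll_eq]
  calc _ ≤ ∫ s, eta G n s * hi := by
        refine integral_mono (moll_integrand n hm hB x) ((eta_integrable n).mul_const _) fun s => ?_
        exact mul_le_mul_of_nonneg_left (hhi _) (eta_nonneg n s)
    _ = hi := by rw [integral_mul_const, eta_integral, one_mul]

theorem le_moll (n : ℕ) {h : G → ℝ} (hm : Measurable h) {B : ℝ} (hB : ∀ x, |h x| ≤ B) {lo : ℝ}
    (hlo : ∀ x, lo ≤ h x) (x : G) : lo ≤ moll n h x := by
  rw [moll_eq]
  calc lo = ∫ s, eta G n s * lo := by rw [integral_mul_const, eta_integral, one_mul]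
    _ ≤ _ := by
        refine integral_mono ((eta_integrable n).mul_const _) (moll_integrand n hm hB x) fun s => ?_
        exact mul_le_mul_of_nonneg_left (hlo _) (eta_nonneg n s)

theorem moll_abs_le (n : ℕ) {h : G → ℝ} (hm : Measurable h) {B : ℝ} (hB : ∀ x, |h x| ≤ B) (x : G) :
    |moll n h x| ≤ B := by
  rw [abs_le]
  exact ⟨le_moll n hm hB (fun x => (abs_le.1 (hB x)).1) x, moll_le n hm hB (fun x => (abs_le.1 (hB x)).2) x⟩

theorem moll_contDiff (n : ℕ) {h : G → ℝ} (hm : Measurable h) {B : ℝ} (hB : ∀ x, |h x| ≤ B) :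
    ContDiff ℝ (⊤ : ℕ∞) (moll n h) :=
  HasCompactSupport.contDiff_convolution_left _ (eta_compact n) (eta_contDiff n) (bdd_locInt hm hB)

theorem moll_tendsto {h : G → ℝ} (hm : Measurable h) {B : ℝ} (hB : ∀ x, |h x| ≤ B) :
    ∀ᵐ x : G, Filter.Tendsto (fun n => moll n h x) Filter.atTop (nhds (h x)) := by
  refine ContDiffBump.ae_convolution_tendsto_right_of_locallyIntegrable (K := 2) ?_ ?_ (bdd_locInt hm hB)
  · have := (tendsto_one_div_add_atTop_nhds_zero_nat (𝕜 := ℝ)).const_mul 2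
    simp only [mul_zero] at this
    refine this.congr fun n => ?_
    simp [bumpSeq, div_eq_mul_inv]
  · refine Filter.Eventually.of_forall fun n => le_of_eq ?_
    simp [bumpSeq, div_eq_mul_inv]

end

/-! ### One-dimensional weak chain rule -/

/-- One-dimensional test functions on `(0,T)`. -/
def IsTest1 (T : ℝ) (ψ : ℝ → ℝ) : Prop :=
  ContDiff ℝ (⊤ : ℕ∞) ψ ∧ ∃ a b : ℝ, 0 < a ∧ b < T ∧ ∀ t, t ∉ Set.Icc a b → ψ t = 0

theorem moll_hasDerivAt_of_weak {T : ℝ} {r g : ℝ → ℝ} (hr : Measurable r) {B : ℝ}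
    (hB : ∀ t, |r t| ≤ B)
    (hw : ∀ ψ, IsTest1 T ψ → ∫ t, deriv ψ t * r t = - ∫ t, ψ t * g t)
    {t : ℝ} {n : ℕ} (h0 : 2 / ((n:ℝ)+1) < t) (h1 : t < T - 2 / ((n:ℝ)+1)) :
    deriv (moll n r) t = moll n g t := by
  have hd := HasCompactSupport.hasDerivAt_convolution_left (ContinuousLinearMap.lsmul ℝ ℝ)
    (eta_compact (G := ℝ) n) ((eta_contDiff (G := ℝ) n).of_le (by simp)) (bdd_locInt hr hB) t
  have hd2 : deriv (moll n r) t = _ := hd.deriv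
  rw [hd2, convolution_eq_swap, moll_eq_swap]
  set ψ : ℝ → ℝ := fun s => eta ℝ n (t - s) with hψ
  have hψd : ∀ s, deriv ψ s = - deriv (eta ℝ n) (t - s) := by
    intro s
    rw [hψ]; exact deriv_comp_const_sub (f := eta ℝ n) t s
  have hT : IsTest1 T ψ := by
    refine ⟨(eta_contDiff n).comp (contDiff_const.sub contDiff_id), t - 2 / ((n:ℝ)+1), t + 2/((n:ℝ)+1), by linarith, by linarith, ?_⟩
    intro s hs
    apply eta_zero
    rw [Real.norm_eq_abs]
    by_contra h
    rw [not_le, abs_lt] at h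
    exact hs ⟨by linarith, by linarith⟩
  have := hw ψ hT
  simp only [hψd] at this
  simp only [ContinuousLinearMap.lsmul_apply, smul_eq_mul]
  have e : ∫ s, -deriv (eta ℝ n) (t - s) * r s = - ∫ s, deriv (eta ℝ n) (t - s) * r s := by
    rw [← integral_neg]; congr 1; funext s; ring
  rw [e] at this
  linarith

theorem weak_chain_rule {ι : Type*} [Fintype ι] {T : ℝ} {r g : ι → ℝ → ℝ} {lo hi : ι → ℝ} {B : ℝ}
    (hr : ∀ k, Measurable (r k)) (hg : ∀ k, Measurable (g k))
    (hbox : ∀ k t, r k t ∈ Set.Icc (lo k) (hi k)) (hgB : ∀ k t, |g k t| ≤ B)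
    (hw : ∀ k ψ, IsTest1 T ψ → ∫ t, deriv ψ t * r k t = - ∫ t, ψ t * g k t)
    (F : (ι → ℝ) → ℝ) (F' : (ι → ℝ) → (ι → ℝ) →L[ℝ] ℝ)
    (hF : ∀ z ∈ Set.Icc lo hi, HasFDerivAt F (F' z) z) (hF' : ContinuousOn F' (Set.Icc lo hi))
    {φ : ℝ → ℝ} (hφ : IsTest1 T φ) :
    ∫ t, deriv φ t * F (fun k => r k t) = - ∫ t, φ t * F' (fun k => r k t) (fun k => g k t) := by
  obtain ⟨hφs, a, b, ha, hb, hsupp⟩ := hφ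
  have hrB : ∀ k, ∃ Bk, ∀ t, |r k t| ≤ Bk := fun k => ⟨max |lo k| |hi k|, fun t =>
    abs_le_max_abs_abs (hbox k t).1 (hbox k t).2⟩
  choose Br hBr using hrB
  set rn : ℕ → ℝ → ι → ℝ := fun n t k => moll n (r k) t with hrn
  have hrn_box : ∀ n t, rn n t ∈ Set.Icc lo hi := fun n t =>
    ⟨fun k => le_moll n (hr k) (hBr k) (fun s => (hbox k s).1) t,
      fun k => moll_le n (hr k) (hBr k) (fun s => (hbox k s).2) t⟩
  have hrn_sm : ∀ n k, ContDiff ℝ (⊤ : ℕ∞) (moll n (r k)) := fun n k => moll_contDiff n (hr k) (hBr k)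
  set gn : ℕ → ℝ → ι → ℝ := fun n t k => deriv (moll n (r k)) t with hgn
  have hrn_cont : ∀ n, Continuous (rn n) := fun n => continuous_pi fun k => (hrn_sm n k).continuous
  have hgn_cont : ∀ n, Continuous (gn n) := fun n => continuous_pi fun k =>
    (hrn_sm n k).continuous_deriv (by simp)
  have hrn_der : ∀ n t, HasDerivAt (rn n) (gn n t) t := fun n t => hasDerivAt_pi.2 fun k =>
    ((hrn_sm n k).differentiable (by simp) t).hasDerivAt
  have hFc : ContinuousOn F (Set.Icc lo hi) := fun z hz => (hF z hz).continuousAt.continuousWithinAt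
  have hbxc : IsCompact (Set.Icc lo hi) := isCompact_Icc
  obtain ⟨BF, hBF⟩ := hbxc.exists_bound_of_continuousOn hFc
  obtain ⟨BF', hBF'⟩ := hbxc.exists_bound_of_continuousOn hF'
  have hφc : HasCompactSupport φ := HasCompactSupport.intro isCompact_Icc hsupp
  have hφd : Continuous (deriv φ) := hφs.continuous_deriv (by simp)
  have hφ'0 : ∀ t, t ∉ Set.Icc a b → deriv φ t = 0 := by
    intro t ht
    have : φ =ᶠ[nhds t] fun _ => 0 := by
      filter_upwards [isClosed_Icc.isOpen_compl.mem_nhds ht] with s hs using hsupp s hs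
    rw [this.deriv_eq]; simp
  -- the identity for each n
  have hn : ∀ n, ∫ t, deriv φ t * F (rn n t) = - ∫ t, φ t * F' (rn n t) (gn n t) := by
    intro n
    have hFrn : Continuous fun t => F (rn n t) := hFc.comp_continuous (hrn_cont n) (hrn_box n)
    have hF'rn : Continuous fun t => F' (rn n t) (gn n t) :=
      (hF'.comp_continuous (hrn_cont n) (hrn_box n)).clm_apply (hgn_cont n)
    have i1 : Integrable (fun t => deriv φ t * F (rn n t)) :=
      (hφd.mul hFrn).integrable_of_hasCompactSupport (hφc.deriv.mul_right)
    have i2 : Integrable (fun t => φ t * F' (rn n t) (gn n t)) :=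
      (hφs.continuous.mul hF'rn).integrable_of_hasCompactSupport (hφc.mul_right)
    have i3 : Integrable (fun t => φ t * F (rn n t)) :=
      (hφs.continuous.mul hFrn).integrable_of_hasCompactSupport (hφc.mul_right)
    have := integral_eq_zero_of_hasDerivAt_of_integrable
      (f := fun t => φ t * F (rn n t)) (f' := fun t => deriv φ t * F (rn n t) + φ t * F' (rn n t) (gn n t))
      (fun t => ((hφs.differentiable (by simp) t).hasDerivAt.mul
        ((hF _ (hrn_box n t)).comp_hasDerivAt t (hrn_der n t)))) (i1.add i2) i3
    rw [integral_add i1 i2] at this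
    linarith
  -- limits
  have hlim_r : ∀ᵐ t : ℝ, Filter.Tendsto (fun n => rn n t) Filter.atTop (nhds fun k => r k t) := by
    have : ∀ᵐ t : ℝ, ∀ k, Filter.Tendsto (fun n => moll n (r k) t) Filter.atTop (nhds (r k t)) :=
      ae_all_iff.2 fun k => moll_tendsto (hr k) (hBr k)
    filter_upwards [this] with t ht using tendsto_pi_nhds.2 ht
  obtain ⟨N, hN⟩ : ∃ N : ℕ, ∀ n ≥ N, 2 / ((n:ℝ)+1) < min a (T - b) := by
    have := (tendsto_one_div_add_atTop_nhds_zero_nat (𝕜 := ℝ)).const_mul 2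
    rw [mul_zero] at this
    have h := this.eventually_lt_const (lt_min ha (sub_pos.2 hb))
    obtain ⟨N, hN⟩ := Filter.eventually_atTop.1 h
    exact ⟨N, fun n hn => by have := hN n hn; rwa [mul_one_div] at this⟩
  have hgn_eq : ∀ n ≥ N, ∀ t ∈ Set.Icc a b, ∀ k, gn n t k = moll n (g k) t := by
    intro n hn t ht k
    have h1 := hN n hn
    have h2 := (lt_min_iff.1 h1)
    exact moll_hasDerivAt_of_weak (hr k) (hBr k) (hw k) (by linarith [ht.1]) (by linarith [ht.2])
  have hlim_g : ∀ᵐ t : ℝ, t ∈ Set.Icc a b → Filter.Tendsto (fun n => gn n t) Filter.atTop (nhds fun k => g k t) := by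
    have : ∀ᵐ t : ℝ, ∀ k, Filter.Tendsto (fun n => moll n (g k) t) Filter.atTop (nhds (g k t)) :=
      ae_all_iff.2 fun k => moll_tendsto (hg k) (hgB k)
    filter_upwards [this] with t ht htab
    refine tendsto_pi_nhds.2 fun k => (ht k).congr' ?_
    filter_upwards [Filter.eventually_ge_atTop N] with n hn using (hgn_eq n hn t htab k).symm
  have hrbox : ∀ t, (fun k => r k t) ∈ Set.Icc lo hi := fun t =>
    ⟨fun k => (hbox k t).1, fun k => (hbox k t).2⟩
  have L1 : Filter.Tendsto (fun n => ∫ t, deriv φ t * F (rn n t)) Filter.atTop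
      (nhds (∫ t, deriv φ t * F (fun k => r k t))) := by
    refine tendsto_integral_of_dominated_convergence (fun t => |deriv φ t| * BF) ?_ ?_ ?_ ?_
    · intro n
      exact (hφd.mul (hFc.comp_continuous (hrn_cont n) (hrn_box n))).aestronglyMeasurable
    · have : Integrable (deriv φ) := hφd.integrable_of_hasCompactSupport hφc.deriv
      exact this.abs.mul_const _
    · intro n
      refine Filter.Eventually.of_forall fun t => ?_
      rw [Real.norm_eq_abs, abs_mul]
      exact mul_le_mul_of_nonneg_left (hBF _ (hrn_box n t)) (abs_nonneg _)
    · filter_upwards [hlim_r] with t ht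
      exact ((hF _ (hrbox t)).continuousAt.tendsto.comp ht).const_mul _
  have L2 : Filter.Tendsto (fun n => ∫ t, φ t * F' (rn n t) (gn n t)) Filter.atTop
      (nhds (∫ t, φ t * F' (fun k => r k t) (fun k => g k t))) := by
    refine tendsto_integral_filter_of_dominated_convergence (fun t => |φ t| * (BF' * |B|)) ?_ ?_ ?_ ?_
    · refine Filter.Eventually.of_forall fun n => ?_
      exact (hφs.continuous.mul ((hF'.comp_continuous (hrn_cont n) (hrn_box n)).clm_apply (hgn_cont n))).aestronglyMeasurable
    · filter_upwards [Filter.eventually_ge_atTop N] with n hn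
      refine Filter.Eventually.of_forall fun t => ?_
      by_cases ht : t ∈ Set.Icc a b
      · rw [Real.norm_eq_abs, abs_mul]
        gcongr
        refine ((F' (rn n t)).le_opNorm (gn n t)).trans ?_
        have h1 := hBF' _ (hrn_box n t)
        have h2 : ‖gn n t‖ ≤ |B| := by
          refine (pi_norm_le_iff_of_nonneg (abs_nonneg _)).2 fun k => ?_
          rw [hgn_eq n hn t ht k]
          exact (moll_abs_le n (hg k) (hgB k) t).trans (le_abs_self _)
        gcongr
        exact (norm_nonneg _).trans h1
      · simp [hsupp t ht]
    · have : Integrable φ := hφs.continuous.integrable_of_hasCompactSupport hφc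
      exact this.abs.mul_const _
    · filter_upwards [hlim_r, hlim_g] with t ht htg
      by_cases hab : t ∈ Set.Icc a b
      · have h1 : Filter.Tendsto (fun n => F' (rn n t)) Filter.atTop (nhds (F' fun k => r k t)) := by
          have := (hF' _ (hrbox t)).tendsto
          refine this.comp (tendsto_nhdsWithin_iff.2 ⟨ht, Filter.Eventually.of_forall fun n => hrn_box n t⟩)
        have h2 : Filter.Tendsto (fun n => (F' (rn n t), gn n t)) Filter.atTop
            (nhds (F' (fun k => r k t), fun k => g k t)) := h1.prodMk_nhds (htg hab)
        have h3 : Continuous fun p : ((ι → ℝ) →L[ℝ] ℝ) × (ι → ℝ) => p.1 p.2 :=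
          continuous_fst.clm_apply continuous_snd
        exact ((h3.tendsto _).comp h2).const_mul _
      · simp [hsupp t hab]
  have L3 := L2.neg
  refine tendsto_nhds_unique L1 (L3.congr fun n => (hn n).symm)

end part4

section part5

/-! ### Gradient bound on translations -/

/-- Hölder inequality where one factor need not be measurable. -/
theorem lintegral_holder_nonmeas {X : Type*} [MeasurableSpace X] {μ : Measure X} {p p' : ℝ}
    (hpq : p.HolderConjugate p') {u F s : X → ℝ≥0∞} (hu : AEMeasurable u μ) (hs : AEMeasurable s μ)
    (hsfin : ∀ᵐ x ∂μ, s x ≠ ∞) (hle : ∀ x, u x ≤ F x * s x) :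
    ∫⁻ x, u x ∂μ ≤ (∫⁻ x, F x ^ p ∂μ) ^ (1 / p) * (∫⁻ x, s x ^ p' ∂μ) ^ (1 / p') := by
  have h1 : ∫⁻ x, u x ∂μ = ∫⁻ x, ((fun x => u x / s x) * s) x ∂μ := by
    refine lintegral_congr_ae ?_
    filter_upwards [hsfin] with x hx
    simp only [Pi.mul_apply]
    by_cases h0 : s x = 0
    · have := hle x
      rw [h0, mul_zero] at this
      simp [h0, le_antisymm this bot_le]
    · rw [ENNReal.div_mul_cancel h0 hx]
  rw [h1]
  refine (ENNReal.lintegral_mul_le_Lp_mul_Lq μ hpq (hu.div hs) hs).trans ?_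
  have hm : ∫⁻ x, (u x / s x) ^ p ∂μ ≤ ∫⁻ x, F x ^ p ∂μ :=
    lintegral_mono fun x => ENNReal.rpow_le_rpow (ENNReal.div_le_of_le_mul (hle x)) hpq.nonneg
  have := ENNReal.rpow_le_rpow hm (z := 1 / p) (one_div_nonneg.2 hpq.nonneg)
  exact mul_le_mul' this le_rfl

theorem ofReal_exp_toReal {p : ℝ} (hp : 0 < p) : (ENNReal.ofReal p).toReal = p := ENNReal.toReal_ofReal hp.le

theorem timeLpOn_ofReal {s : Set ℝ} {p : ℝ} (hp : 0 < p) (F : ℝ → ℝ≥0∞) :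
    timeLpOn s (ENNReal.ofReal p) F = (∫⁻ t in s, F t ^ p) ^ (1 / p) := by
  simp [timeLpOn, ENNReal.toReal_ofReal hp.le]

theorem eLpNorm_ofReal {X E : Type*} [MeasurableSpace X] [NormedAddCommGroup E] {μ : Measure X} {p : ℝ} (hp : 0 < p)
    (f : X → E) : eLpNorm f (ENNReal.ofReal p) μ = (∫⁻ x, ‖f x‖ₑ ^ p ∂μ) ^ (1 / p) := by
  rw [eLpNorm_eq_lintegral_rpow_enorm_toReal (by simpa using hp) (by simp)]
  simp [ENNReal.toReal_ofReal hp.le]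

theorem enorm_integral_mul_le {d : ℕ} {T p p' : ℝ} (hpq : p.HolderConjugate p')
    (G : ℝ → (Fin d → ℝ) → Fin d → ℝ) (S : ℝ → (Fin d → ℝ) → ℝ) (hS : Measurable (Function.uncurry S))
    {B : ℝ} (hB : ∀ t x, |S t x| ≤ B) (i : Fin d) :
    ‖∫ t in Set.Ioo 0 T, ∫ x in unitCube d, G t x i * S t x‖ₑ ≤
      LpLqNorm T (ENNReal.ofReal p) (ENNReal.ofReal p) G *
        (∫⁻ t in Set.Ioo 0 T, ∫⁻ x in unitCube d, ‖S t x‖ₑ ^ p') ^ (1 / p') := by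
  have hp0 := hpq.pos
  have hp0' := hpq.symm.pos
  have hBe : ∀ t x, ‖S t x‖ₑ ≤ ENNReal.ofReal B := by
    intro t x
    rw [← ofReal_norm]; exact ENNReal.ofReal_le_ofReal (hB t x)
  have hSt : ∀ t, Measurable (S t) := fun t => hS.comp (measurable_const.prodMk measurable_id)
  set s : ℝ → ℝ≥0∞ := fun t => (∫⁻ x in unitCube d, ‖S t x‖ₑ ^ p') ^ (1 / p') with hs
  have hsm : Measurable s := by
    have h1 : Measurable fun z : ℝ × (Fin d → ℝ) => ‖S z.1 z.2‖ₑ ^ p' := (hS.enorm).pow_const _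
    exact (Measurable.lintegral_prod_right' h1).pow_const _
  have hsfin : ∀ t, s t ≠ ∞ := by
    intro t
    rw [hs]
    refine ENNReal.rpow_ne_top_of_nonneg (by positivity) ?_
    have : ∫⁻ x in unitCube d, ‖S t x‖ₑ ^ p' ≤ ∫⁻ x, (ENNReal.ofReal B) ^ p' ∂(cubeVol d) := by
      refine lintegral_mono fun x => ?_
      gcongr; exact hBe t x
    refine ne_top_of_le_ne_top ?_ this
    rw [lintegral_const, measure_univ, mul_one]
    exact ENNReal.rpow_ne_top_of_nonneg hp0'.le ENNReal.ofReal_ne_top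
  have hx : ∀ t, ‖∫ x in unitCube d, G t x i * S t x‖ₑ ≤ eLpNorm (G t) (ENNReal.ofReal p) (cubeVol d) * s t := by
    intro t
    by_cases hi : AEStronglyMeasurable (fun x => G t x i * S t x) (volume.restrict (unitCube d))
    · refine (enorm_integral_le_lintegral_enorm _).trans ?_
      have := lintegral_holder_nonmeas (μ := volume.restrict (unitCube d)) hpq (F := fun x => ‖G t x‖ₑ) hi.enorm (hSt t).enorm.aemeasurable
        (Filter.Eventually.of_forall fun x => by simp) (fun x => by
          rw [enorm_mul]; gcongr
          rw [enorm_le_iff_norm_le]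
          exact norm_le_pi_norm _ i)
      rw [eLpNorm_ofReal hp0]
      exact this
    · rw [integral_non_aestronglyMeasurable hi]; simp
  by_cases hi : AEStronglyMeasurable (fun t => ∫ x in unitCube d, G t x i * S t x) (volume.restrict (Set.Ioo 0 T))
  · refine (enorm_integral_le_lintegral_enorm _).trans ?_
    have := lintegral_holder_nonmeas (μ := volume.restrict (Set.Ioo 0 T)) hpq
      (F := fun t => eLpNorm (G t) (ENNReal.ofReal p) (cubeVol d)) hi.enorm hsm.aemeasurable
        (Filter.Eventually.of_forall hsfin) hx
    refine this.trans (le_of_eq ?_)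
    rw [LpLqNorm, timeLpOn_ofReal hp0]
    congr 3
    funext t
    rw [hs]
    simp only
    rw [← ENNReal.rpow_mul, one_div, inv_mul_cancel₀ hp0'.ne', ENNReal.rpow_one]
  · rw [integral_non_aestronglyMeasurable hi]; simp

theorem IsTestFunction.meas {d : ℕ} {T : ℝ} {S : ℝ → (Fin d → ℝ) → ℝ} (hS : IsTestFunction T S) :
    Measurable (Function.uncurry S) := hS.smooth.continuous.measurable

/-- bounded in space-time -/
theorem stperiodic_bounded {d : ℕ} {S : ℝ → (Fin d → ℝ) → ℝ} (hc : Continuous (Function.uncurry S))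
    (hp : ∀ t, SpacePeriodic (S t)) {a b : ℝ} (hs : ∀ t x, t ∉ Set.Icc a b → S t x = 0) :
    ∃ B, 0 ≤ B ∧ ∀ t x, |S t x| ≤ B := by
  obtain ⟨B, hB⟩ := ((isCompact_Icc (a := a) (b := b)).prod (isCompact_univ_pi fun _ : Fin d => isCompact_Icc (a := (0:ℝ)) (b := 1))).exists_bound_of_continuousOn
    hc.continuousOn
  have h0 : ∀ t x, |S t x| ≤ max B 0 := by
    intro t x
    by_cases ht : t ∈ Set.Icc a b
    · have h := hp t (fun i => Int.fract (x i)) (fun i => ⌊x i⌋)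
      have h2 : ((fun i => Int.fract (x i)) + fun i => ((⌊x i⌋ : ℤ) : ℝ)) = x := by
        funext i; simp
      rw [h2] at h
      rw [h]
      exact (hB (t, _) ⟨ht, fun i _ => ⟨Int.fract_nonneg _, (Int.fract_lt_one _).le⟩⟩).trans (le_max_left _ _)
    · rw [hs t x ht]; simp
  exact ⟨max B 0, le_max_right _ _, h0⟩

/-- spatial derivative of a smooth space-time function -/
theorem pderivX_eq {d : ℕ} {S : ℝ → (Fin d → ℝ) → ℝ} (hs : ContDiff ℝ (⊤ : ℕ∞) (Function.uncurry S)) (i : Fin d)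
    (t : ℝ) (x : Fin d → ℝ) :
    pderivX i S t x = fderiv ℝ (Function.uncurry S) (t, x) (0, Pi.single i 1) := by
  unfold pderivX
  have h1 : HasFDerivAt (fun x : Fin d → ℝ => (t, x)) (ContinuousLinearMap.inr ℝ ℝ (Fin d → ℝ)) x :=
    hasFDerivAt_prodMk_right t x
  have h2 := ((hs.differentiable (by simp) (t, x)).hasFDerivAt).comp x h1
  have h3 : fderiv ℝ (S t) x = _ := h2.fderiv
  rw [h3]; simp

theorem pderivX_continuous {d : ℕ} {S : ℝ → (Fin d → ℝ) → ℝ} (hs : ContDiff ℝ (⊤ : ℕ∞) (Function.uncurry S)) (i : Fin d) :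
    Continuous (Function.uncurry (pderivX i S)) := by
  have : Function.uncurry (pderivX i S) = fun z => fderiv ℝ (Function.uncurry S) z (0, Pi.single i 1) := by
    funext z; exact pderivX_eq hs i z.1 z.2
  rw [this]
  have := hs.continuous_fderiv (by simp)
  fun_prop

theorem spaceTime_finite (d : ℕ) (T : ℝ) : IsFiniteMeasure (spaceTime d T) := by
  unfold spaceTime; infer_instance

theorem lintegral_spaceTime {d : ℕ} {T : ℝ} {f : ℝ × (Fin d → ℝ) → ℝ≥0∞} (hf : Measurable f) :
    ∫⁻ z, f z ∂(spaceTime d T) = ∫⁻ t in Set.Ioo 0 T, ∫⁻ x in unitCube d, f (t, x) := by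
  unfold spaceTime
  rw [lintegral_prod _ hf.aemeasurable]
  rfl

theorem integral_spaceTime {d : ℕ} {T : ℝ} {f : ℝ × (Fin d → ℝ) → ℝ} (hf : Integrable f (spaceTime d T)) :
    ∫ z, f z ∂(spaceTime d T) = ∫ t in Set.Ioo 0 T, ∫ x in unitCube d, f (t, x) := by
  unfold spaceTime at *
  rw [integral_prod _ hf]
  rfl

theorem lintegral_spaceTime_shift {d : ℕ} {T : ℝ} {f : ℝ × (Fin d → ℝ) → ℝ≥0∞} (hf : Measurable f)
    (hp : ∀ t (x : Fin d → ℝ) (n : Fin d → ℤ), f (t, x + fun i => (n i : ℝ)) = f (t, x)) (y : Fin d → ℝ) :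
    ∫⁻ z, f (z.1, z.2 + y) ∂(spaceTime d T) = ∫⁻ z, f z ∂(spaceTime d T) := by
  rw [lintegral_spaceTime hf, lintegral_spaceTime (f := fun z => f (z.1, z.2 + y)) (hf.comp (by fun_prop))]
  congr 1; funext t
  exact lintegral_cube_add (fun x => f (t, x)) (hp t) y

theorem integrable_spaceTime_shift {d : ℕ} {T : ℝ} {f : ℝ × (Fin d → ℝ) → ℝ} (hf : Measurable f)
    (hp : ∀ t, SpacePeriodic fun x => f (t, x)) (hi : Integrable f (spaceTime d T)) (y : Fin d → ℝ) :
    Integrable (fun z => f (z.1, z.2 + y)) (spaceTime d T) := by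
  refine ⟨(hf.comp (by fun_prop : Measurable fun z : ℝ × (Fin d → ℝ) => (z.1, z.2 + y))).aestronglyMeasurable, ?_⟩
  have h2 := hi.2
  unfold HasFiniteIntegral at *
  rwa [lintegral_spaceTime_shift (f := fun z => ‖f z‖ₑ) hf.enorm (fun t x n => by
    have := hp t x n
    simp only at this; rw [this]) y]

theorem integral_spaceTime_shift {d : ℕ} {T : ℝ} {f : ℝ × (Fin d → ℝ) → ℝ} (hf : Measurable f)
    (hp : ∀ t, SpacePeriodic fun x => f (t, x)) (hi : Integrable f (spaceTime d T)) (y : Fin d → ℝ) :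
    ∫ z, f (z.1, z.2 + y) ∂(spaceTime d T) = ∫ z, f z ∂(spaceTime d T) := by
  rw [integral_spaceTime hi, integral_spaceTime (integrable_spaceTime_shift hf hp hi y)]
  congr 1; funext t
  exact integral_cube_add (fun x => f (t, x)) (hp t) y

theorem IsTestFunction.shift {d : ℕ} {T : ℝ} {S : ℝ → (Fin d → ℝ) → ℝ} (hS : IsTestFunction T S) (y : Fin d → ℝ) :
    IsTestFunction T fun t x => S t (x + y) := by
  obtain ⟨hs, hp, a, b, ha, hb, hsupp⟩ := hS
  refine ⟨?_, ?_, a, b, ha, hb, fun t x ht => hsupp t _ ht⟩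
  · have : (Function.uncurry fun t x => S t (x + y)) = Function.uncurry S ∘ fun z : ℝ × (Fin d → ℝ) => (z.1, z.2 + y) := rfl
    rw [this]
    exact hs.comp (contDiff_fst.prodMk (contDiff_snd.add contDiff_const))
  · intro t x n
    simp only
    rw [add_right_comm, hp t]

theorem pderivX_shift {d : ℕ} (S : ℝ → (Fin d → ℝ) → ℝ) (y : Fin d → ℝ) (i : Fin d) (t : ℝ) (x : Fin d → ℝ) :
    pderivX i (fun t x => S t (x + y)) t x = pderivX i S t (x + y) := by
  unfold pderivX
  rw [fderiv_comp_add_right]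

theorem pderivX_periodic {d : ℕ} {S : ℝ → (Fin d → ℝ) → ℝ} (hp : ∀ t, SpacePeriodic (S t)) (i : Fin d) (t : ℝ) :
    SpacePeriodic (pderivX i S t) := periodic_fderiv (hp t) i

/-- Step 2 : translation estimate against test functions -/
theorem grad_test_bound {d : ℕ} {T p p' : ℝ} (hpq : p.HolderConjugate p')
    {ρ : ℝ → (Fin d → ℝ) → ℝ} (hρm : Measurable (Function.uncurry ρ))
    (hρi : Integrable (Function.uncurry ρ) (spaceTime d T))
    {G : ℝ → (Fin d → ℝ) → Fin d → ℝ}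
    (hG : ∀ i, HasWeakDerivX T i ρ fun t x => G t x i)
    (hGfin : LpLqNorm T (ENNReal.ofReal p) (ENNReal.ofReal p) G < ∞)
    {S : ℝ → (Fin d → ℝ) → ℝ} (hS : IsTestFunction T S) (y : Fin d → ℝ) :
    |∫ z, ρ z.1 z.2 * (S z.1 (z.2 + y) - S z.1 z.2) ∂(spaceTime d T)| ≤
      (∑ i, |y i|) * (LpLqNorm T (ENNReal.ofReal p) (ENNReal.ofReal p) G).toReal *
        (∫ z, |S z.1 z.2| ^ p' ∂(spaceTime d T)) ^ (1 / p') := by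
  have hp0' := hpq.symm.pos
  have := spaceTime_finite d T
  set CG := (LpLqNorm T (ENNReal.ofReal p) (ENNReal.ofReal p) G) with hCG
  obtain ⟨a, b, ha, hb, hsupp⟩ := hS.supp
  obtain ⟨B, hB0, hB⟩ := stperiodic_bounded hS.smooth.continuous hS.periodic hsupp
  have hdsupp : ∀ i t x, t ∉ Set.Icc a b → pderivX i S t x = 0 := by
    intro i t x ht
    unfold pderivX
    have : S t = fun _ => 0 := by funext x; exact hsupp t x ht
    rw [this]; simp
  have hdb : ∀ i, ∃ B, 0 ≤ B ∧ ∀ t x, |pderivX i S t x| ≤ B := fun i =>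
    stperiodic_bounded (pderivX_continuous hS.smooth i) (pderivX_periodic hS.periodic i) (hdsupp i)
  choose D hD0 hD using hdb
  -- the p' norm is translation invariant
  have hSp : ∀ w, ∫⁻ t in Set.Ioo 0 T, ∫⁻ x in unitCube d, ‖S t (x + w)‖ₑ ^ p' =
      ENNReal.ofReal (∫ z, |S z.1 z.2| ^ p' ∂(spaceTime d T)) := by
    intro w
    have hm : Measurable fun z : ℝ × (Fin d → ℝ) => ‖S z.1 z.2‖ₑ ^ p' := hS.meas.enorm.pow_const _
    have e1 : ∀ t, ∫⁻ x in unitCube d, ‖S t (x + w)‖ₑ ^ p' = ∫⁻ x in unitCube d, ‖S t x‖ₑ ^ p' := fun t =>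
      lintegral_cube_add (fun x => ‖S t x‖ₑ ^ p') (fun x n => by simp only [hS.periodic t x n]) w
    simp only [e1]
    rw [← lintegral_spaceTime hm, ofReal_integral_eq_lintegral_ofReal]
    · congr 1; funext z
      rw [← ofReal_norm, ENNReal.ofReal_rpow_of_nonneg (norm_nonneg _) hp0'.le, Real.norm_eq_abs]
    · refine Integrable.of_bound (C := B ^ p') ?_ ?_
      · exact ((continuous_abs.measurable.comp hS.meas).pow_const _).aestronglyMeasurable
      · refine Filter.Eventually.of_forall fun z => ?_
        rw [Real.norm_of_nonneg (by positivity)]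
        exact Real.rpow_le_rpow (abs_nonneg _) (hB _ _) hp0'.le
    · exact Filter.Eventually.of_forall fun z => by positivity
  set Q := (∫ z, |S z.1 z.2| ^ p' ∂(spaceTime d T)) with hQ
  have hQ0 : 0 ≤ Q := integral_nonneg fun z => by positivity
  have hInt0 : ∀ {f : ℝ → (Fin d → ℝ) → ℝ} {B : ℝ}, Measurable (Function.uncurry f) → (∀ t x, |f t x| ≤ B) →
      Integrable (fun z : ℝ × (Fin d → ℝ) => ρ z.1 z.2 * f z.1 z.2) (spaceTime d T) := by
    intro f B hf hB
    exact hρi.mul_bdd (c := B) hf.aestronglyMeasurable (Filter.Eventually.of_forall fun z => hB _ _)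
  have hmd : ∀ i w, Measurable (Function.uncurry fun t x => pderivX i S t (x + w)) := by
    intro i w
    exact (pderivX_continuous hS.smooth i).measurable.comp (by fun_prop : Measurable fun z : ℝ × (Fin d → ℝ) => (z.1, z.2 + w))
  -- derivative bound
  have hder : ∀ i w, |∫ z, ρ z.1 z.2 * pderivX i S z.1 (z.2 + w) ∂(spaceTime d T)| ≤ CG.toReal * Q ^ (1 / p') := by
    intro i w
    rw [integral_spaceTime (hInt0 (hmd i w) (fun t x => hD i t _))]
    have h1 := hG i _ (hS.shift w)
    simp only [pderivX_shift] at h1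
    simp only
    rw [h1, abs_neg]
    have h2 := enorm_integral_mul_le (T := T) hpq G _ (hS.shift w).meas (fun t x => hB t (x + w)) i
    rw [hSp w, ← ofReal_norm, ← hCG, ENNReal.ofReal_rpow_of_nonneg hQ0 (by positivity),
      ← ENNReal.ofReal_toReal hGfin.ne, ← ENNReal.ofReal_mul (by positivity)] at h2
    exact (ENNReal.ofReal_le_ofReal_iff (by positivity)).1 h2
  -- mean value
  set q : ℝ → ℝ := fun s => ∫ z, ρ z.1 z.2 * S z.1 (z.2 + s • y) ∂(spaceTime d T) with hq
  have hmS : ∀ w, Measurable (Function.uncurry fun t x => S t (x + w)) := fun w => (hS.shift w).meas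
  have hSd : ∀ t x (s : ℝ), HasDerivAt (fun s : ℝ => S t (x + s • y)) (∑ i, y i * pderivX i S t (x + s • y)) s := by
    intro t x s
    have hdiff : DifferentiableAt ℝ (S t) (x + s • y) := by
      have : ContDiff ℝ (⊤ : ℕ∞) (S t) := hS.smooth.comp (contDiff_const.prodMk contDiff_id)
      exact this.differentiable (by simp) _
    have h1 : HasDerivAt (fun s : ℝ => x + s • y) y s := by
      have := ((hasDerivAt_id s).smul_const y).const_add x
      simpa using this
    have := hdiff.hasFDerivAt.comp_hasDerivAt s h1
    refine HasDerivAt.congr_deriv this ?_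
    unfold pderivX
    generalize fderiv ℝ (S t) (x + s • y) = A
    conv_lhs => rw [pi_eq_sum_univ' y]
    rw [map_sum]
    refine Finset.sum_congr rfl fun i _ => ?_
    rw [map_smul, smul_eq_mul]
  have hqd : ∀ s, HasDerivAt q (∑ i, y i * ∫ z, ρ z.1 z.2 * pderivX i S z.1 (z.2 + s • y) ∂(spaceTime d T)) s := by
    intro s
    have key := hasDerivAt_integral_of_dominated_loc_of_deriv_le
      (μ := spaceTime d T) (F := fun (s : ℝ) z => ρ z.1 z.2 * S z.1 (z.2 + s • y))
      (F' := fun (s : ℝ) z => ρ z.1 z.2 * ∑ i, y i * pderivX i S z.1 (z.2 + s • y)) (x₀ := s)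
      (s := Set.univ) (bound := fun z => |ρ z.1 z.2| * ∑ i, |y i| * D i) Filter.univ_mem
      (Filter.Eventually.of_forall fun s => (hInt0 (hmS (s • y)) (fun t x => hB t _)).aestronglyMeasurable)
      (hInt0 (hmS (s • y)) (fun t x => hB t _)) ?_ ?_ (hρi.abs.mul_const _) ?_
    · refine HasDerivAt.congr_deriv key.2 ?_
      simp only [Finset.mul_sum]
      rw [integral_finsetSum]
      · refine Finset.sum_congr rfl fun i _ => ?_
        rw [← integral_const_mul]; congr 1; funext z; ring
      · intro i _
        have := (hInt0 (hmd i (s • y)) (fun t x => hD i t _)).const_mul (y i)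
        refine this.congr (Filter.Eventually.of_forall fun z => ?_)
        simp only; ring
    · refine (hρm.mul (Finset.measurable_sum _ fun i _ => ?_)).aestronglyMeasurable
      exact (hmd i (s • y)).const_mul (y i)
    · refine Filter.Eventually.of_forall fun z s _ => ?_
      rw [Real.norm_eq_abs, abs_mul]
      gcongr
      refine (Finset.abs_sum_le_sum_abs _ _).trans (Finset.sum_le_sum fun i _ => ?_)
      rw [abs_mul]
      gcongr
      exact hD i _ _
    · refine Filter.Eventually.of_forall fun z s _ => ?_
      exact (hSd z.1 z.2 s).const_mul _
  have hmv := Convex.norm_image_sub_le_of_norm_hasDerivWithin_le (f := q) (s := Set.univ)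
    (C := (∑ i, |y i|) * CG.toReal * Q ^ (1 / p')) (x := 0) (y := 1)
    (fun s _ => (hqd s).hasDerivWithinAt) (fun s _ => by
      rw [Real.norm_eq_abs]
      refine (Finset.abs_sum_le_sum_abs _ _).trans ?_
      rw [mul_assoc, Finset.sum_mul]
      refine Finset.sum_le_sum fun i _ => ?_
      rw [abs_mul]
      gcongr
      exact hder i _) convex_univ trivial trivial
  have e : ∫ z, ρ z.1 z.2 * (S z.1 (z.2 + y) - S z.1 z.2) ∂(spaceTime d T) = q 1 - q 0 := by
    rw [hq]
    simp only [one_smul, zero_smul, add_zero]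
    rw [← integral_sub (hInt0 (hmS y) (fun t x => hB t _)) (hInt0 hS.meas hB)]
    congr 1; funext z; ring
  rw [e]
  simpa using hmv

end part5

section part6

instance haar_st (d : ℕ) : (volume : Measure (ℝ × (Fin d → ℝ))).IsAddHaarMeasure :=
  inferInstanceAs (Measure.prod (volume : Measure ℝ) (volume : Measure (Fin d → ℝ))).IsAddHaarMeasure

theorem spaceTime_ac (d : ℕ) (T : ℝ) : spaceTime d T ≪ (volume : Measure (ℝ × (Fin d → ℝ))) := by
  unfold spaceTime cubeVol
  rw [Measure.prod_restrict]
  exact Measure.restrict_le_self.absolutelyContinuous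

theorem ae_spaceTime_of_ae {d : ℕ} {T : ℝ} {P : ℝ × (Fin d → ℝ) → Prop} (h : ∀ᵐ z, P z) :
    ∀ᵐ z ∂(spaceTime d T), P z := (spaceTime_ac d T).ae_le h

/-- Step 3 -/
theorem grad_bdd_bound {d : ℕ} {T p p' : ℝ} (hpq : p.HolderConjugate p')
    {ρ : ℝ → (Fin d → ℝ) → ℝ} (hρm : Measurable (Function.uncurry ρ))
    (hρi : Integrable (Function.uncurry ρ) (spaceTime d T)) (hρp : ∀ t, SpacePeriodic (ρ t))
    {G : ℝ → (Fin d → ℝ) → Fin d → ℝ}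
    (hG : ∀ i, HasWeakDerivX T i ρ fun t x => G t x i)
    (hGfin : LpLqNorm T (ENNReal.ofReal p) (ENNReal.ofReal p) G < ∞) (y : Fin d → ℝ)
    {h : ℝ × (Fin d → ℝ) → ℝ} (hm : Measurable h) {B : ℝ} (hB : ∀ z, |h z| ≤ B)
    (hper : ∀ t, SpacePeriodic fun x => h (t, x)) {a b : ℝ} (ha : 0 < a) (hb : b < T)
    (hsupp : ∀ t x, t ∉ Set.Icc a b → h (t, x) = 0) :
    |∫ z, (ρ z.1 (z.2 + y) - ρ z.1 z.2) * h z ∂(spaceTime d T)| ≤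
      (∑ i, |y i|) * (LpLqNorm T (ENNReal.ofReal p) (ENNReal.ofReal p) G).toReal *
        (∫ z, |h z| ^ p' ∂(spaceTime d T)) ^ (1 / p') := by
  have hp0' := hpq.symm.pos
  have := spaceTime_finite d T
  have hB0 : 0 ≤ B := (abs_nonneg _).trans (hB 0)
  have hρs := integrable_spaceTime_shift hρm hρp hρi y
  -- smooth approximations
  obtain ⟨N, hN⟩ : ∃ N : ℕ, ∀ n ≥ N, 2 / ((n:ℝ)+1) < min a (T - b) := by
    have := (tendsto_one_div_add_atTop_nhds_zero_nat (𝕜 := ℝ)).const_mul 2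
    rw [mul_zero] at this
    have h := this.eventually_lt_const (lt_min ha (sub_pos.2 hb))
    obtain ⟨N, hN⟩ := Filter.eventually_atTop.1 h
    exact ⟨N, fun n hn => by have := hN n hn; rwa [mul_one_div] at this⟩
  have hper2 : ∀ n t, SpacePeriodic fun x => moll n h (t, x) := by
    intro n t x k
    simp only [moll_eq]
    congr 1; funext s
    have := hper (t - s.1) (x - s.2) k
    simp only at this
    rw [Prod.sub_def, Prod.sub_def]
    simp only
    rw [← this, add_sub_right_comm]
  have htest : ∀ n ≥ N, IsTestFunction T fun t x => moll n h (t, x) := by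
    intro n hn
    have h1 := lt_min_iff.1 (hN n hn)
    refine ⟨moll_contDiff n hm hB, hper2 n, a - 2 / ((n:ℝ)+1), b + 2 / ((n:ℝ)+1), by linarith, by linarith, ?_⟩
    intro t x ht
    rw [moll_eq]
    refine integral_eq_zero_of_ae (Filter.Eventually.of_forall fun s => ?_)
    by_cases hs : 2 / ((n:ℝ)+1) ≤ ‖s‖
    · simp [eta_zero n hs]
    · have h2 : |s.1| < 2 / ((n:ℝ)+1) := lt_of_le_of_lt (norm_fst_le s) (not_le.1 hs)
      have h3 := abs_lt.1 h2
      have : h ((t, x) - s) = 0 := by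
        rw [Prod.sub_def]
        apply hsupp
        intro h4
        exact ht ⟨by linarith [h4.1], by linarith [h4.2]⟩
      simp [this]
  have hmm : ∀ n, Measurable (moll n h) := fun n => (moll_contDiff n hm hB).continuous.measurable
  have hn : ∀ n ≥ N, |∫ z, (ρ z.1 (z.2 + y) - ρ z.1 z.2) * moll n h z ∂(spaceTime d T)| ≤
      (∑ i, |y i|) * (LpLqNorm T (ENNReal.ofReal p) (ENNReal.ofReal p) G).toReal *
        (∫ z, |moll n h z| ^ p' ∂(spaceTime d T)) ^ (1 / p') := by
    intro n hn
    have h1 := grad_test_bound hpq hρm hρi hG hGfin (htest n hn) (-y)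
    simp only [Pi.neg_apply, abs_neg] at h1
    refine le_trans (le_of_eq ?_) h1
    congr 1
    have bM : ∀ w, ∀ᵐ z ∂(spaceTime d T), ‖moll n h (z.1, z.2 + w)‖ ≤ B := fun w =>
      Filter.Eventually.of_forall fun z => moll_abs_le n hm hB _
    have mM : ∀ w : Fin d → ℝ, Measurable (fun z : ℝ × (Fin d → ℝ) => moll n h (z.1, z.2 + w)) := fun w => (hmm n).comp (by fun_prop)
    have i1 : ∀ w, Integrable (fun z => ρ z.1 z.2 * moll n h (z.1, z.2 + w)) (spaceTime d T) := fun w =>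
      hρi.mul_bdd (c := B) (mM w).aestronglyMeasurable (bM w)
    have i2 := hρs.mul_bdd (c := B) (mM 0).aestronglyMeasurable (bM 0)
    have i10 := i1 0
    simp only [add_zero] at i2 i10
    have e := integral_spaceTime_shift (T := T) (f := fun z => ρ z.1 z.2 * moll n h (z.1, z.2 + -y))
      (hρm.mul (mM (-y))) (fun t x k => by
        simp only
        rw [hρp t x k, add_right_comm]
        have := hper2 n t (x + -y) k
        simp only at this
        rw [this]) (i1 (-y)) y
    simp only [add_neg_cancel_right] at e
    simp only [sub_mul, mul_sub]
    rw [integral_sub (i1 (-y)) i10, ← e]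
    exact integral_sub i2 i10
  have hlim := ae_spaceTime_of_ae (T := T) (moll_tendsto hm hB)
  have L1 : Filter.Tendsto (fun n => ∫ z, (ρ z.1 (z.2 + y) - ρ z.1 z.2) * moll n h z ∂(spaceTime d T)) Filter.atTop
      (nhds (∫ z, (ρ z.1 (z.2 + y) - ρ z.1 z.2) * h z ∂(spaceTime d T))) := by
    refine tendsto_integral_of_dominated_convergence (fun z => |ρ z.1 (z.2 + y) - ρ z.1 z.2| * B) ?_ ?_ ?_ ?_
    · intro n
      exact ((hρs.sub hρi).aestronglyMeasurable).mul (hmm n).aestronglyMeasurable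
    · exact (hρs.sub hρi).abs.mul_const B
    · intro n
      refine Filter.Eventually.of_forall fun z => ?_
      rw [Real.norm_eq_abs, abs_mul]
      exact mul_le_mul_of_nonneg_left (moll_abs_le n hm hB _) (abs_nonneg _)
    · filter_upwards [hlim] with z hz using hz.const_mul _
  have L2 : Filter.Tendsto (fun n => ∫ z, |moll n h z| ^ p' ∂(spaceTime d T)) Filter.atTop
      (nhds (∫ z, |h z| ^ p' ∂(spaceTime d T))) := by
    refine tendsto_integral_of_dominated_convergence (fun z => B ^ p') ?_ ?_ ?_ ?_
    · intro n
      exact ((continuous_abs.measurable.comp (hmm n)).pow_const _).aestronglyMeasurable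
    · exact integrable_const _
    · intro n
      refine Filter.Eventually.of_forall fun z => ?_
      rw [Real.norm_of_nonneg (by positivity)]
      exact Real.rpow_le_rpow (abs_nonneg _) (moll_abs_le n hm hB _) hp0'.le
    · filter_upwards [hlim] with z hz
      exact (hz.abs).rpow_const (Or.inr hp0'.le)
  refine le_of_tendsto_of_tendsto L1.abs ((L2.rpow_const (Or.inr (by positivity))).const_mul _) ?_
  filter_upwards [Filter.eventually_ge_atTop N] with n h1 using hn n h1

/-- Step 4 -/
theorem grad_shift_bound {d : ℕ} {T p p' : ℝ} (hpq : p.HolderConjugate p')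
    {ρ : ℝ → (Fin d → ℝ) → ℝ} (hρm : Measurable (Function.uncurry ρ))
    (hρi : Integrable (Function.uncurry ρ) (spaceTime d T)) (hρp : ∀ t, SpacePeriodic (ρ t))
    {G : ℝ → (Fin d → ℝ) → Fin d → ℝ}
    (hG : ∀ i, HasWeakDerivX T i ρ fun t x => G t x i)
    (hGfin : LpLqNorm T (ENNReal.ofReal p) (ENNReal.ofReal p) G < ∞) (y : Fin d → ℝ) :
    ∫⁻ z, ENNReal.ofReal (|ρ z.1 (z.2 + y) - ρ z.1 z.2| ^ p) ∂(spaceTime d T) ≤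
      ENNReal.ofReal (((∑ i, |y i|) * (LpLqNorm T (ENNReal.ofReal p) (ENNReal.ofReal p) G).toReal) ^ p) := by
  have hp0' := hpq.symm.pos
  have hp0 := hpq.pos
  have hp1 := hpq.lt
  have := spaceTime_finite d T
  set C := (∑ i, |y i|) * (LpLqNorm T (ENNReal.ofReal p) (ENNReal.ofReal p) G).toReal with hC
  have hC0 : 0 ≤ C := by positivity
  set f : ℝ × (Fin d → ℝ) → ℝ := fun z => ρ z.1 (z.2 + y) - ρ z.1 z.2 with hf
  have hfm : Measurable f := (hρm.comp (by fun_prop : Measurable fun z : ℝ × (Fin d → ℝ) => (z.1, z.2 + y))).sub hρm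
  have hfp : ∀ t, SpacePeriodic fun x => f (t, x) := by
    intro t x n
    simp only [hf]
    rw [add_right_comm, hρp t, hρp t]
  -- truncation sets
  set A : ℕ → Set (ℝ × (Fin d → ℝ)) := fun k => {z | z.1 ∈ Set.Icc (1 / ((k:ℝ)+1)) (T - 1 / ((k:ℝ)+1)) ∧ |f z| ≤ k} with hA
  have hAm : ∀ k, MeasurableSet (A k) := fun k =>
    (measurableSet_Icc.preimage measurable_fst).inter (measurableSet_le (continuous_abs.measurable.comp hfm) measurable_const)
  have hAmono : Monotone A := by
    intro k l hkl z hz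
    have h1 : (k:ℝ) ≤ l := by exact_mod_cast hkl
    have h2 : 1 / ((l:ℝ)+1) ≤ 1 / ((k:ℝ)+1) := by gcongr
    exact ⟨⟨h2.trans hz.1.1, by linarith [hz.1.2]⟩, hz.2.trans h1⟩
  -- bound for each k
  have hk : ∀ k, ∫⁻ z, (A k).indicator (fun z => ENNReal.ofReal (|f z| ^ p)) z ∂(spaceTime d T) ≤ ENNReal.ofReal (C ^ p) := by
    intro k
    set h : ℝ × (Fin d → ℝ) → ℝ := (A k).indicator fun z => SignType.sign (f z) * |f z| ^ (p - 1) with hh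
    have hsm : Measurable fun z => ((SignType.sign (f z) : ℝ)) := by
      have e : (fun z => ((SignType.sign (f z) : ℝ))) = fun z => if 0 < f z then 1 else if f z < 0 then -1 else 0 := by
        funext z
        rw [sign_apply]; split_ifs <;> simp
      rw [e]
      refine Measurable.ite (measurableSet_lt measurable_const hfm) measurable_const ?_
      exact Measurable.ite (measurableSet_lt hfm measurable_const) measurable_const measurable_const
    have hhm : Measurable h := (hsm.mul ((continuous_abs.measurable.comp hfm).pow_const _)).indicator (hAm k)
    have hB : ∀ z, |h z| ≤ (k:ℝ) ^ (p - 1) := by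
      intro z
      by_cases hz : z ∈ A k
      · simp only [hh, Set.indicator_of_mem hz]
        rw [abs_mul, abs_of_nonneg (Real.rpow_nonneg (abs_nonneg _) _)]
        have : |((SignType.sign (f z) : ℝ))| ≤ 1 := by
          rw [sign_apply]; split_ifs <;> simp
        calc _ ≤ 1 * |f z| ^ (p - 1) := by gcongr
          _ ≤ _ := by
            rw [one_mul]
            exact Real.rpow_le_rpow (abs_nonneg _) hz.2 (by linarith)
      · simp only [hh, Set.indicator_of_notMem hz, abs_zero]
        positivity
    have hper : ∀ t, SpacePeriodic fun x => h (t, x) := by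
      intro t x n
      have e := hfp t x n
      simp only at e
      simp only [hh, Set.indicator, hA, Set.mem_setOf_eq, e]
    have key := grad_bdd_bound (T := T) hpq hρm hρi hρp hG hGfin y hhm hB hper
      (a := 1 / ((k:ℝ)+1)) (b := T - 1 / ((k:ℝ)+1)) (by positivity) (by
        have : 0 < 1 / ((k:ℝ)+1) := by positivity
        linarith) (fun t x ht => by
          simp only [hh]
          rw [Set.indicator_of_notMem]
          exact fun hz => ht hz.1)
    have e1 : ∀ z, (ρ z.1 (z.2 + y) - ρ z.1 z.2) * h z = (A k).indicator (fun z => |f z| ^ p) z := by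
      intro z
      by_cases hz : z ∈ A k
      · simp only [hh, Set.indicator_of_mem hz]
        show f z * _ = _
        rw [← mul_assoc, self_mul_sign]
        by_cases h0 : |f z| = 0
        · rw [h0, Real.zero_rpow hp0.ne']; simp
        · have := lt_of_le_of_ne (abs_nonneg (f z)) (Ne.symm h0)
          rw [Real.rpow_sub_one h0]; field_simp
      · simp [hh, Set.indicator_of_notMem hz]
    have e2 : ∀ z, |h z| ^ p' = (A k).indicator (fun z => |f z| ^ p) z := by
      intro z
      by_cases hz : z ∈ A k
      · simp only [hh, Set.indicator_of_mem hz]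
        by_cases h0 : f z = 0
        · simp [h0, Real.zero_rpow hp0.ne', Real.zero_rpow hp0'.ne']
        · have h1 : |((SignType.sign (f z) : ℝ))| = 1 := by
            rcases lt_or_gt_of_ne h0 with h | h
            · simp [sign_neg h]
            · simp [sign_pos h]
          rw [abs_mul, h1, one_mul, abs_of_nonneg (Real.rpow_nonneg (abs_nonneg _) _), ← Real.rpow_mul (abs_nonneg _),
            hpq.sub_one_mul_conj]
      · simp [hh, Set.indicator_of_notMem hz, Real.zero_rpow hp0'.ne']
    simp only [e1, e2] at key
    set I := ∫ z, (A k).indicator (fun z => |f z| ^ p) z ∂(spaceTime d T) with hI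
    have hI0 : 0 ≤ I := integral_nonneg fun z => Set.indicator_nonneg (fun z _ => by positivity) z
    rw [abs_of_nonneg hI0] at key
    have hIC : I ≤ C ^ p := by
      rcases hI0.eq_or_lt with h0 | h0
      · rw [← h0]; positivity
      · have h3 : I = I ^ (1 / p) * I ^ (1 / p') := by
          rw [← Real.rpow_add h0, one_div, one_div, hpq.inv_add_inv_eq_one, Real.rpow_one]
        have h4 : I ^ (1 / p) ≤ C := by
          refine le_of_mul_le_mul_right ?_ (Real.rpow_pos_of_pos h0 (1 / p'))
          rw [← h3]; exact key
        calc I = (I ^ (1 / p)) ^ p := by rw [← Real.rpow_mul hI0, one_div, inv_mul_cancel₀ hp0.ne', Real.rpow_one]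
          _ ≤ C ^ p := Real.rpow_le_rpow (by positivity) h4 hp0.le
    refine le_trans (le_of_eq ?_) (ENNReal.ofReal_le_ofReal hIC)
    rw [hI, ofReal_integral_eq_lintegral_ofReal]
    · congr 1; funext z
      by_cases hz : z ∈ A k
      · simp [Set.indicator_of_mem hz]
      · simp [Set.indicator_of_notMem hz]
    · refine Integrable.of_bound (C := (k:ℝ) ^ p) ?_ ?_
      · exact ((((continuous_abs.measurable.comp hfm).pow_const p)).indicator (hAm k)).aestronglyMeasurable
      · refine Filter.Eventually.of_forall fun z => ?_
        by_cases hz : z ∈ A k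
        · rw [Set.indicator_of_mem hz, Real.norm_of_nonneg (by positivity)]
          exact Real.rpow_le_rpow (abs_nonneg _) hz.2 hp0.le
        · rw [Set.indicator_of_notMem hz, norm_zero]; positivity
    · exact Filter.Eventually.of_forall fun z => Set.indicator_nonneg (fun z _ => by positivity) z
  -- limit
  have hlim : Filter.Tendsto (fun k => ∫⁻ z, (A k).indicator (fun z => ENNReal.ofReal (|f z| ^ p)) z ∂(spaceTime d T)) Filter.atTop
      (nhds (∫⁻ z, ENNReal.ofReal (|f z| ^ p) ∂(spaceTime d T))) := by
    refine lintegral_tendsto_of_tendsto_of_monotone ?_ ?_ ?_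
    · intro k
      exact ((((continuous_abs.measurable.comp hfm).pow_const p)).ennreal_ofReal.indicator (hAm k)).aemeasurable
    · refine Filter.Eventually.of_forall fun z k l hkl => ?_
      exact Set.indicator_le_indicator_of_subset (hAmono hkl) (fun _ => bot_le) z
    · have hin : ∀ᵐ z ∂(spaceTime d T), z.1 ∈ Set.Ioo 0 T := by
        unfold spaceTime cubeVol
        rw [Measure.prod_restrict]
        filter_upwards [ae_restrict_mem (measurableSet_Ioo.prod (measurableSet_unitCube d))] with z hz using hz.1
      filter_upwards [hin] with z hz
      have h1 : ∀ᶠ k : ℕ in Filter.atTop, z ∈ A k := by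
        have t1 := (tendsto_one_div_add_atTop_nhds_zero_nat (𝕜 := ℝ))
        have a1 := t1.eventually_lt_const (lt_min hz.1 (sub_pos.2 hz.2))
        obtain ⟨M, hM⟩ := exists_nat_ge |f z|
        filter_upwards [a1, Filter.eventually_ge_atTop M] with k hk1 hk2
        have := lt_min_iff.1 hk1
        refine ⟨⟨this.1.le, by linarith⟩, hM.trans (by exact_mod_cast hk2)⟩
      refine tendsto_const_nhds.congr' ?_
      filter_upwards [h1] with k hk
      rw [Set.indicator_of_mem hk]
  exact le_of_tendsto' hlim hk

/-- Final gradient shift bound in terms of torus distance. -/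
theorem grad_shift_bound_tN {d : ℕ} {T p p' : ℝ} (hpq : p.HolderConjugate p')
    {ρ : ℝ → (Fin d → ℝ) → ℝ} (hρm : Measurable (Function.uncurry ρ))
    (hρi : Integrable (Function.uncurry ρ) (spaceTime d T)) (hρp : ∀ t, SpacePeriodic (ρ t))
    {G : ℝ → (Fin d → ℝ) → Fin d → ℝ}
    (hG : ∀ i, HasWeakDerivX T i ρ fun t x => G t x i)
    (hGfin : LpLqNorm T (ENNReal.ofReal p) (ENNReal.ofReal p) G < ∞) (y : Fin d → ℝ) :
    ∫⁻ z, ENNReal.ofReal (|ρ z.1 (z.2 + y) - ρ z.1 z.2| ^ p) ∂(spaceTime d T) ≤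
      ENNReal.ofReal ((LpLqNorm T (ENNReal.ofReal p) (ENNReal.ofReal p) G).toReal ^ p) * ENNReal.ofReal (tN y ^ p) := by
  have h := grad_shift_bound (T := T) hpq hρm hρi hρp hG hGfin (y - fun i => ((round (y i) : ℤ) : ℝ))
  have e : ∀ z : ℝ × (Fin d → ℝ), ρ z.1 (z.2 + (y - fun i => ((round (y i) : ℤ) : ℝ))) = ρ z.1 (z.2 + y) := by
    intro z
    rw [← add_sub_assoc]
    exact periodic_sub_int (hρp z.1) _ _
  simp only [e] at h
  refine h.trans (le_of_eq ?_)
  rw [← ENNReal.ofReal_mul (by positivity), ← Real.mul_rpow (by positivity) (tN_nonneg y), mul_comm]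
  rfl

/-! ### Besov bound on translations -/

theorem euNorm_le_sum {d : ℕ} (y : Fin d → ℝ) : euNorm y ≤ ∑ i, |y i| := by
  unfold euNorm
  rw [Real.sqrt_le_left (Finset.sum_nonneg fun _ _ => abs_nonneg _)]
  have h : ∀ i ∈ Finset.univ, y i ^ 2 = |y i| ^ 2 := fun i _ => (sq_abs _).symm
  rw [Finset.sum_congr rfl h]
  exact Finset.sum_sq_le_sq_sum_of_nonneg (fun i _ => abs_nonneg _)

theorem euNorm_nonneg {d : ℕ} (y : Fin d → ℝ) : 0 ≤ euNorm y := Real.sqrt_nonneg _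

theorem besov_shift_bound {d : ℕ} {T q α : ℝ} (hq : 0 < q) (hα : 0 < α)
    {v : ℝ → (Fin d → ℝ) → Fin d → ℝ} (hvm : Measurable (Function.uncurry v)) (hvp : ∀ t, SpacePeriodic (v t))
    (w : Fin d → ℝ) :
    ∫⁻ z, ENNReal.ofReal (‖v z.1 (z.2 + w) - v z.1 z.2‖ ^ q) ∂(spaceTime d T) ≤
      (∫⁻ t in Set.Ioo 0 T, (besovNorm α (ENNReal.ofReal q) (v t)) ^ q) * ENNReal.ofReal (tN w ^ (α * q)) := by
  have hm : Measurable fun z : ℝ × (Fin d → ℝ) => ‖v z.1 (z.2 + w) - v z.1 z.2‖ₑ ^ q :=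
    ((hvm.comp (by fun_prop : Measurable fun z : ℝ × (Fin d → ℝ) => (z.1, z.2 + w))).sub hvm).enorm.pow_const _
  have e0 : ∀ z : ℝ × (Fin d → ℝ), ENNReal.ofReal (‖v z.1 (z.2 + w) - v z.1 z.2‖ ^ q) = ‖v z.1 (z.2 + w) - v z.1 z.2‖ₑ ^ q := by
    intro z
    rw [← ENNReal.ofReal_rpow_of_nonneg (norm_nonneg _) hq.le, ofReal_norm]
  simp only [e0]
  rw [lintegral_spaceTime hm, ← lintegral_mul_const' _ _ ENNReal.ofReal_ne_top]
  refine lintegral_mono fun t => ?_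
  simp only
  set y : Fin d → ℝ := -(w - fun i => ((round (w i) : ℤ) : ℝ)) with hy
  have e1 : ∀ x, v t (x + w) = v t (x - y) := by
    intro x
    rw [hy, sub_neg_eq_add, ← add_sub_assoc]
    exact (periodic_sub_int (hvp t) _ _).symm
  simp only [e1]
  by_cases h0 : y = 0
  · simp [h0, ENNReal.zero_rpow_of_pos hq]
  · have h1 : eLpNorm (fun x => v t (x - y) - v t x) (ENNReal.ofReal q) (cubeVol d) / ENNReal.ofReal (euNorm y ^ α)
        ≤ besovNorm α (ENNReal.ofReal q) (v t) := by
      unfold besovNorm besovSeminorm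
      refine le_trans ?_ le_add_self
      exact le_iSup₂_of_le y h0 le_rfl
    have hle : euNorm y ≤ tN w := by
      refine (euNorm_le_sum y).trans (le_of_eq ?_)
      unfold tN
      refine Finset.sum_congr rfl fun i _ => ?_
      simp [hy, abs_sub_comm]
    have hpos : 0 < euNorm y := by
      refine Real.sqrt_pos.2 ?_
      by_contra hcon
      apply h0
      funext i
      have h2 := (Finset.sum_eq_zero_iff_of_nonneg (fun i _ => sq_nonneg (y i))).1
        (le_antisymm (not_lt.1 hcon) (Finset.sum_nonneg fun i _ => sq_nonneg (y i))) i (Finset.mem_univ i)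
      simpa using h2
    have h2 : eLpNorm (fun x => v t (x - y) - v t x) (ENNReal.ofReal q) (cubeVol d) ≤
        besovNorm α (ENNReal.ofReal q) (v t) * ENNReal.ofReal (tN w ^ α) := by
      rw [ENNReal.div_le_iff (by simp [Real.rpow_pos_of_pos hpos]) ENNReal.ofReal_ne_top] at h1
      refine h1.trans ?_
      gcongr
    rw [eLpNorm_ofReal hq] at h2
    have h3 := ENNReal.rpow_le_rpow h2 hq.le
    rw [← ENNReal.rpow_mul, one_div, inv_mul_cancel₀ hq.ne', ENNReal.rpow_one, ENNReal.mul_rpow_of_nonneg _ _ hq.le,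
      ENNReal.ofReal_rpow_of_nonneg (Real.rpow_nonneg (tN_nonneg w) _) hq.le, ← Real.rpow_mul (tN_nonneg w)] at h3
    exact h3

end part6

section part7

/-- the exponent of the density -/
def pE (γ : ℝ) : ℝ := (3 * γ - 1) / 2
/-- the exponent of the velocity -/
def qE (γ : ℝ) : ℝ := (3 * γ - 1) / (γ - 1)

theorem pE_gt {γ : ℝ} (hγ : 1 < γ) : γ < pE γ := by unfold pE; linarith
theorem qE_gt {γ : ℝ} (hγ : 1 < γ) : 3 < qE γ := by
  unfold qE; rw [lt_div_iff₀ (by linarith)]; linarith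
theorem pq1 {γ : ℝ} (hγ : 1 < γ) : 1 / pE γ + 3 / qE γ = 1 := by
  unfold pE qE
  have h1 : γ - 1 ≠ 0 := by linarith
  have h2 : 3 * γ - 1 ≠ 0 := by linarith
  field_simp; ring
theorem pq2 {γ : ℝ} (hγ : 1 < γ) : γ / pE γ + 1 / qE γ = 1 := by
  unfold pE qE
  have h1 : γ - 1 ≠ 0 := by linarith
  have h2 : 3 * γ - 1 ≠ 0 := by linarith
  rw [one_div_div, div_div_eq_mul_div, ← add_div, div_eq_one_iff_eq h2]; ring

theorem young3 {a b c s t u : ℝ} (ha : 0 ≤ a) (hb : 0 ≤ b) (hc : 0 ≤ c) (hs : 0 ≤ s) (ht : 0 ≤ t)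
    (hu : 0 ≤ u) (h : s + t + u = 1) : a ^ s * b ^ t * c ^ u ≤ a + b + c := by
  refine (Real.geom_mean_le_arith_mean3_weighted hs ht hu ha hb hc h).trans ?_
  have h1 : s * a ≤ 1 * a := mul_le_mul_of_nonneg_right (by linarith) ha
  have h2 : t * b ≤ 1 * b := mul_le_mul_of_nonneg_right (by linarith) hb
  have h3 : u * c ≤ 1 * c := mul_le_mul_of_nonneg_right (by linarith) hc
  linarith

/-- Young in the form used throughout. -/
theorem youngE {x y z p q r a b e : ℝ} (hx : 0 ≤ x) (hy : 0 ≤ y) (hz : 0 ≤ z) (hp : 0 < p) (hq : 0 < q)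
    (hr : 0 < r)
    (ha : 0 ≤ a) (hb : 0 ≤ b) (he : 0 ≤ e) (h : a / p + b / q + e / r = 1) :
    x ^ a * y ^ b * z ^ e ≤ x ^ p + y ^ q + z ^ r := by
  have := young3 (Real.rpow_nonneg hx p) (Real.rpow_nonneg hy q) (Real.rpow_nonneg hz r)
    (s := a / p) (t := b / q) (u := e / r) (by positivity) (by positivity) (by positivity) h
  rw [← Real.rpow_mul hx, ← Real.rpow_mul hy, ← Real.rpow_mul hz, mul_div_cancel₀ _ hp.ne',
    mul_div_cancel₀ _ hq.ne', mul_div_cancel₀ _ hr.ne'] at this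
  exact this

theorem young1 {x y p q a b : ℝ} (hx : 0 ≤ x) (hy : 0 ≤ y) (hp : 0 < p) (hq : 0 < q)
    (ha : 0 ≤ a) (hb : 0 ≤ b) (h : a / p + b / q ≤ 1) :
    x ^ a * y ^ b ≤ 1 + x ^ p + y ^ q := by
  have := youngE hx hy (zero_le_one) hp hq (one_pos) ha hb (e := 1 - (a/p+b/q)) (by linarith)
    (by rw [div_one]; ring)
  simp only [Real.one_rpow, mul_one] at this
  linarith

theorem rpow_add_le {x y a : ℝ} (hx : 0 ≤ x) (hy : 0 ≤ y) (ha : 0 ≤ a) :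
    (x + y) ^ a ≤ 2 ^ a * (x ^ a + y ^ a) := by
  have h1 : x + y ≤ 2 * max x y := by linarith [le_max_left x y, le_max_right x y]
  calc (x+y)^a ≤ (2 * max x y)^a := Real.rpow_le_rpow (by positivity) h1 ha
    _ = 2^a * (max x y)^a := Real.mul_rpow (by norm_num) (by positivity)
    _ ≤ _ := by
      gcongr
      rcases max_choice x y with h | h <;> rw [h]
      · linarith [Real.rpow_nonneg hy a]
      · linarith [Real.rpow_nonneg hx a]

/-- difference of powers -/
theorem rpow_sub_le {x y γ : ℝ} (hx : 0 ≤ x) (hy : 0 ≤ y) (hγ : 1 ≤ γ) :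
    |x ^ γ - y ^ γ| ≤ γ * (|x - y| * (x + y) ^ (γ - 1)) := by
  wlog h : y ≤ x generalizing x y
  · have := this hy hx (le_of_not_ge h)
    rwa [abs_sub_comm, abs_sub_comm x, add_comm x]
  rw [abs_of_nonneg (sub_nonneg.2 (Real.rpow_le_rpow hy h (by linarith))),
    abs_of_nonneg (sub_nonneg.2 h)]
  rcases h.eq_or_lt with h | h
  · subst h; simp
  obtain ⟨c, hc, hc2⟩ := exists_hasDerivAt_eq_slope (fun x : ℝ => x ^ γ) (fun x => γ * x ^ (γ - 1)) h
    (Real.continuous_rpow_const (by linarith)).continuousOn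
    (fun z hz => Real.hasDerivAt_rpow_const (Or.inr hγ))
  rw [_root_.eq_div_iff (by linarith)] at hc2
  rw [← hc2]
  have : c ^ (γ - 1) ≤ (x + y) ^ (γ-1) := Real.rpow_le_rpow (by linarith [hc.1]) (by linarith [hc.2]) (by linarith)
  have h2 : 0 ≤ x - y := by linarith
  calc γ * c ^ (γ-1) * (x - y) ≤ γ * (x+y)^(γ-1) * (x-y) := by gcongr
    _ = _ := by ring

set_option linter.unusedSectionVars false
section prob
variable {Ω : Type*} [MeasurableSpace Ω] {μ : Measure Ω} [IsProbabilityMeasure μ]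

theorem jensen_rpow {p : ℝ} (hp : 1 ≤ p) {X : Ω → ℝ} (hX : ∀ w, 0 ≤ X w)
    (hi : Integrable X μ) (hip : Integrable (fun w => X w ^ p) μ) :
    (∫ w, X w ∂μ) ^ p ≤ ∫ w, X w ^ p ∂μ := by
  exact (convexOn_rpow hp).map_integral_le
    (Real.continuous_rpow_const (by linarith)).continuousOn isClosed_Ici
    (Filter.Eventually.of_forall fun w => hX w) hi hip

/-- bundled integrability data -/
structure Dat (μ : Measure Ω) (γ : ℝ) (R g : Ω → ℝ) : Prop where
  hγ : 1 < γ
  mR : Measurable R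
  mg : Measurable g
  R0 : ∀ w, 0 ≤ R w
  g0 : ∀ w, 0 ≤ g w
  iR : Integrable (fun w => R w ^ pE γ) μ
  ig : Integrable (fun w => g w ^ qE γ) μ

variable {γ : ℝ} {R g : Ω → ℝ}

theorem Dat.addc (h : Dat μ γ R g) {s : ℝ} (hs : 0 ≤ s) : Dat μ γ (fun w => R w + s) g := by
  have hp : 0 ≤ pE γ := by linarith [pE_gt h.hγ, h.hγ]
  refine ⟨h.hγ, h.mR.add_const s, h.mg, fun w => add_nonneg (h.R0 w) hs, h.g0, ?_, h.ig⟩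
  refine Integrable.mono' ((h.iR.add (integrable_const (s ^ pE γ))).const_mul (2 ^ pE γ))
    (((h.mR.add_const s).pow_const _).aestronglyMeasurable) (Filter.Eventually.of_forall fun w => ?_)
  rw [Real.norm_of_nonneg (Real.rpow_nonneg (add_nonneg (h.R0 w) hs) _)]
  exact rpow_add_le (h.R0 w) hs hp

theorem Dat.scale (h : Dat μ γ R g) {s t : ℝ} (hs : 0 ≤ s) (ht : 0 ≤ t) :
    Dat μ γ (fun w => s * R w) (fun w => t * g w) := by
  refine ⟨h.hγ, h.mR.const_mul s, h.mg.const_mul t, fun w => mul_nonneg hs (h.R0 w),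
    fun w => mul_nonneg ht (h.g0 w), ?_, ?_⟩
  · simp_rw [fun w => Real.mul_rpow hs (h.R0 w) (z := pE γ)]
    exact h.iR.const_mul _
  · simp_rw [fun w => Real.mul_rpow ht (h.g0 w) (z := qE γ)]
    exact h.ig.const_mul _

theorem Dat.mono (h : Dat μ γ R g) {f : Ω → ℝ} (mf : Measurable f) (f0 : ∀ w, 0 ≤ f w)
    (hf : ∀ w, f w ≤ R w) : Dat μ γ f g := by
  have hp : 0 ≤ pE γ := by linarith [pE_gt h.hγ, h.hγ]
  refine ⟨h.hγ, mf, h.mg, f0, h.g0, ?_, h.ig⟩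
  refine Integrable.mono' h.iR (mf.pow_const _).aestronglyMeasurable (Filter.Eventually.of_forall fun w => ?_)
  rw [Real.norm_of_nonneg (Real.rpow_nonneg (f0 w) _)]
  exact Real.rpow_le_rpow (f0 w) (hf w) hp

theorem Dat.int (h : Dat μ γ R g) {a b : ℝ} (ha : 0 ≤ a) (hb : 0 ≤ b)
    (hab : a / pE γ + b / qE γ ≤ 1) : Integrable (fun w => R w ^ a * g w ^ b) μ := by
  have hp : 0 < pE γ := by linarith [pE_gt h.hγ, h.hγ]
  have hq : 0 < qE γ := by linarith [qE_gt h.hγ]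
  refine Integrable.mono' (((integrable_const (1:ℝ)).add h.iR).add h.ig)
    ((h.mR.pow_const _).mul (h.mg.pow_const _)).aestronglyMeasurable (Filter.Eventually.of_forall fun w => ?_)
  rw [Real.norm_of_nonneg (mul_nonneg (Real.rpow_nonneg (h.R0 w) _) (Real.rpow_nonneg (h.g0 w) _))]
  exact young1 (h.R0 w) (h.g0 w) hp hq ha hb hab

theorem exps {γ : ℝ} (hγ : 1 < γ) : 0 < 1 / qE γ ∧ 0 < 1 / pE γ ∧ 3 / qE γ = 3 * (1 / qE γ) ∧ 2 / qE γ = 2 * (1 / qE γ) ∧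
    γ / pE γ = (γ - 1) / pE γ + 1 / pE γ ∧ 0 < (γ - 1) / pE γ := by
  have hp : 0 < pE γ := by linarith [pE_gt hγ]
  have hq : 0 < qE γ := by linarith [qE_gt hγ]
  have h3 : 0 < γ - 1 := by linarith
  refine ⟨by positivity, by positivity, by ring, by ring, by ring, by positivity⟩

theorem Dat.i1 (h : Dat μ γ R g) : Integrable R μ := by
  have e := exps h.hγ
  have := h.int (a := 1) (b := 0) (by norm_num) le_rfl (by rw [zero_div]; linarith [pq1 h.hγ])
  simpa using this
theorem Dat.ig1 (h : Dat μ γ R g) : Integrable g μ := by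
  have e := exps h.hγ
  have := h.int (a := 0) (b := 1) le_rfl (by norm_num) (by rw [zero_div]; linarith [pq1 h.hγ])
  simpa using this
theorem Dat.i11 (h : Dat μ γ R g) : Integrable (fun w => R w * g w) μ := by
  have e := exps h.hγ
  have := h.int (a := 1) (b := 1) (by norm_num) (by norm_num) (by linarith [pq1 h.hγ])
  simpa using this
theorem Dat.i12 (h : Dat μ γ R g) : Integrable (fun w => R w * g w ^ 2) μ := by
  have e := exps h.hγ
  have := h.int (a := 1) (b := (2:ℕ)) (by norm_num) (by norm_num) (by push_cast; linarith [pq1 h.hγ])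
  simpa only [Real.rpow_one, Real.rpow_natCast] using this
theorem Dat.i13 (h : Dat μ γ R g) : Integrable (fun w => R w * g w ^ 3) μ := by
  have e := exps h.hγ
  have := h.int (a := 1) (b := (3:ℕ)) (by norm_num) (by norm_num) (by push_cast; linarith [pq1 h.hγ])
  simpa only [Real.rpow_one, Real.rpow_natCast] using this
theorem Dat.iγ (h : Dat μ γ R g) : Integrable (fun w => R w ^ γ) μ := by
  have e := exps h.hγ
  have := h.int (a := γ) (b := 0) (by linarith [h.hγ]) le_rfl (by rw [zero_div]; linarith [pq2 h.hγ])
  simpa using this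

/-- Cauchy-Schwarz and Chebyshev for the weighted measure -/
theorem Dat.cs (h : Dat μ γ R g) (hP : 0 < ∫ w, R w ∂μ) :
    (∫ w, R w * g w ∂μ) ^ 2 / (∫ w, R w ∂μ) ≤ ∫ w, R w * g w ^ 2 ∂μ := by
  set P := ∫ w, R w ∂μ
  set m := (∫ w, R w * g w ∂μ) / P with hm
  have hm2 : ∫ w, R w * g w ∂μ = m * P := by rw [hm]; field_simp
  have h0 : 0 ≤ ∫ w, (R w * g w ^ 2 - 2 * m * (R w * g w) + m ^ 2 * R w) ∂μ :=
    integral_nonneg fun w => by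
      have : R w * g w ^ 2 - 2 * m * (R w * g w) + m ^ 2 * R w = R w * (g w - m)^2 := by ring
      rw [this]; exact mul_nonneg (h.R0 w) (sq_nonneg _)
  rw [integral_add (by exact h.i12.sub (h.i11.const_mul _)) (h.i1.const_mul _),
    integral_sub h.i12 (h.i11.const_mul _), integral_const_mul, integral_const_mul, hm2] at h0
  rw [hm2, div_le_iff₀ hP]
  change 0 ≤ _ + m^2 * P at h0
  nlinarith

theorem Dat.cheb (h : Dat μ γ R g) (hP : 0 < ∫ w, R w ∂μ) :
    (∫ w, R w * g w ^ 2 ∂μ) * ((∫ w, R w * g w ∂μ) / (∫ w, R w ∂μ)) ≤ ∫ w, R w * g w ^ 3 ∂μ := by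
  set P := ∫ w, R w ∂μ
  set m := (∫ w, R w * g w ∂μ) / P with hm
  have hm2 : ∫ w, R w * g w ∂μ = m * P := by rw [hm]; field_simp
  have hm0 : 0 ≤ m := div_nonneg (integral_nonneg fun w => mul_nonneg (h.R0 w) (h.g0 w)) hP.le
  have h0 : 0 ≤ ∫ w, (R w * g w ^ 3 - m * (R w * g w ^ 2) - m ^ 2 * (R w * g w) + m ^ 3 * R w) ∂μ :=
    integral_nonneg fun w => by
      have : R w * g w ^ 3 - m * (R w * g w ^ 2) - m ^ 2 * (R w * g w) + m ^ 3 * R w = R w * ((g w - m)^2 * (g w + m)) := by ring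
      rw [this]; exact mul_nonneg (h.R0 w) (mul_nonneg (sq_nonneg _) (add_nonneg (h.g0 w) hm0))
  rw [integral_add (by exact (h.i13.sub (h.i12.const_mul _)).sub (h.i11.const_mul _)) (h.i1.const_mul _),
    integral_sub (by exact h.i13.sub (h.i12.const_mul _)) (h.i11.const_mul _),
    integral_sub h.i13 (h.i12.const_mul _), integral_const_mul, integral_const_mul, integral_const_mul, hm2] at h0
  change 0 ≤ _ + m^3 * P at h0
  nlinarith

/-- The master quantity. -/
def TT (μ : Measure Ω) (γ ε δ : ℝ) (R f g : Ω → ℝ) : ℝ :=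
  1 + (∫ w, R w ^ pE γ ∂μ) + (∫ w, (f w / ε) ^ pE γ ∂μ) + ∫ w, (g w / δ) ^ qE γ ∂μ

theorem Dat.fdat (h : Dat μ γ R g) {P : ℝ} (hP : 0 ≤ P) : Dat μ γ (fun w => |R w - P|) g :=
  (h.addc hP).mono (h.mR.sub_const P).abs (fun w => abs_nonneg _) fun w => by
    have := h.R0 w
    rw [abs_le]; constructor <;> linarith

/-- E[R g^3] bound -/
theorem Dat.bd3 (h : Dat μ γ R g) {ε δ : ℝ} (hε : 0 < ε) (hδ : 0 < δ) (f : Ω → ℝ) (hf : ∀ w, 0 ≤ f w) :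
    ∫ w, R w * g w ^ 3 ∂μ ≤ δ ^ 3 * TT μ γ ε δ R f g := by
  have e := exps h.hγ
  have hp : 0 < pE γ := by linarith [pE_gt h.hγ, h.hγ]
  have hq : 0 < qE γ := by linarith [qE_gt h.hγ]
  have hs := (h.scale (s := 1) (t := δ⁻¹) zero_le_one (by positivity))
  have h1 : ∫ w, R w * g w ^ 3 ∂μ = δ ^ 3 * ∫ w, R w * (g w / δ) ^ 3 ∂μ := by
    rw [← integral_const_mul]; congr 1; funext w; field_simp
  have hig : Integrable (fun w => (g w / δ) ^ qE γ) μ := by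
    simpa only [div_eq_inv_mul] using hs.ig
  have h2 : ∫ w, R w * (g w / δ) ^ 3 ∂μ ≤ ∫ w, (R w ^ pE γ + (g w / δ) ^ qE γ) ∂μ := by
    refine integral_mono ?_ (h.iR.add hig) fun w => ?_
    · simpa only [div_eq_inv_mul, one_mul] using hs.i13
    · have h4 := young3 (Real.rpow_nonneg (h.R0 w) (pE γ)) (Real.rpow_nonneg (div_nonneg (h.g0 w) hδ.le) (qE γ)) le_rfl
        (s := 1 / pE γ) (t := (3:ℕ) / qE γ) (u := 0) (by positivity) (by positivity) le_rfl (by push_cast; linarith [pq1 h.hγ])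
      rw [← Real.rpow_mul (h.R0 w), ← Real.rpow_mul (div_nonneg (h.g0 w) hδ.le), mul_div_cancel₀ _ hp.ne',
        mul_div_cancel₀ _ hq.ne', Real.rpow_one, Real.rpow_natCast, Real.rpow_zero, mul_one, add_zero] at h4
      exact h4
  rw [integral_add h.iR hig] at h2
  have h5 : 0 ≤ ∫ w, (f w / ε) ^ pE γ ∂μ := integral_nonneg fun w => Real.rpow_nonneg (div_nonneg (hf w) hε.le) _
  rw [h1]
  refine mul_le_mul_of_nonneg_left ?_ (by positivity)
  unfold TT; linarith

theorem Dat.bd2 (h : Dat μ γ R g) {ε δ : ℝ} (hε : 0 < ε) (hδ : 0 < δ) (f : Ω → ℝ) (hf : ∀ w, 0 ≤ f w) :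
    ∫ w, R w * g w ^ 2 ∂μ ≤ δ ^ 2 * TT μ γ ε δ R f g := by
  have e := exps h.hγ
  have hp : 0 < pE γ := by linarith [pE_gt h.hγ, h.hγ]
  have hq : 0 < qE γ := by linarith [qE_gt h.hγ]
  have hs := (h.scale (s := 1) (t := δ⁻¹) zero_le_one (by positivity))
  have h1 : ∫ w, R w * g w ^ 2 ∂μ = δ ^ 2 * ∫ w, R w * (g w / δ) ^ 2 ∂μ := by
    rw [← integral_const_mul]; congr 1; funext w; field_simp
  have hig : Integrable (fun w => (g w / δ) ^ qE γ) μ := by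
    simpa only [div_eq_inv_mul] using hs.ig
  have h2 : ∫ w, R w * (g w / δ) ^ 2 ∂μ ≤ ∫ w, (1 + R w ^ pE γ + (g w / δ) ^ qE γ) ∂μ := by
    refine integral_mono ?_ (((integrable_const (1:ℝ)).add h.iR).add hig) fun w => ?_
    · simpa only [div_eq_inv_mul, one_mul] using hs.i12
    · have h4 := young1 (h.R0 w) (div_nonneg (h.g0 w) hδ.le) hp hq (a := 1) (b := (2:ℕ))
        (by norm_num) (by norm_num) (by push_cast; linarith [pq1 h.hγ])
      rw [Real.rpow_one, Real.rpow_natCast] at h4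
      exact h4
  rw [integral_add (by exact (integrable_const (1:ℝ)).add h.iR) hig, integral_add (integrable_const (1:ℝ)) h.iR] at h2
  have h5 : 0 ≤ ∫ w, (f w / ε) ^ pE γ ∂μ := integral_nonneg fun w => Real.rpow_nonneg (div_nonneg (hf w) hε.le) _
  simp only [integral_const, probReal_univ, smul_eq_mul, mul_one] at h2
  rw [h1]
  refine mul_le_mul_of_nonneg_left ?_ (by positivity)
  unfold TT; linarith

end prob

end part7

section part8

set_option linter.unusedSectionVars false
section prob
variable {Ω : Type*} [MeasurableSpace Ω] {μ : Measure Ω} [IsProbabilityMeasure μ]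
variable {γ : ℝ} {R g : Ω → ℝ}

theorem Dat.P_rpow (h : Dat μ γ R g) : (∫ w, R w ∂μ) ^ pE γ ≤ ∫ w, R w ^ pE γ ∂μ :=
  jensen_rpow (by linarith [pE_gt h.hγ, h.hγ]) h.R0 h.i1 h.iR

theorem Dat.S_rpow (h : Dat μ γ R g) :
    ∫ w, (R w + ∫ w, R w ∂μ) ^ pE γ ∂μ ≤ 2 ^ (pE γ + 1) * ∫ w, R w ^ pE γ ∂μ := by
  have hp : 0 ≤ pE γ := by linarith [pE_gt h.hγ, h.hγ]
  have hP : 0 ≤ ∫ w, R w ∂μ := integral_nonneg h.R0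
  have h1 : ∫ w, (R w + ∫ w, R w ∂μ) ^ pE γ ∂μ ≤
      ∫ w, 2 ^ pE γ * (R w ^ pE γ + (∫ w, R w ∂μ) ^ pE γ) ∂μ :=
    integral_mono (h.addc hP).iR ((h.iR.add (integrable_const _)).const_mul _) fun w =>
      rpow_add_le (h.R0 w) hP hp
  rw [integral_const_mul, integral_add h.iR (integrable_const _)] at h1
  simp only [integral_const, probReal_univ, smul_eq_mul, one_mul] at h1
  refine h1.trans ?_
  rw [Real.rpow_add (by norm_num), Real.rpow_one, mul_assoc]
  refine mul_le_mul_of_nonneg_left ?_ (by positivity)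
  linarith [h.P_rpow]

theorem two_rpow_pE {γ : ℝ} (hγ : 1 < γ) : 1 ≤ (2:ℝ) ^ (pE γ + 1) :=
  Real.one_le_rpow (by norm_num) (by linarith [pE_gt hγ])

theorem Dat.TT_nonneg (h : Dat μ γ R g) {ε δ : ℝ} (hε : 0 < ε) (hδ : 0 < δ) {f : Ω → ℝ} (hf : ∀ w, 0 ≤ f w) :
    0 ≤ (∫ w, R w ^ pE γ ∂μ) ∧ 0 ≤ (∫ w, (f w / ε) ^ pE γ ∂μ) ∧ 0 ≤ ∫ w, (g w / δ) ^ qE γ ∂μ := by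
  refine ⟨integral_nonneg fun w => Real.rpow_nonneg (h.R0 w) _,
    integral_nonneg fun w => Real.rpow_nonneg (div_nonneg (hf w) hε.le) _,
    integral_nonneg fun w => Real.rpow_nonneg (div_nonneg (h.g0 w) hδ.le) _⟩

theorem Dat.ifs (h : Dat μ γ R g) {ε : ℝ} (hε : 0 < ε) : Integrable (fun w => (R w / ε) ^ pE γ) μ := by
  have := (h.scale (s := ε⁻¹) (t := 1) (by positivity) zero_le_one).iR
  simpa only [div_eq_inv_mul] using this
theorem Dat.igs (h : Dat μ γ R g) {δ : ℝ} (hδ : 0 < δ) : Integrable (fun w => (g w / δ) ^ qE γ) μ := by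
  have := (h.scale (s := 1) (t := δ⁻¹) zero_le_one (by positivity)).ig
  simpa only [div_eq_inv_mul] using this

theorem Dat.ifS (h : Dat μ γ R g) {P : ℝ} (hP : 0 ≤ P) :
    Integrable (fun w => |R w - P| * (R w + P) ^ (γ - 1)) μ := by
  refine Integrable.mono' (h.addc hP).iγ ((h.mR.sub_const P).abs.mul ((h.mR.add_const P).pow_const _)).aestronglyMeasurable
    (Filter.Eventually.of_forall fun w => ?_)
  have h0 : 0 ≤ R w + P := add_nonneg (h.R0 w) hP
  rw [Real.norm_of_nonneg (mul_nonneg (abs_nonneg _) (Real.rpow_nonneg h0 _))]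
  have h1 : |R w - P| ≤ R w + P := by
    have := h.R0 w
    rw [abs_le]; constructor <;> linarith
  calc _ ≤ (R w + P) * (R w + P) ^ (γ-1) := by gcongr
    _ = (R w + P) ^ γ := by
      rw [← Real.rpow_one_add' h0 (by linarith [h.hγ])]; congr 1; ring

theorem Dat.bdP1 (h : Dat μ γ R g) {ε δ : ℝ} (hε : 0 < ε) (hδ : 0 < δ) {P : ℝ} (hP : P = ∫ w, R w ∂μ) :
    ∫ w, |R w - P| * (R w + P) ^ (γ - 1) ∂μ ≤
      2 ^ (pE γ + 1) * ε * TT μ γ ε δ R (fun w => |R w - P|) g := by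
  have hp : 0 < pE γ := by linarith [pE_gt h.hγ, h.hγ]
  have hP0 : 0 ≤ P := hP ▸ integral_nonneg h.R0
  have e := exps h.hγ
  have h1 : ∫ w, |R w - P| * (R w + P) ^ (γ - 1) ∂μ ≤
      ∫ w, ε * (1 + (|R w - P| / ε) ^ pE γ + (R w + P) ^ pE γ) ∂μ := by
    refine integral_mono (h.ifS hP0) ((((integrable_const _).add ((h.fdat hP0).ifs hε)).add (h.addc hP0).iR).const_mul _) fun w => ?_
    have := young1 (div_nonneg (abs_nonneg (R w - P)) hε.le) (add_nonneg (h.R0 w) hP0) hp hp (a := 1) (b := γ - 1)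
      zero_le_one (by linarith [h.hγ]) (by linarith [pq2 h.hγ])
    rw [Real.rpow_one] at this
    have h2 := mul_le_mul_of_nonneg_left this hε.le
    refine le_trans (le_of_eq ?_) h2
    field_simp
  rw [integral_const_mul, integral_add (by exact (integrable_const _).add ((h.fdat hP0).ifs hε)) (h.addc hP0).iR,
    integral_add (integrable_const _) ((h.fdat hP0).ifs hε)] at h1
  simp only [integral_const, probReal_univ, smul_eq_mul, mul_one] at h1
  have hS := h.S_rpow
  rw [← hP] at hS
  have hT := h.TT_nonneg hε hδ (f := fun w => |R w - P|) (fun w => abs_nonneg _)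
  have h2 := two_rpow_pE h.hγ
  refine h1.trans ?_
  rw [mul_comm _ ε, mul_assoc]
  refine mul_le_mul_of_nonneg_left ?_ hε.le
  unfold TT
  set a := ∫ w, R w ^ pE γ ∂μ
  set b := ∫ w, (|R w - P| / ε) ^ pE γ ∂μ
  set c := ∫ w, (g w / δ) ^ qE γ ∂μ
  set k := (2:ℝ) ^ (pE γ + 1)
  nlinarith [hT.1, hT.2.1, hT.2.2]

theorem Dat.bdPa (h : Dat μ γ R g) {ε δ : ℝ} (hε : 0 < ε) (hδ : 0 < δ) {P : ℝ} (hP : P = ∫ w, R w ∂μ) :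
    (∫ w, |R w - P| * (R w + P) ^ (γ - 1) ∂μ) * (∫ w, g w ∂μ) ≤
      2 ^ (pE γ + 1) * (ε * δ) * TT μ γ ε δ R (fun w => |R w - P|) g := by
  have hp : 0 < pE γ := by linarith [pE_gt h.hγ, h.hγ]
  have hq : 0 < qE γ := by linarith [qE_gt h.hγ]
  have hP0 : 0 ≤ P := hP ▸ integral_nonneg h.R0
  have e := exps h.hγ
  set y := (∫ w, g w ∂μ) / δ with hy
  have hy0 : 0 ≤ y := div_nonneg (integral_nonneg h.g0) hδ.le
  have hy1 : ∫ w, g w ∂μ = δ * y := by rw [hy]; field_simp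
  have hyq : y ^ qE γ ≤ ∫ w, (g w / δ) ^ qE γ ∂μ := by
    have := jensen_rpow (X := fun w => g w / δ) (p := qE γ) (by linarith [qE_gt h.hγ]) (fun w => div_nonneg (h.g0 w) hδ.le) (h.ig1.div_const δ) (h.igs hδ)
    rwa [integral_div] at this
  have h1 : ∫ w, (|R w - P| * (R w + P) ^ (γ - 1)) * y ∂μ ≤
      ∫ w, ε * ((|R w - P| / ε) ^ pE γ + (R w + P) ^ pE γ + y ^ qE γ) ∂μ := by
    refine integral_mono ((h.ifS hP0).mul_const y) (((((h.fdat hP0).ifs hε)).add (h.addc hP0).iR).add (integrable_const _) |>.const_mul _) fun w => ?_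
    have := youngE (div_nonneg (abs_nonneg (R w - P)) hε.le) (add_nonneg (h.R0 w) hP0) hy0 hp hp hq (a := 1) (b := γ - 1) (e := 1)
      zero_le_one (by linarith [h.hγ]) zero_le_one (by linarith [pq2 h.hγ])
    rw [Real.rpow_one, Real.rpow_one] at this
    have h2 := mul_le_mul_of_nonneg_left this hε.le
    refine le_trans (le_of_eq ?_) h2
    field_simp
  rw [integral_mul_const, integral_const_mul, integral_add (by exact (((h.fdat hP0).ifs hε)).add (h.addc hP0).iR) (integrable_const _),
    integral_add ((h.fdat hP0).ifs hε) (h.addc hP0).iR] at h1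
  simp only [integral_const, probReal_univ, smul_eq_mul, one_mul] at h1
  have hS := h.S_rpow
  rw [← hP] at hS
  have hT := h.TT_nonneg hε hδ (f := fun w => |R w - P|) (fun w => abs_nonneg _)
  have h2 := two_rpow_pE h.hγ
  rw [hy1]
  have h3 := mul_le_mul_of_nonneg_left h1 hδ.le
  refine le_trans (le_of_eq (by ring)) (h3.trans ?_)
  rw [mul_comm _ (ε * δ), ← mul_assoc, mul_comm δ ε, mul_assoc (ε * δ)]
  refine mul_le_mul_of_nonneg_left ?_ (by positivity)
  unfold TT
  set a := ∫ w, R w ^ pE γ ∂μ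
  set b := ∫ w, (|R w - P| / ε) ^ pE γ ∂μ
  set c := ∫ w, (g w / δ) ^ qE γ ∂μ
  set k := (2:ℝ) ^ (pE γ + 1)
  nlinarith [hT.1, hT.2.1, hT.2.2]

theorem Dat.bdPb1 (h : Dat μ γ R g) {ε δ : ℝ} (hε : 0 < ε) (hδ : 0 < δ) {P : ℝ} (hP : P = ∫ w, R w ∂μ) :
    P ^ (γ - 1) * (∫ w, |R w - P| * g w ∂μ) ≤
      (ε * δ) * TT μ γ ε δ R (fun w => |R w - P|) g := by
  have hp : 0 < pE γ := by linarith [pE_gt h.hγ, h.hγ]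
  have hq : 0 < qE γ := by linarith [qE_gt h.hγ]
  have hP0 : 0 ≤ P := hP ▸ integral_nonneg h.R0
  have e := exps h.hγ
  have h1 : ∫ w, P ^ (γ - 1) * (|R w - P| * g w) ∂μ ≤
      ∫ w, (ε * δ) * (P ^ pE γ + (|R w - P| / ε) ^ pE γ + (g w / δ) ^ qE γ) ∂μ := by
    refine integral_mono ((h.fdat hP0).i11.const_mul _) ((((integrable_const _).add ((h.fdat hP0).ifs hε)).add (h.igs hδ)).const_mul _) fun w => ?_
    have := youngE hP0 (div_nonneg (abs_nonneg (R w - P)) hε.le) (div_nonneg (h.g0 w) hδ.le) hp hp hq (a := γ - 1) (b := 1) (e := 1)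
      (by linarith [h.hγ]) zero_le_one zero_le_one (by linarith [pq2 h.hγ])
    rw [Real.rpow_one, Real.rpow_one] at this
    have h2 := mul_le_mul_of_nonneg_left this (mul_pos hε hδ).le
    refine le_trans (le_of_eq ?_) h2
    field_simp
  rw [integral_const_mul, integral_const_mul, integral_add (by exact (integrable_const _).add ((h.fdat hP0).ifs hε)) (h.igs hδ),
    integral_add (integrable_const _) ((h.fdat hP0).ifs hε)] at h1
  simp only [integral_const, probReal_univ, smul_eq_mul, one_mul] at h1
  have hS := h.P_rpow
  rw [← hP] at hS
  refine h1.trans ?_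
  refine mul_le_mul_of_nonneg_left ?_ (by positivity)
  unfold TT
  linarith

theorem Dat.bdPb2 (h : Dat μ γ R g) {ε δ : ℝ} (hε : 0 < ε) (hε1 : ε ≤ 1) (hδ : 0 < δ) {P : ℝ} (hP : P = ∫ w, R w ∂μ)
    (hPpos : 0 < P) :
    (∫ w, |R w - P| ^ γ ∂μ) * ((∫ w, |R w - P| * g w ∂μ) / P) ≤
      8 * (ε * δ) * TT μ γ ε δ R (fun w => |R w - P|) g := by
  have hγ := h.hγ
  have hp1 := pE_gt h.hγ
  have hp : 0 < pE γ := by linarith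
  have hq : 0 < qE γ := by linarith [qE_gt h.hγ]
  have hP0 := hPpos.le
  have e := exps h.hγ
  have hf := h.fdat hP0
  have hT := h.TT_nonneg hε hδ (f := fun w => |R w - P|) (fun w => abs_nonneg _)
  set f : Ω → ℝ := fun w => |R w - P| with hfdef
  change (∫ w, f w ^ γ ∂μ) * ((∫ w, f w * g w ∂μ) / P) ≤ _
  set A := ∫ w, f w ∂μ with hA
  set B := ∫ w, f w ^ pE γ ∂μ with hB
  have hA0 : 0 ≤ A := integral_nonneg hf.R0
  have hA2 : A ≤ 2 * P := by
    have : A ≤ ∫ w, (R w + P) ∂μ := integral_mono hf.i1 (h.addc hP0).i1 fun w => by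
      have := h.R0 w
      change |R w - P| ≤ _
      rw [abs_le]; constructor <;> linarith
    rw [integral_add h.i1 (integrable_const _)] at this
    simp only [integral_const, probReal_univ, smul_eq_mul, one_mul] at this
    linarith
  have hTn : 0 ≤ TT μ γ ε δ R f g := by unfold TT; linarith [hT.1, hT.2.1, hT.2.2]
  rcases hA0.eq_or_lt with hA00 | hApos
  · have hz : f =ᵐ[μ] 0 := (integral_eq_zero_iff_of_nonneg hf.R0 hf.i1).1 hA00.symm
    have : ∫ w, f w * g w ∂μ = 0 := integral_eq_zero_of_ae (hz.mono fun w hw => by simp [hw])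
    rw [this]; simp only [zero_div, mul_zero]; positivity
  have hBpos : 0 < B := lt_of_lt_of_le (Real.rpow_pos_of_pos hApos (pE γ)) (jensen_rpow (by linarith) hf.R0 hf.i1 hf.iR)
  set z := (B / A) ^ (1 / (pE γ - 1)) with hz
  have hz0 : 0 < z := Real.rpow_pos_of_pos (by positivity) _
  have hzp : z ^ (pE γ - 1) = B / A := by
    rw [hz, ← Real.rpow_mul (by positivity), one_div, inv_mul_cancel₀ (by linarith), Real.rpow_one]
  have hzγ : z ^ (γ - pE γ) * B = z ^ (γ - 1) * A := by
    have : γ - pE γ = (γ - 1) - (pE γ - 1) := by ring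
    rw [this, Real.rpow_sub hz0, hzp]; field_simp
  -- bound on E f^γ
  have h1 : ∫ w, f w ^ γ ∂μ ≤ 2 * (A * z ^ (γ - 1)) := by
    have : ∫ w, f w ^ γ ∂μ ≤ ∫ w, (f w * z ^ (γ - 1) + f w ^ pE γ * z ^ (γ - pE γ)) ∂μ := by
      refine integral_mono hf.iγ ((hf.i1.mul_const _).add (hf.iR.mul_const _)) fun w => ?_
      have hfw := hf.R0 w
      have e1 : 0 ≤ f w * z ^ (γ - 1) := by positivity
      have e2 : 0 ≤ f w ^ pE γ * z ^ (γ - pE γ) := by positivity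
      rcases le_total (f w) z with hle | hle
      · have : f w ^ γ ≤ f w * z ^ (γ - 1) := by
          have e3 : f w ^ γ = f w * f w ^ (γ - 1) := by
            rw [← Real.rpow_one_add' hfw (by linarith)]; congr 1; ring
          rw [e3]
          exact mul_le_mul_of_nonneg_left (Real.rpow_le_rpow hfw hle (by linarith)) hfw
        dsimp only; linarith
      · have : f w ^ γ ≤ f w ^ pE γ * z ^ (γ - pE γ) := by
          have e3 : f w ^ γ = f w ^ pE γ * f w ^ (γ - pE γ) := by
            rw [← Real.rpow_add (by linarith)]; congr 1; ring
          rw [e3]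
          exact mul_le_mul_of_nonneg_left (Real.rpow_le_rpow_of_nonpos hz0 hle (by linarith)) (by positivity)
        dsimp only; linarith
    rw [integral_add (hf.i1.mul_const _) (hf.iR.mul_const _), integral_mul_const, integral_mul_const] at this
    change _ ≤ A * _ + B * _ at this
    linarith
  have h2 : 0 ≤ ∫ w, f w * g w ∂μ := integral_nonneg fun w => mul_nonneg (hf.R0 w) (h.g0 w)
  -- bound on z^{γ-1} E [f g]
  have h3 : z ^ (γ - 1) * ∫ w, f w * g w ∂μ ≤ (ε * δ) * (2 * TT μ γ ε δ R f g) := by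
    have hzε : 0 < z / ε := by positivity
    have : ∫ w, z ^ (γ - 1) * (f w * g w) ∂μ ≤
        ∫ w, (ε * δ) * ((z / ε) ^ (pE γ - 1) / ε * f w + (f w / ε) ^ pE γ + (g w / δ) ^ qE γ) ∂μ := by
      refine integral_mono (hf.i11.const_mul _) ((((hf.i1.const_mul _).add (hf.ifs hε)).add (h.igs hδ)).const_mul _) fun w => ?_
      have hfw := hf.R0 w
      have hgw := h.g0 w
      have hk1 : 0 ≤ (z / ε) ^ (pE γ - 1) := by positivity
      have y := young3 (a := (z / ε) ^ (pE γ - 1) / ε * f w) (b := (f w / ε) ^ pE γ) (c := (g w / δ) ^ qE γ)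
        (s := 2 / 3) (t := 1 / (3 * pE γ)) (u := 1 / qE γ) (by positivity) (by positivity) (by positivity)
        (by norm_num) (by positivity) (by positivity) (by
          have := pq1 hγ
          have e5 : 1 / (3 * pE γ) = (1 / 3) * (1 / pE γ) := by field_simp
          rw [e5]; linarith)
      have y1 : ((z / ε) ^ (pE γ - 1) / ε * f w) ^ (2/3:ℝ) * ((f w / ε) ^ pE γ) ^ (1 / (3 * pE γ)) * ((g w / δ) ^ qE γ) ^ (1 / qE γ)
          = (z / ε) ^ (γ - 1) * (f w / ε) * (g w / δ) := by
        have hfe : 0 ≤ f w / ε := by positivity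
        have hge : 0 ≤ g w / δ := by positivity
        rw [div_mul_eq_mul_div, mul_div_assoc, Real.mul_rpow hk1 hfe, ← Real.rpow_mul hzε.le, ← Real.rpow_mul hfe,
          ← Real.rpow_mul hge, mul_one_div_cancel hq.ne', Real.rpow_one]
        have e6 : (pE γ - 1) * (2/3) = γ - 1 := by unfold pE; ring
        have e7 : pE γ * (1 / (3 * pE γ)) = 1/3 := by field_simp
        rw [e6, e7, mul_assoc ((z/ε)^(γ-1)), ← Real.rpow_add' hfe (by norm_num)]
        norm_num
      rw [y1] at y
      have y2 := mul_le_mul_of_nonneg_left y (mul_pos hε hδ).le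
      refine le_trans ?_ y2
      have e8 : ε ^ (γ - 1) ≤ 1 := Real.rpow_le_one hε.le hε1 (by linarith)
      have e9 : z ^ (γ - 1) ≤ (z / ε) ^ (γ - 1) := Real.rpow_le_rpow hz0.le (by
        rw [le_div_iff₀ hε]; nlinarith) (by linarith)
      have e10 : ε * δ * ((z / ε) ^ (γ - 1) * (f w / ε) * (g w / δ)) = (z / ε) ^ (γ - 1) * (f w * g w) := by
        field_simp
      rw [e10]
      exact mul_le_mul_of_nonneg_right e9 (by positivity)
    rw [integral_const_mul, integral_const_mul, integral_add (by exact (hf.i1.const_mul _).add (hf.ifs hε)) (h.igs hδ),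
      integral_add (hf.i1.const_mul _) (hf.ifs hε), integral_const_mul] at this
    have e11 : (z / ε) ^ (pE γ - 1) / ε * A = ∫ w, (f w / ε) ^ pE γ ∂μ := by
      have : ∀ w, (f w / ε) ^ pE γ = f w ^ pE γ / ε ^ pE γ := fun w => Real.div_rpow (hf.R0 w) hε.le _
      simp_rw [this]
      rw [integral_div]
      change _ = B / _
      rw [Real.div_rpow hz0.le hε.le, hzp, Real.rpow_sub_one hε.ne']
      field_simp
    change _ ≤ _ * (_ * A + _ + _) at this
    rw [e11] at this
    refine this.trans (mul_le_mul_of_nonneg_left ?_ (by positivity))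
    unfold TT; linarith [hT.1, hT.2.1, hT.2.2]
  calc (∫ w, f w ^ γ ∂μ) * ((∫ w, f w * g w ∂μ) / P) ≤ (2 * (A * z ^ (γ - 1))) * ((∫ w, f w * g w ∂μ) / P) :=
        mul_le_mul_of_nonneg_right h1 (by positivity)
    _ = (2 * (A / P)) * (z ^ (γ - 1) * (∫ w, f w * g w ∂μ)) := by ring
    _ ≤ (2 * 2) * ((ε * δ) * (2 * TT μ γ ε δ R f g)) := by
        have : A / P ≤ 2 := by rw [div_le_iff₀ hPpos]; exact hA2
        gcongr
    _ = _ := by ring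

/-- The pressure term. -/
theorem Dat.bdP2 (h : Dat μ γ R g) {ε δ : ℝ} (hε : 0 < ε) (hε1 : ε ≤ 1) (hδ : 0 < δ) {P : ℝ} (hP : P = ∫ w, R w ∂μ)
    (hPpos : 0 < P) :
    (∫ w, |R w - P| * (R w + P) ^ (γ - 1) ∂μ) * ((∫ w, R w * g w ∂μ) / P) ≤
      (2 ^ (pE γ + 1) + 10 * 4 ^ (γ - 1)) * (ε * δ) * TT μ γ ε δ R (fun w => |R w - P|) g := by
  have hγ := h.hγ
  have hP0 := hPpos.le
  have hf := h.fdat hP0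
  set X := ∫ w, |R w - P| * (R w + P) ^ (γ - 1) ∂μ with hX
  have hX0 : 0 ≤ X := integral_nonneg fun w => mul_nonneg (abs_nonneg _) (Real.rpow_nonneg (add_nonneg (h.R0 w) hP0) _)
  set Y := ∫ w, |R w - P| * g w ∂μ with hY
  have hY0 : 0 ≤ Y := integral_nonneg fun w => mul_nonneg (abs_nonneg _) (h.g0 w)
  set A := ∫ w, |R w - P| ∂μ with hA
  have hA0 : 0 ≤ A := integral_nonneg hf.R0
  have hA2 : A ≤ 2 * P := by
    have : A ≤ ∫ w, (R w + P) ∂μ := integral_mono hf.i1 (h.addc hP0).i1 fun w => by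
      have := h.R0 w
      rw [abs_le]; constructor <;> linarith
    rw [integral_add h.i1 (integrable_const _)] at this
    simp only [integral_const, probReal_univ, smul_eq_mul, one_mul] at this
    linarith
  have h1 : ∫ w, R w * g w ∂μ ≤ P * (∫ w, g w ∂μ) + Y := by
    rw [hY, ← integral_const_mul, ← integral_add (h.ig1.const_mul _) hf.i11]
    refine integral_mono h.i11 ((h.ig1.const_mul _).add hf.i11) fun w => ?_
    have : R w ≤ P + |R w - P| := by linarith [le_abs_self (R w - P)]
    have := mul_le_mul_of_nonneg_right this (h.g0 w)
    dsimp only; linarith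
  have h2 : X ≤ 4 ^ (γ - 1) * (P ^ (γ - 1) * A + ∫ w, |R w - P| ^ γ ∂μ) := by
    have : X ≤ ∫ w, 4 ^ (γ - 1) * (P ^ (γ - 1) * |R w - P| + |R w - P| ^ γ) ∂μ := by
      refine integral_mono (h.ifS hP0) (((hf.i1.const_mul _).add hf.iγ).const_mul _) fun w => ?_
      have hfw : 0 ≤ |R w - P| := abs_nonneg _
      have e1 : R w + P ≤ 2 * P + |R w - P| := by linarith [le_abs_self (R w - P)]
      have e2 : (R w + P) ^ (γ - 1) ≤ 2 ^ (γ-1) * ((2 * P) ^ (γ-1) + |R w - P| ^ (γ-1)) :=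
        (Real.rpow_le_rpow (add_nonneg (h.R0 w) hP0) e1 (by linarith)).trans (rpow_add_le (by positivity) hfw (by linarith))
      have e3 : (2 * P) ^ (γ-1) = 2 ^ (γ - 1) * P ^ (γ-1) := Real.mul_rpow (by norm_num) hP0
      have e4 : (4:ℝ) ^ (γ-1) = 2 ^ (γ-1) * 2 ^ (γ-1) := by
        rw [← Real.mul_rpow (by norm_num) (by norm_num)]; norm_num
      have e5 : 1 ≤ (2:ℝ) ^ (γ-1) := Real.one_le_rpow (by norm_num) (by linarith)
      have e6 : |R w - P| ^ γ = |R w - P| * |R w - P| ^ (γ - 1) := by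
        rw [← Real.rpow_one_add' hfw (by linarith)]; congr 1; ring
      have e7 : 0 ≤ |R w - P| ^ (γ-1) := by positivity
      have e8 : (R w + P) ^ (γ - 1) ≤ 4 ^ (γ-1) * (P ^ (γ-1) + |R w - P| ^ (γ-1)) := by
        refine e2.trans ?_
        rw [e3, e4, mul_assoc]
        gcongr
        nlinarith
      rw [e6]
      calc _ ≤ |R w - P| * (4 ^ (γ-1) * (P ^ (γ-1) + |R w - P| ^ (γ-1))) := by gcongr
        _ = _ := by ring
    rw [integral_const_mul, integral_add (hf.i1.const_mul _) hf.iγ, integral_const_mul] at this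
    exact this
  have ha := h.bdPa hε hδ hP
  have hb1 := h.bdPb1 hε hδ hP
  have hb2 := h.bdPb2 hε hε1 hδ hP hPpos
  set TV := TT μ γ ε δ R (fun w => |R w - P|) g
  have h3 : P ^ (γ - 1) * A * (Y / P) ≤ 2 * ((ε * δ) * TV) := by
    calc P ^ (γ - 1) * A * (Y / P) = (A / P) * (P ^ (γ-1) * Y) := by ring
      _ ≤ 2 * (P ^ (γ-1) * Y) := by
        have : A / P ≤ 2 := by rw [div_le_iff₀ hPpos]; exact hA2
        gcongr
      _ ≤ _ := by gcongr
  calc X * ((∫ w, R w * g w ∂μ) / P) ≤ X * ((P * (∫ w, g w ∂μ) + Y) / P) := by gcongr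
    _ = X * (∫ w, g w ∂μ) + X * (Y / P) := by field_simp
    _ ≤ X * (∫ w, g w ∂μ) + 4 ^ (γ - 1) * (P ^ (γ - 1) * A + ∫ w, |R w - P| ^ γ ∂μ) * (Y / P) := by gcongr
    _ = X * (∫ w, g w ∂μ) + 4 ^ (γ - 1) * (P ^ (γ - 1) * A * (Y / P) + (∫ w, |R w - P| ^ γ ∂μ) * (Y / P)) := by ring
    _ ≤ 2 ^ (pE γ + 1) * (ε * δ) * TV + 4 ^ (γ - 1) * (2 * ((ε * δ) * TV) + 8 * (ε * δ) * TV) := by gcongr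
    _ = _ := by ring

/-- comparing the oscillation around the mean and around a point -/
theorem Dat.osc (h : Dat μ γ R g) {P : ℝ} (hP : P = ∫ w, R w ∂μ) {r : ℝ} (hr : 0 ≤ r) {ε : ℝ} (hε : 0 < ε) :
    ∫ w, (|R w - P| / ε) ^ pE γ ∂μ ≤ 2 ^ (pE γ + 1) * ∫ w, (|R w - r| / ε) ^ pE γ ∂μ := by
  have hγ := h.hγ
  have hp : 1 ≤ pE γ := by linarith [pE_gt h.hγ]
  have hP0 : 0 ≤ P := hP ▸ integral_nonneg h.R0
  have hf := h.fdat hr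
  set m := ∫ w, |R w - r| / ε ∂μ with hm
  have hm0 : 0 ≤ m := integral_nonneg fun w => div_nonneg (abs_nonneg _) hε.le
  have hj : m ^ pE γ ≤ ∫ w, (|R w - r| / ε) ^ pE γ ∂μ :=
    jensen_rpow hp (fun w => div_nonneg (abs_nonneg _) hε.le) (hf.i1.div_const _) (hf.ifs hε)
  have hrP : |r - P| ≤ ε * m := by
    have e1 : P - r = ∫ w, (R w - r) ∂μ := by
      rw [integral_sub h.i1 (integrable_const _), ← hP]; simp
    rw [abs_sub_comm, e1, hm, integral_div, mul_div_cancel₀ _ hε.ne']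
    exact abs_integral_le_integral_abs
  have h1 : ∫ w, (|R w - P| / ε) ^ pE γ ∂μ ≤ ∫ w, 2 ^ pE γ * ((|R w - r| / ε) ^ pE γ + m ^ pE γ) ∂μ := by
    refine integral_mono ((h.fdat hP0).ifs hε) (((hf.ifs hε).add (integrable_const _)).const_mul _) fun w => ?_
    refine le_trans (Real.rpow_le_rpow (div_nonneg (abs_nonneg _) hε.le) ?_ (by linarith))
      (rpow_add_le (div_nonneg (abs_nonneg _) hε.le) hm0 (by linarith))
    have : |R w - P| ≤ |R w - r| + |r - P| := abs_sub_le _ _ _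
    rw [div_le_iff₀ hε, add_mul, div_mul_cancel₀ _ hε.ne']
    linarith
  rw [integral_const_mul, integral_add (hf.ifs hε) (integrable_const _)] at h1
  simp only [integral_const, probReal_univ, smul_eq_mul, one_mul] at h1
  refine h1.trans ?_
  rw [Real.rpow_add (by norm_num), Real.rpow_one, mul_assoc]
  refine mul_le_mul_of_nonneg_left ?_ (by positivity)
  linarith

end prob

end part8

section part9

set_option linter.unusedSectionVars false
section prob
variable {Ω : Type*} [MeasurableSpace Ω] {μ : Measure Ω} [IsProbabilityMeasure μ]
variable {γ : ℝ} {R g : Ω → ℝ} {d : ℕ} {V : Ω → Fin d → ℝ} {v0 : Fin d → ℝ}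

theorem Dat.ia (h : Dat μ γ R g) (mV : Measurable V) (hg : ∀ w, ‖V w - v0‖ ≤ g w) (i : Fin d) :
    Integrable (fun w => R w * (V w i - v0 i)) μ := by
  refine Integrable.mono' h.i11 (h.mR.mul (((measurable_pi_apply i).comp mV).sub_const _)).aestronglyMeasurable
    (Filter.Eventually.of_forall fun w => ?_)
  rw [norm_mul, Real.norm_of_nonneg (h.R0 w)]
  exact mul_le_mul_of_nonneg_left ((norm_le_pi_norm (V w - v0) i).trans (hg w)) (h.R0 w)

theorem Dat.iaa (h : Dat μ γ R g) (mV : Measurable V) (hg : ∀ w, ‖V w - v0‖ ≤ g w) (i j : Fin d) :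
    Integrable (fun w => R w * (V w i - v0 i) * (V w j - v0 j)) μ ∧
    |∫ w, R w * (V w i - v0 i) * (V w j - v0 j) ∂μ| ≤ ∫ w, R w * g w ^ 2 ∂μ := by
  have key : ∀ w, ‖R w * (V w i - v0 i) * (V w j - v0 j)‖ ≤ R w * g w ^ 2 := fun w => by
    rw [norm_mul, norm_mul, Real.norm_of_nonneg (h.R0 w), mul_assoc, sq]
    exact mul_le_mul_of_nonneg_left (mul_le_mul ((norm_le_pi_norm (V w - v0) i).trans (hg w))
      ((norm_le_pi_norm (V w - v0) j).trans (hg w)) (norm_nonneg _) (h.g0 w)) (h.R0 w)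
  refine ⟨Integrable.mono' h.i12 ((h.mR.mul (((measurable_pi_apply i).comp mV).sub_const _)).mul
    (((measurable_pi_apply j).comp mV).sub_const _)).aestronglyMeasurable
    (Filter.Eventually.of_forall key), ?_⟩
  rw [← Real.norm_eq_abs]
  exact norm_integral_le_of_norm_le h.i12 (Filter.Eventually.of_forall key)

theorem Dat.abs_ia (h : Dat μ γ R g) (_mV : Measurable V) (hg : ∀ w, ‖V w - v0‖ ≤ g w) (i : Fin d) :
    |∫ w, R w * (V w i - v0 i) ∂μ| ≤ ∫ w, R w * g w ∂μ := by
  rw [← Real.norm_eq_abs]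
  refine norm_integral_le_of_norm_le h.i11 (Filter.Eventually.of_forall fun w => ?_)
  rw [norm_mul, Real.norm_of_nonneg (h.R0 w)]
  exact mul_le_mul_of_nonneg_left ((norm_le_pi_norm (V w - v0) i).trans (hg w)) (h.R0 w)

theorem Dat.mean (h : Dat μ γ R g) (mV : Measurable V) (hg : ∀ w, ‖V w - v0‖ ≤ g w) (i : Fin d) :
    ∫ w, R w * V w i ∂μ = (∫ w, R w * (V w i - v0 i) ∂μ) + v0 i * ∫ w, R w ∂μ := by
  rw [← integral_const_mul, ← integral_add (h.ia mV hg i) (h.i1.const_mul _)]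
  congr 1; funext w; ring

theorem Dat.covar (h : Dat μ γ R g) (mV : Measurable V) (hg : ∀ w, ‖V w - v0‖ ≤ g w) (i j : Fin d)
    (hP : 0 < ∫ w, R w ∂μ) :
    |(∫ w, R w * V w i * V w j ∂μ) - (∫ w, R w * V w i ∂μ) * ((∫ w, R w * V w j ∂μ) / ∫ w, R w ∂μ)| ≤
      2 * ∫ w, R w * g w ^ 2 ∂μ := by
  have e : ∫ w, R w * V w i * V w j ∂μ = (∫ w, R w * (V w i - v0 i) * (V w j - v0 j) ∂μ) +
      v0 i * (∫ w, R w * (V w j - v0 j) ∂μ) + v0 j * (∫ w, R w * (V w i - v0 i) ∂μ) + v0 i * v0 j * ∫ w, R w ∂μ := by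
    rw [← integral_const_mul, ← integral_const_mul, ← integral_const_mul,
      ← integral_add (h.iaa mV hg i j).1 ((h.ia mV hg j).const_mul _),
      ← integral_add (by exact (h.iaa mV hg i j).1.add ((h.ia mV hg j).const_mul _)) ((h.ia mV hg i).const_mul _),
      ← integral_add (by exact ((h.iaa mV hg i j).1.add ((h.ia mV hg j).const_mul _)).add ((h.ia mV hg i).const_mul _)) (h.i1.const_mul _)]
    congr 1; funext w; ring
  rw [e, h.mean mV hg i, h.mean mV hg j]
  have h1 := (h.iaa mV hg i j).2
  have h2 := h.abs_ia mV hg i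
  have h3 := h.abs_ia mV hg j
  have h4 := h.cs hP
  set P := ∫ w, R w ∂μ
  set A := ∫ w, R w * (V w i - v0 i) ∂μ
  set B := ∫ w, R w * (V w j - v0 j) ∂μ
  set D := ∫ w, R w * (V w i - v0 i) * (V w j - v0 j) ∂μ
  have e2 : D + v0 i * B + v0 j * A + v0 i * v0 j * P - (A + v0 i * P) * ((B + v0 j * P) / P) = D - A * B / P := by
    field_simp; ring
  rw [e2]
  have h5 : |A * B / P| ≤ ∫ w, R w * g w ^ 2 ∂μ := by
    refine le_trans ?_ h4
    rw [abs_div, abs_mul, abs_of_pos hP, sq]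
    exact div_le_div_of_nonneg_right (mul_le_mul h2 h3 (abs_nonneg _) ((abs_nonneg _).trans h2)) hP.le
  calc |D - A * B / P| ≤ |D| + |A * B / P| := abs_sub _ _
    _ ≤ _ := by linarith

theorem Dat.devU (h : Dat μ γ R g) (mV : Measurable V) (hg : ∀ w, ‖V w - v0‖ ≤ g w) (j : Fin d)
    (hP : 0 < ∫ w, R w ∂μ) :
    ∫ w, |R w * (V w j - (∫ w, R w * V w j ∂μ) / ∫ w, R w ∂μ)| ∂μ ≤ 2 * ∫ w, R w * g w ∂μ := by
  rw [h.mean mV hg j]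
  have h3 := h.abs_ia mV hg j
  set P := ∫ w, R w ∂μ with hPd
  set B := ∫ w, R w * (V w j - v0 j) ∂μ
  set G := ∫ w, R w * g w ∂μ with hG
  have : ∫ w, |R w * (V w j - (B + v0 j * P) / P)| ∂μ ≤ ∫ w, (R w * g w + (G / P) * R w) ∂μ := by
    refine integral_mono_of_nonneg (Filter.Eventually.of_forall fun w => abs_nonneg _) (h.i11.add (h.i1.const_mul _))
      (Filter.Eventually.of_forall fun w => ?_)
    have e : V w j - (B + v0 j * P) / P = (V w j - v0 j) - B / P := by field_simp; ring
    dsimp only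
    rw [e, abs_mul, abs_of_nonneg (h.R0 w)]
    have e1 : |V w j - v0 j| ≤ g w := (norm_le_pi_norm (V w - v0) j).trans (hg w)
    have e2 : |B / P| ≤ G / P := by rw [abs_div, abs_of_pos hP]; gcongr
    have e3 : |(V w j - v0 j) - B / P| ≤ g w + G / P := (abs_sub _ _).trans (by linarith)
    have := mul_le_mul_of_nonneg_left e3 (h.R0 w)
    linarith
  rw [integral_add h.i11 (h.i1.const_mul _), integral_const_mul] at this
  change _ ≤ G + G / P * P at this
  rw [div_mul_cancel₀ _ hP.ne'] at this
  linarith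

theorem Dat.pres (h : Dat μ γ R g) {P : ℝ} (hP : 0 ≤ P) :
    |(∫ w, R w ^ γ ∂μ) - P ^ γ| ≤ γ * ∫ w, |R w - P| * (R w + P) ^ (γ - 1) ∂μ := by
  have e : (∫ w, R w ^ γ ∂μ) - P ^ γ = ∫ w, (R w ^ γ - P ^ γ) ∂μ := by
    rw [integral_sub h.iγ (integrable_const _)]; simp
  rw [e, ← integral_const_mul, ← Real.norm_eq_abs]
  exact norm_integral_le_of_norm_le ((h.ifS hP).const_mul _)
    (Filter.Eventually.of_forall fun w => rpow_sub_le (h.R0 w) hP h.hγ.le)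

end prob

/-- A good time slice. -/
structure Slice (d : ℕ) (γ c : ℝ) (r : (Fin d → ℝ) → ℝ) (u : (Fin d → ℝ) → Fin d → ℝ) : Prop where
  hγ : 1 < γ
  hc : 0 < c
  mr : Measurable r
  mu : Measurable u
  pr : SpacePeriodic r
  pu : SpacePeriodic u
  r0 : ∀ x, 0 ≤ r x
  lower : ∀ᵐ x ∂(cubeVol d), c ≤ r x
  ir : Integrable (fun x => r x ^ pE γ) (cubeVol d)
  iu : Integrable (fun x => ‖u x‖ ^ qE γ) (cubeVol d)

section slice
variable {d : ℕ} {γ c L : ℝ} {r : (Fin d → ℝ) → ℝ} {u : (Fin d → ℝ) → Fin d → ℝ} {K : (Fin d → ℝ) → ℝ}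

theorem Slice.dat0 (S : Slice d γ c r u) : Dat (cubeVol d) γ r (fun x => ‖u x‖) :=
  ⟨S.hγ, S.mr, S.mu.norm, S.r0, fun _ => norm_nonneg _, S.ir, S.iu⟩

theorem Slice.i1 (S : Slice d γ c r u) : Integrable r (cubeVol d) := S.dat0.i1
theorem Slice.iM (S : Slice d γ c r u) (j : Fin d) : Integrable (fun y => r y * u y j) (cubeVol d) := by
  have := S.dat0.ia (v0 := 0) S.mu (fun w => by simp) j
  simpa using this
theorem Slice.iF (S : Slice d γ c r u) (i j : Fin d) : Integrable (fun y => r y * u y i * u y j) (cubeVol d) := by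
  have := (S.dat0.iaa (v0 := 0) S.mu (fun w => by simp) i j).1
  simpa using this
theorem Slice.iQ (S : Slice d γ c r u) : Integrable (fun y => kappa γ * r y ^ γ) (cubeVol d) :=
  S.dat0.iγ.const_mul _

theorem shift_integrable (hK : IsKer d L K) {h : (Fin d → ℝ) → ℝ} (hm : Measurable h) (hp : SpacePeriodic h)
    (hi : Integrable h (cubeVol d)) (x : Fin d → ℝ) : Integrable (fun w => h (x + w)) (kerMeas K) := by
  have := hK.integrable_kerMeas (integrable_cube_add h hm hp hi x)
  simpa only [add_comm] using this

theorem Slice.dat (S : Slice d γ c r u) (hK : IsKer d L K) (x : Fin d → ℝ) :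
    Dat (kerMeas K) γ (fun w => r (x + w)) (fun w => ‖u (x + w) - u x‖) := by
  have := hK.isProb
  have hq : 0 < qE γ := by linarith [qE_gt S.hγ]
  refine ⟨S.hγ, S.mr.comp (measurable_const_add x), ((S.mu.comp (measurable_const_add x)).sub_const _).norm,
    fun w => S.r0 _, fun w => norm_nonneg _, ?_, ?_⟩
  · exact shift_integrable hK (S.mr.pow_const _) (fun x n => by simp only [S.pr x n]) S.ir x
  · refine Integrable.mono' (((shift_integrable hK (S.mu.norm.pow_const _) (fun x n => by simp only [S.pu x n]) S.iu x).add
      (integrable_const (‖u x‖ ^ qE γ))).const_mul (2 ^ qE γ))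
      ((((S.mu.comp (measurable_const_add x)).sub_const _).norm.pow_const _).aestronglyMeasurable) (Filter.Eventually.of_forall fun w => ?_)
    rw [Real.norm_of_nonneg (by positivity)]
    exact (Real.rpow_le_rpow (norm_nonneg _) (norm_sub_le _ _) hq.le).trans
      (rpow_add_le (norm_nonneg _) (norm_nonneg _) hq.le)

theorem Slice.pM (S : Slice d γ c r u) (j : Fin d) : SpacePeriodic (fun y => r y * u y j) := fun x n => by
  simp only [S.pr x n, S.pu x n]
theorem Slice.pF (S : Slice d γ c r u) (i j : Fin d) : SpacePeriodic (fun y => r y * u y i * u y j) := fun x n => by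
  simp only [S.pr x n, S.pu x n]
theorem Slice.pQ (S : Slice d γ c r u) : SpacePeriodic (fun y => kappa γ * r y ^ γ) := fun x n => by
  simp only [S.pr x n]

theorem conv_one (hK : IsKer d L K) (x : Fin d → ℝ) : ∫ w in unitCube d, K (w - x) = 1 := by
  have := hK.isProb
  have h := hK.conv_eq (h := fun _ => (1:ℝ)) (fun _ _ => rfl) x
  simpa [conv] using h

theorem conv_lower (hK : IsKer d L K) {h : (Fin d → ℝ) → ℝ} (hi : Integrable h (cubeVol d))
    (hl : ∀ᵐ x ∂(cubeVol d), c ≤ h x) (x : Fin d → ℝ) : c ≤ conv K h x := by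
  have h1 : c = ∫ w in unitCube d, K (w - x) * c := by
    rw [integral_mul_const, conv_one hK, one_mul]
  rw [h1]
  refine integral_mono_ae ?_ (conv_integrand_integrable hK.periodic hK.continuous hi x) ?_
  · exact (conv_integrand_integrable hK.periodic hK.continuous (integrable_const (1:ℝ)) x |>.mul_const c).congr
      (Filter.Eventually.of_forall fun w => by simp)
  · exact hl.mono fun w hw => mul_le_mul_of_nonneg_left hw (hK.pos _).le

theorem Slice.P_lower (S : Slice d γ c r u) (hK : IsKer d L K) (x : Fin d → ℝ) : c ≤ conv K r x :=
  conv_lower hK S.i1 S.lower x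

theorem conv_dK_le (hK : IsKer d L K) {h : (Fin d → ℝ) → ℝ} (hm : Measurable h) (hp : SpacePeriodic h)
    (hi : Integrable h (cubeVol d)) (i : Fin d) (x : Fin d → ℝ) :
    |conv (fun w => - dKer K i w) h x| ≤ L * ∫ w, |h (x + w)| ∂(kerMeas K) := by
  rw [conv_eq_shift (fun x n => by simp only [periodic_fderiv hK.periodic i x n]) hp]
  refine hK.dconv_abs_le i (h := fun w => h (x + w)) ?_
  have := integrable_cube_add h hm hp hi x
  simpa only [add_comm] using this

theorem conv_lin {K h1 h2 : (Fin d → ℝ) → ℝ} (hp : SpacePeriodic K) (hc : Continuous K)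
    (hi1 : Integrable h1 (cubeVol d)) (hi2 : Integrable h2 (cubeVol d)) {U : ℝ} {x : Fin d → ℝ} :
    conv K h1 x - U * conv K h2 x = conv K (fun y => h1 y - U * h2 y) x := by
  have e := integral_sub (conv_integrand_integrable hp hc hi1 x) ((conv_integrand_integrable hp hc hi2 x).const_mul U)
  rw [integral_const_mul] at e
  unfold conv
  refine e.symm.trans ?_
  change _ = ∫ w, _ ∂(cubeVol d)
  congr 1; funext w; ring

/-- `∂_i U_j` -/
def dU (K : (Fin d → ℝ) → ℝ) (r : (Fin d → ℝ) → ℝ) (u : (Fin d → ℝ) → Fin d → ℝ) (i j : Fin d) (x : Fin d → ℝ) : ℝ :=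
  (conv (fun w => - dKer K i w) (fun y => r y * u y j) x -
    conv K (fun y => r y * u y j) x / conv K r x * conv (fun w => - dKer K i w) r x) / conv K r x

theorem Slice.dU_le (S : Slice d γ c r u) (hK : IsKer d L K) (hL : 0 ≤ L) (i j : Fin d) (x : Fin d → ℝ) :
    |dU K r u i j x| ≤ 2 * L * ((∫ w, r (x + w) * ‖u (x + w) - u x‖ ∂(kerMeas K)) / conv K r x) := by
  have := hK.isProb
  have hP : 0 < conv K r x := S.hc.trans_le (S.P_lower hK x)
  have hD := S.dat hK x
  set U := conv K (fun y => r y * u y j) x / conv K r x with hU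
  have hdp : SpacePeriodic (fun w => - dKer K i w) := fun x n => by simp only [periodic_fderiv hK.periodic i x n]
  have hdc := (hK.d_continuous i).neg
  have e : conv (fun w => - dKer K i w) (fun y => r y * u y j) x - U * conv (fun w => - dKer K i w) r x =
      conv (fun w => - dKer K i w) (fun y => r y * (u y j - U)) x := by
    rw [conv_lin hdp hdc (S.iM j) S.i1]
    congr 1; funext w; ring
  unfold dU
  rw [← hU, e, abs_div, abs_of_pos hP, ← mul_div_assoc]
  refine div_le_div_of_nonneg_right ?_ hP.le
  refine (conv_dK_le hK (h := fun y => r y * (u y j - U)) (S.mr.mul (((measurable_pi_apply j).comp S.mu).sub_const U)) (fun x n => by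
    simp only [S.pr x n, S.pu x n]) ?_ i x).trans ?_
  · exact ((S.iM j).sub (S.i1.const_mul U)).congr (Filter.Eventually.of_forall fun w => by
      change r w * u w j - U * r w = r w * (u w j - U); ring)
  · have hd := hD.devU (V := fun w => u (x + w)) (S.mu.comp (measurable_const_add x)) (v0 := u x) (fun w => le_rfl) j (by
      rw [← hK.conv_eq S.pr]; exact hP)
    have e1 : U = (∫ w, r (x + w) * u (x + w) j ∂(kerMeas K)) / ∫ w, r (x + w) ∂(kerMeas K) := by
      rw [hU, hK.conv_eq S.pr, hK.conv_eq (S.pM j)]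
    rw [← e1] at hd
    rw [mul_comm 2 L, mul_assoc]
    exact mul_le_mul_of_nonneg_left hd hL

end slice

end part9

section part10

set_option linter.unusedSectionVars false

theorem kappa_pos {γ : ℝ} (hγ : 1 < γ) : 0 < kappa γ := by
  unfold kappa
  have : 0 < γ - 1 := by linarith
  positivity

/-- derivative of the flux function -/
theorem H_deriv {d : ℕ} {γ k : ℝ} (hγ : 1 < γ) {P Q : ℝ → ℝ} {M F : Fin d → ℝ → ℝ} {dP dQ : ℝ} {dM dF dV : Fin d → ℝ}
    (i : Fin d) (hP0 : 0 < P 0) (hP : HasDerivAt P dP 0) (hQ : HasDerivAt Q dQ 0)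
    (hM : ∀ j, HasDerivAt (M j) (dM j) 0) (hF : ∀ j, HasDerivAt (F j) (dF j) 0)
    (hdV : ∀ j, dV j = (dM j - M j 0 / P 0 * dP) / P 0) :
    HasDerivAt (fun s => -(1/2) * (∑ j, (M j s / P s) ^ 2) * M i s + (∑ j, M j s / P s * F j s)
      + k * γ / (γ - 1) * P s ^ (γ - 1) * M i s - k * P s ^ γ * (M i s / P s) + M i s / P s * Q s)
     ((-(∑ j, M j 0 / P 0 * dV j) * M i 0 - (1/2) * (∑ j, (M j 0 / P 0) ^ 2) * dM i)
      + (∑ j, (dV j * F j 0 + M j 0 / P 0 * dF j)) + k * γ / (γ - 1) * P 0 ^ (γ - 1) * dM i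
      - k * P 0 ^ γ * dV i + (dV i * Q 0 + M i 0 / P 0 * dQ)) 0 := by
  have hU : ∀ j, HasDerivAt (fun s => M j s / P s) (dV j) 0 := fun j => by
    have := (hM j).fun_div hP hP0.ne'
    refine this.congr_deriv ?_
    rw [hdV]; field_simp
  have h1 : HasDerivAt (fun s => ∑ j, (M j s / P s) ^ 2) (∑ j, 2 * (M j 0 / P 0) * dV j) 0 := by
    refine HasDerivAt.fun_sum fun j _ => ?_
    have := (hU j).fun_pow 2
    refine this.congr_deriv ?_
    simp
  have h2 : HasDerivAt (fun s => ∑ j, M j s / P s * F j s) (∑ j, (dV j * F j 0 + M j 0 / P 0 * dF j)) 0 :=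
    HasDerivAt.fun_sum fun j _ => (hU j).fun_mul (hF j)
  have h3 := hP.rpow_const (p := γ - 1) (Or.inl hP0.ne')
  have h4 := hP.rpow_const (p := γ) (Or.inl hP0.ne')
  have h5 := (((((h1.const_mul (-(1/2))).fun_mul (hM i)).fun_add h2).fun_add ((h3.const_mul (k * γ / (γ - 1))).fun_mul (hM i))).fun_sub
    ((h4.const_mul k).fun_mul (hU i))).fun_add ((hU i).fun_mul hQ)
  refine h5.congr_deriv ?_
  have e1 : ∑ j, 2 * (M j 0 / P 0) * dV j = 2 * ∑ j, M j 0 / P 0 * dV j := by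
    rw [Finset.mul_sum]; exact Finset.sum_congr rfl fun j _ => by ring
  have e2 : P 0 ^ (γ - 1 - 1) = P 0 ^ (γ - 1) / P 0 := Real.rpow_sub_one hP0.ne' _
  rw [e1, e2]
  have h6 : γ - 1 ≠ 0 := by linarith
  field_simp
  ring

section slice
variable {d : ℕ} {γ c L : ℝ} {r : (Fin d → ℝ) → ℝ} {u : (Fin d → ℝ) → Fin d → ℝ} {K : (Fin d → ℝ) → ℝ}

/-- The negative time derivative of the mollified energy density. -/
def flux (K : (Fin d → ℝ) → ℝ) (γ : ℝ) (r : (Fin d → ℝ) → ℝ) (u : (Fin d → ℝ) → Fin d → ℝ) (x : Fin d → ℝ) : ℝ :=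
  (-(1/2) * (∑ j, (conv K (fun y => r y * u y j) x / conv K r x) ^ 2) + kappa γ * γ / (γ - 1) * conv K r x ^ (γ - 1)) *
    (∑ i, conv (fun w => - dKer K i w) (fun y => r y * u y i) x) +
  ∑ j, (conv K (fun y => r y * u y j) x / conv K r x) *
    ((∑ i, conv (fun w => - dKer K i w) (fun y => r y * u y i * u y j) x) +
      conv (fun w => - dKer K j w) (fun y => kappa γ * r y ^ γ) x)

/-- The commutator errors. -/
def errT (K : (Fin d → ℝ) → ℝ) (γ : ℝ) (r : (Fin d → ℝ) → ℝ) (u : (Fin d → ℝ) → Fin d → ℝ) (x : Fin d → ℝ) : ℝ :=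
  (∑ i, ∑ j, dU K r u i j x * (conv K (fun y => r y * u y i * u y j) x -
    conv K (fun y => r y * u y i) x * (conv K (fun y => r y * u y j) x / conv K r x))) +
  (conv K (fun y => kappa γ * r y ^ γ) x - kappa γ * conv K r x ^ γ) * ∑ i, dU K r u i i x

/-- `∂_i H_i` -/
def dH (K : (Fin d → ℝ) → ℝ) (γ : ℝ) (r : (Fin d → ℝ) → ℝ) (u : (Fin d → ℝ) → Fin d → ℝ) (i : Fin d) (x : Fin d → ℝ) : ℝ :=
  (-(∑ j, conv K (fun y => r y * u y j) x / conv K r x * dU K r u i j x) * conv K (fun y => r y * u y i) x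
    - (1/2) * (∑ j, (conv K (fun y => r y * u y j) x / conv K r x) ^ 2) * conv (fun w => - dKer K i w) (fun y => r y * u y i) x)
  + (∑ j, (dU K r u i j x * conv K (fun y => r y * u y i * u y j) x +
      conv K (fun y => r y * u y j) x / conv K r x * conv (fun w => - dKer K i w) (fun y => r y * u y i * u y j) x))
  + kappa γ * γ / (γ - 1) * conv K r x ^ (γ - 1) * conv (fun w => - dKer K i w) (fun y => r y * u y i) x
  - kappa γ * conv K r x ^ γ * dU K r u i i x
  + (dU K r u i i x * conv K (fun y => kappa γ * r y ^ γ) x +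
     conv K (fun y => r y * u y i) x / conv K r x * conv (fun w => - dKer K i w) (fun y => kappa γ * r y ^ γ) x)

theorem flux_add_err (K : (Fin d → ℝ) → ℝ) (γ : ℝ) (r : (Fin d → ℝ) → ℝ) (u : (Fin d → ℝ) → Fin d → ℝ) (x : Fin d → ℝ) :
    flux K γ r u x + errT K γ r u x = ∑ i, dH K γ r u i x := by
  unfold flux errT dH
  generalize (kappa γ * γ / (γ - 1) * conv K r x ^ (γ - 1)) = A
  generalize hU : (fun j => conv K (fun y => r y * u y j) x / conv K r x) = U
  have hU' : ∀ j, conv K (fun y => r y * u y j) x / conv K r x = U j := fun j => by rw [← hU]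
  simp only [hU']
  simp only [mul_add, add_mul, Finset.sum_add_distrib, Finset.sum_sub_distrib, Finset.mul_sum, Finset.sum_mul, mul_sub, sub_mul, neg_mul, Finset.sum_neg_distrib]
  rw [Finset.sum_comm (f := fun j i => U j * conv (fun w => - dKer K i w) (fun y => r y * u y i * u y j) x)]
  have e1 : ∑ i, ∑ j, dU K r u i j x * (conv K (fun y => r y * u y i) x * U j) =
    ∑ i, ∑ j, U j * dU K r u i j x * conv K (fun y => r y * u y i) x :=
      Finset.sum_congr rfl fun i _ => Finset.sum_congr rfl fun j _ => by ring
  rw [e1]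
  have e2 : ∑ i, conv K (fun y => kappa γ * r y ^ γ) x * dU K r u i i x = ∑ i, dU K r u i i x * conv K (fun y => kappa γ * r y ^ γ) x :=
    Finset.sum_congr rfl fun i _ => by ring
  rw [e2]
  ring

theorem dK_per (hK : IsKer d L K) (i : Fin d) : SpacePeriodic (fun w => - dKer K i w) := fun x n => by
  simp only [periodic_fderiv hK.periodic i x n]

theorem Slice.cU (S : Slice d γ c r u) (hK : IsKer d L K) (j : Fin d) :
    Continuous (fun x => conv K (fun y => r y * u y j) x / conv K r x) :=
  (conv_continuous hK.periodic hK.continuous (S.iM j)).div (conv_continuous hK.periodic hK.continuous S.i1)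
    fun x => (S.hc.trans_le (S.P_lower hK x)).ne'

theorem Slice.cdU (S : Slice d γ c r u) (hK : IsKer d L K) (i j : Fin d) :
    Continuous (dU K r u i j) :=
  ((conv_continuous (dK_per hK i) (hK.d_continuous i).neg (S.iM j)).sub
    ((S.cU hK j).mul (conv_continuous (dK_per hK i) (hK.d_continuous i).neg S.i1))).div
    (conv_continuous hK.periodic hK.continuous S.i1)
    fun x => (S.hc.trans_le (S.P_lower hK x)).ne'

theorem Slice.cPow (S : Slice d γ c r u) (hK : IsKer d L K) (a : ℝ) :
    Continuous (fun x => conv K r x ^ a) :=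
  (conv_continuous hK.periodic hK.continuous S.i1).rpow_const fun x => Or.inl (S.hc.trans_le (S.P_lower hK x)).ne'

theorem Slice.c_err (S : Slice d γ c r u) (hK : IsKer d L K) : Continuous (errT K γ r u) := by
  have h1 := S.cU hK
  have h2 := S.cdU hK
  have h3 := S.cPow hK γ
  have h4 := fun i j => conv_continuous hK.periodic hK.continuous (S.iF i j)
  have h5 := fun i => conv_continuous hK.periodic hK.continuous (S.iM i)
  have h6 := conv_continuous hK.periodic hK.continuous S.iQ
  unfold errT
  refine Continuous.add (continuous_finsetSum _ fun i _ => continuous_finsetSum _ fun j _ =>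
    (h2 i j).mul ((h4 i j).sub ((h5 i).mul (h1 j)))) ((h6.sub (continuous_const.mul h3)).mul
      (continuous_finsetSum _ fun i _ => h2 i i))

theorem Slice.c_flux (S : Slice d γ c r u) (hK : IsKer d L K) : Continuous (flux K γ r u) := by
  have h1 := S.cU hK
  have h3 := S.cPow hK (γ - 1)
  have h4 := fun k i j => conv_continuous (dK_per hK k) (hK.d_continuous k).neg (S.iF i j)
  have h5 := fun k i => conv_continuous (dK_per hK k) (hK.d_continuous k).neg (S.iM i)
  have h6 := fun k => conv_continuous (dK_per hK k) (hK.d_continuous k).neg S.iQ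
  unfold flux
  refine Continuous.add (((continuous_const.mul (continuous_finsetSum _ fun j _ => (h1 j).pow 2)).add (continuous_const.mul h3)).mul
    (continuous_finsetSum _ fun i _ => h5 i i)) (continuous_finsetSum _ fun j _ => (h1 j).mul
      ((continuous_finsetSum _ fun i _ => h4 i i j).add (h6 j)))

theorem Slice.c_dH (S : Slice d γ c r u) (hK : IsKer d L K) (i : Fin d) : Continuous (dH K γ r u i) := by
  have h1 := S.cU hK
  have h2 := S.cdU hK
  have h3 := S.cPow hK
  have h4 := fun k i j => conv_continuous (dK_per hK k) (hK.d_continuous k).neg (S.iF i j)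
  have h5 := fun k i => conv_continuous (dK_per hK k) (hK.d_continuous k).neg (S.iM i)
  have h6 := fun k => conv_continuous (dK_per hK k) (hK.d_continuous k).neg S.iQ
  have h7 := fun i j => conv_continuous hK.periodic hK.continuous (S.iF i j)
  have h8 := fun i => conv_continuous hK.periodic hK.continuous (S.iM i)
  have h9 := conv_continuous hK.periodic hK.continuous S.iQ
  unfold dH
  refine Continuous.add (Continuous.sub (Continuous.add (Continuous.add (Continuous.sub ?_ ?_) ?_) ?_) ?_) ?_
  · exact (continuous_finsetSum _ fun j _ => (h1 j).mul (h2 i j)).neg.mul (h8 i)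
  · exact (continuous_const.mul (continuous_finsetSum _ fun j _ => (h1 j).pow 2)).mul (h5 i i)
  · exact continuous_finsetSum _ fun j _ => ((h2 i j).mul (h7 i j)).add ((h1 j).mul (h4 i i j))
  · exact (continuous_const.mul (h3 _)).mul (h5 i i)
  · exact (continuous_const.mul (h3 _)).mul (h2 i i)
  · exact ((h2 i i).mul h9).add ((h1 i).mul (h6 i))

theorem dU_periodic (hK : IsKer d L K) (i j : Fin d) : SpacePeriodic (dU K r u i j) := fun x n => by
  have h1 := fun h : (Fin d → ℝ) → ℝ => conv_periodic (h := h) hK.periodic x n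
  have h2 := fun h : (Fin d → ℝ) → ℝ => conv_periodic (h := h) (dK_per hK i) x n
  simp only [dU, h1, h2]

theorem Slice.int_dH (S : Slice d γ c r u) (hK : IsKer d L K) (i : Fin d) :
    ∫ x in unitCube d, dH K γ r u i x = 0 := by
  refine integral_cube_deriv i (fun x => -(1/2) * (∑ j, (conv K (fun y => r y * u y j) x / conv K r x) ^ 2) * conv K (fun y => r y * u y i) x
      + (∑ j, conv K (fun y => r y * u y j) x / conv K r x * conv K (fun y => r y * u y i * u y j) x)
      + kappa γ * γ / (γ - 1) * conv K r x ^ (γ - 1) * conv K (fun y => r y * u y i) x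
      - kappa γ * conv K r x ^ γ * (conv K (fun y => r y * u y i) x / conv K r x) +
      conv K (fun y => r y * u y i) x / conv K r x * conv K (fun y => kappa γ * r y ^ γ) x) _ ?_ ?_ (S.c_dH hK i) ?_
  · intro x n
    have h1 := fun h : (Fin d → ℝ) → ℝ => conv_periodic (h := h) hK.periodic x n
    simp only [h1]
  · intro x n
    have h1 := fun h : (Fin d → ℝ) → ℝ => conv_periodic (h := h) hK.periodic x n
    have h2 := fun h : (Fin d → ℝ) → ℝ => conv_periodic (h := h) (dK_per hK i) x n
    have h3 := fun j => dU_periodic (r := r) (u := u) hK i j x n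
    simp only [dH, h1, h2, h3]
  · intro x
    have hx : x + (0:ℝ) • (Pi.single i 1 : Fin d → ℝ) = x := by simp
    have := H_deriv (k := kappa γ) S.hγ i (P := fun s => conv K r (x + s • Pi.single i 1))
      (Q := fun s => conv K (fun y => kappa γ * r y ^ γ) (x + s • Pi.single i 1))
      (M := fun j s => conv K (fun y => r y * u y j) (x + s • Pi.single i 1))
      (F := fun j s => conv K (fun y => r y * u y i * u y j) (x + s • Pi.single i 1))
      (dV := fun j => dU K r u i j x)
      (by rw [hx]; exact (S.hc.trans_le (S.P_lower hK x)))
      (conv_hasDerivAt hK S.i1 i x) (conv_hasDerivAt hK S.iQ i x) (fun j => conv_hasDerivAt hK (S.iM j) i x)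
      (fun j => conv_hasDerivAt hK (S.iF i j) i x) (fun j => by rw [hx]; rfl)
    simp only [hx] at this
    exact this

theorem Slice.int_flux (S : Slice d γ c r u) (hK : IsKer d L K) :
    ∫ x in unitCube d, flux K γ r u x = - ∫ x in unitCube d, errT K γ r u x := by
  have h1 : Integrable (flux K γ r u) (cubeVol d) := continuous_integrable_cube (S.c_flux hK)
  have h2 : Integrable (errT K γ r u) (cubeVol d) := continuous_integrable_cube (S.c_err hK)
  have e := integral_add h1 h2
  rw [eq_neg_iff_add_eq_zero]
  refine e.symm.trans ?_
  simp only [flux_add_err]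
  rw [integral_finsetSum _ fun i _ => continuous_integrable_cube (S.c_dH hK i)]
  exact Finset.sum_eq_zero fun i _ => S.int_dH hK i

/-- The T-functional -/
def TL (K : (Fin d → ℝ) → ℝ) (γ ε δ : ℝ) (r : (Fin d → ℝ) → ℝ) (u : (Fin d → ℝ) → Fin d → ℝ) (x : Fin d → ℝ) : ℝ≥0∞ :=
  ∫⁻ w, (1 + ENNReal.ofReal (r (x + w) ^ pE γ) + ENNReal.ofReal ((|r (x + w) - r x| / ε) ^ pE γ) +
    ENNReal.ofReal ((‖u (x + w) - u x‖ / δ) ^ qE γ)) ∂(kerMeas K)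

theorem Slice.TT_le (S : Slice d γ c r u) (hK : IsKer d L K) {ε δ : ℝ} (hε : 0 < ε) (hδ : 0 < δ) (x : Fin d → ℝ) :
    ENNReal.ofReal (TT (kerMeas K) γ ε δ (fun w => r (x + w)) (fun w => |r (x + w) - conv K r x|) (fun w => ‖u (x + w) - u x‖)) ≤
      ENNReal.ofReal (2 ^ (pE γ + 1)) * TL K γ ε δ r u x := by
  have := hK.isProb
  have hD := S.dat hK x
  have ho := hD.osc (hK.conv_eq S.pr x) (S.r0 x) hε
  have h2 := two_rpow_pE S.hγ
  have hT := hD.TT_nonneg hε hδ (f := fun w => |r (x+w) - r x|) (fun w => abs_nonneg _)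
  have i1 := hD.iR
  have i2 := (hD.fdat (S.r0 x)).ifs hε
  have i3 := hD.igs hδ
  have e : TL K γ ε δ r u x = ENNReal.ofReal (1 + (∫ w, r (x + w) ^ pE γ ∂(kerMeas K)) +
     (∫ w, (|r (x + w) - r x| / ε) ^ pE γ ∂(kerMeas K)) + ∫ w, (‖u (x + w) - u x‖ / δ) ^ qE γ ∂(kerMeas K)) := by
    rw [ENNReal.ofReal_add (by linarith [hT.1, hT.2.1]) hT.2.2, ENNReal.ofReal_add (by linarith [hT.1]) hT.2.1,
      ENNReal.ofReal_add zero_le_one hT.1, ofReal_integral_eq_lintegral_ofReal i1 (Filter.Eventually.of_forall fun w => Real.rpow_nonneg (hD.R0 w) _),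
      ofReal_integral_eq_lintegral_ofReal i2 (Filter.Eventually.of_forall fun w => by positivity),
      ofReal_integral_eq_lintegral_ofReal i3 (Filter.Eventually.of_forall fun w => by positivity)]
    unfold TL
    have m1 : Measurable fun w => ENNReal.ofReal (r (x + w) ^ pE γ) := (hD.mR.pow_const _).ennreal_ofReal
    have m2 : Measurable fun w => ENNReal.ofReal ((|r (x + w) - r x| / ε) ^ pE γ) :=
      (((hD.mR.sub_const _).abs.div_const _).pow_const _).ennreal_ofReal
    rw [lintegral_add_left (by exact (measurable_const.add m1).add m2), lintegral_add_left (by exact measurable_const.add m1),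
      lintegral_add_left measurable_const]
    simp
  rw [e, ← ENNReal.ofReal_mul (by positivity)]
  refine ENNReal.ofReal_le_ofReal ?_
  unfold TT
  set a := ∫ w, r (x + w) ^ pE γ ∂(kerMeas K)
  set b := ∫ w, (|r (x + w) - r x| / ε) ^ pE γ ∂(kerMeas K)
  set b' := ∫ w, (|r (x + w) - conv K r x| / ε) ^ pE γ ∂(kerMeas K)
  set e := ∫ w, (‖u (x + w) - u x‖ / δ) ^ qE γ ∂(kerMeas K)
  set k := (2:ℝ) ^ (pE γ + 1)
  nlinarith [hT.1, hT.2.1, hT.2.2]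

end slice

end part10

section part11

section slice2
variable {d : ℕ} {γ c L : ℝ} {r : (Fin d → ℝ) → ℝ} {u : (Fin d → ℝ) → Fin d → ℝ} {K : (Fin d → ℝ) → ℝ}

/-- constant for the error -/
def CE (d : ℕ) (γ : ℝ) : ℝ := 4 * d ^ 2 + 2 * d * kappa γ * γ * (2 ^ (pE γ + 1) + 10 * 4 ^ (γ - 1))

theorem CE_nonneg (d : ℕ) {γ : ℝ} (hγ : 1 < γ) : 0 ≤ CE d γ := by
  have := kappa_pos hγ
  have : 0 < γ := by linarith
  unfold CE; positivity

/-- abbreviation for the `TT` functional at a point -/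
def TX (K : (Fin d → ℝ) → ℝ) (γ ε δ : ℝ) (r : (Fin d → ℝ) → ℝ) (u : (Fin d → ℝ) → Fin d → ℝ) (x : Fin d → ℝ) : ℝ :=
  TT (kerMeas K) γ ε δ (fun w => r (x + w)) (fun w => |r (x + w) - conv K r x|) (fun w => ‖u (x + w) - u x‖)

theorem Slice.TX_nonneg (S : Slice d γ c r u) (hK : IsKer d L K) {ε δ : ℝ} (hε : 0 < ε) (hδ : 0 < δ) (x : Fin d → ℝ) :
    0 ≤ TX K γ ε δ r u x := by
  have := hK.isProb
  have h := (S.dat hK x).TT_nonneg hε hδ (f := fun w => |r (x+w) - conv K r x|) (fun w => abs_nonneg _)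
  unfold TX TT
  linarith [h.1, h.2.1, h.2.2]

theorem Slice.cov_le (S : Slice d γ c r u) (hK : IsKer d L K) (i j : Fin d) (x : Fin d → ℝ) :
    |conv K (fun y => r y * u y i * u y j) x -
    conv K (fun y => r y * u y i) x * (conv K (fun y => r y * u y j) x / conv K r x)| ≤
      2 * ∫ w, r (x + w) * ‖u (x + w) - u x‖ ^ 2 ∂(kerMeas K) := by
  have := hK.isProb
  have hD := S.dat hK x
  have hP := S.hc.trans_le (S.P_lower hK x)
  rw [hK.conv_eq S.pr] at hP ⊢
  rw [hK.conv_eq (S.pF i j), hK.conv_eq (S.pM i), hK.conv_eq (S.pM j)]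
  exact hD.covar (V := fun w => u (x+w)) (v0 := u x) (S.mu.comp (measurable_const_add x)) (fun w => le_rfl) i j hP

theorem Slice.pres_le (S : Slice d γ c r u) (hK : IsKer d L K) (x : Fin d → ℝ) :
    |conv K (fun y => kappa γ * r y ^ γ) x - kappa γ * conv K r x ^ γ| ≤
      kappa γ * γ * ∫ w, |r (x + w) - conv K r x| * (r (x + w) + conv K r x) ^ (γ - 1) ∂(kerMeas K) := by
  have := hK.isProb
  have hD := S.dat hK x
  have hP := S.hc.trans_le (S.P_lower hK x)
  have h := hD.pres hP.le
  rw [hK.conv_eq S.pQ, integral_const_mul, ← mul_sub, abs_mul, abs_of_pos (kappa_pos S.hγ), mul_assoc]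
  exact mul_le_mul_of_nonneg_left h (kappa_pos S.hγ).le

theorem Slice.err_le (S : Slice d γ c r u) (hK : IsKer d L K) (hL : 0 ≤ L) {ε δ : ℝ} (hε : 0 < ε) (hε1 : ε ≤ 1)
    (hδ : 0 < δ) (x : Fin d → ℝ) :
    |errT K γ r u x| ≤ CE d γ * L * (δ ^ 3 + ε * δ) * TX K γ ε δ r u x := by
  have := hK.isProb
  have hD := S.dat hK x
  have hT := S.TX_nonneg hK hε hδ x
  have hP := S.hc.trans_le (S.P_lower hK x)
  have hPe := hK.conv_eq S.pr x
  have hk := kappa_pos S.hγ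
  have hγ := S.hγ
  have b3 := hD.bd3 hε hδ (fun w => |r (x+w) - conv K r x|) (fun w => abs_nonneg _)
  have bp := hD.bdP2 hε hε1 hδ hPe hP
  have ch := hD.cheb (hPe ▸ hP)
  rw [← hPe] at ch
  have hU := fun i j => S.dU_le hK hL i j x
  have hC := fun i j => S.cov_le hK i j x
  have hQ := S.pres_le hK x
  change _ ≤ δ ^ 3 * TX K γ ε δ r u x at b3
  change _ ≤ _ * TX K γ ε δ r u x at bp
  have hA0 : 0 ≤ ∫ w, r (x + w) * ‖u (x + w) - u x‖ ^ 2 ∂(kerMeas K) :=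
    integral_nonneg fun w => mul_nonneg (S.r0 _) (by positivity)
  have hm0 : 0 ≤ (∫ w, r (x + w) * ‖u (x + w) - u x‖ ∂(kerMeas K)) / conv K r x :=
    div_nonneg (integral_nonneg fun w => mul_nonneg (S.r0 _) (by positivity)) hP.le
  have hB0 : 0 ≤ ∫ w, |r (x + w) - conv K r x| * (r (x + w) + conv K r x) ^ (γ - 1) ∂(kerMeas K) :=
    integral_nonneg fun w => mul_nonneg (abs_nonneg _) (Real.rpow_nonneg (add_nonneg (S.r0 _) hP.le) _)
  set A := ∫ w, r (x + w) * ‖u (x + w) - u x‖ ^ 2 ∂(kerMeas K)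
  set m := (∫ w, r (x + w) * ‖u (x + w) - u x‖ ∂(kerMeas K)) / conv K r x
  set B := ∫ w, |r (x + w) - conv K r x| * (r (x + w) + conv K r x) ^ (γ - 1) ∂(kerMeas K)
  set t := TX K γ ε δ r u x
  set G : ℝ := 2 ^ (pE γ + 1) + 10 * 4 ^ (γ - 1) with hG
  have hG0 : 0 ≤ G := by positivity
  have h1 : |∑ i, ∑ j, dU K r u i j x * (conv K (fun y => r y * u y i * u y j) x -
    conv K (fun y => r y * u y i) x * (conv K (fun y => r y * u y j) x / conv K r x))| ≤ 4 * d ^ 2 * L * (δ ^ 3 * t) := by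
    calc _ ≤ ∑ i : Fin d, ∑ j : Fin d, 4 * L * (δ ^ 3 * t) := by
          refine (Finset.abs_sum_le_sum_abs _ _).trans (Finset.sum_le_sum fun i _ =>
            (Finset.abs_sum_le_sum_abs _ _).trans (Finset.sum_le_sum fun j _ => ?_))
          rw [abs_mul]
          calc _ ≤ (2 * L * m) * (2 * A) := mul_le_mul (hU i j) (hC i j) (abs_nonneg _) (by positivity)
            _ = 4 * L * (A * m) := by ring
            _ ≤ _ := mul_le_mul_of_nonneg_left (ch.trans b3) (by positivity)
      _ = _ := by simp; ring
  have h2 : |(conv K (fun y => kappa γ * r y ^ γ) x - kappa γ * conv K r x ^ γ) * ∑ i, dU K r u i i x| ≤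
      2 * d * kappa γ * γ * L * (G * (ε * δ) * t) := by
    rw [abs_mul]
    have h3 : |∑ i, dU K r u i i x| ≤ d * (2 * L * m) := by
      calc _ ≤ ∑ i : Fin d, (2 * L * m) := (Finset.abs_sum_le_sum_abs _ _).trans (Finset.sum_le_sum fun i _ => hU i i)
        _ = _ := by simp
    calc _ ≤ (kappa γ * γ * B) * (d * (2 * L * m)) := mul_le_mul hQ h3 (abs_nonneg _) (by positivity)
      _ = 2 * d * kappa γ * γ * L * (B * m) := by ring
      _ ≤ _ := mul_le_mul_of_nonneg_left bp (by positivity)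
  unfold errT
  refine (abs_add_le _ _).trans ((add_le_add h1 h2).trans ?_)
  have e : CE d γ = 4 * d ^ 2 + 2 * d * kappa γ * γ * G := rfl
  rw [e]
  have f1 : 0 ≤ 4 * (d:ℝ) ^ 2 * L * (ε * δ * t) := by positivity
  have f2 : 0 ≤ 2 * (d:ℝ) * kappa γ * γ * G * L * (δ ^ 3 * t) := by positivity
  nlinarith

/-- mollified energy density -/
def eDens (K : (Fin d → ℝ) → ℝ) (γ : ℝ) (r : (Fin d → ℝ) → ℝ) (u : (Fin d → ℝ) → Fin d → ℝ) (x : Fin d → ℝ) : ℝ :=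
  (1/2) * (∑ j, conv K (fun y => r y * u y j) x ^ 2 / conv K r x) + kappa γ / (γ - 1) * conv K r x ^ γ

theorem integral_conv (hK : IsKer d L K) {h : (Fin d → ℝ) → ℝ} (hm : Measurable h) (hp : SpacePeriodic h)
    (hi : Integrable h (cubeVol d)) : ∫ x in unitCube d, conv K h x = ∫ x in unitCube d, h x := by
  have e : ∀ w, ∫ x in unitCube d, h (x + w) = ∫ x in unitCube d, h x := integral_cube_add h hp
  have hp2 : SpacePeriodic (fun x => |h x|) := fun x n => by simp only [hp x n]
  have e2 : ∀ w, ∫ x in unitCube d, |h (x + w)| = ∫ x in unitCube d, |h x| := integral_cube_add _ hp2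
  have hmm : Measurable (fun z : (Fin d → ℝ) × (Fin d → ℝ) => K z.2 * h (z.1 + z.2)) :=
    (hK.continuous.measurable.comp measurable_snd).mul (hm.comp (measurable_fst.add measurable_snd))
  have hInt0 : Integrable (Function.uncurry fun x w => K w * h (x + w)) ((cubeVol d).prod (cubeVol d)) := by
    refine (integrable_prod_iff' hmm.aestronglyMeasurable).2 ⟨Filter.Eventually.of_forall fun w => (integrable_cube_add h hm hp hi w).const_mul (K w), ?_⟩
    have : (fun w => ∫ x, ‖K w * h (x + w)‖ ∂(cubeVol d)) =
        fun w => K w * ∫ x in unitCube d, |h x| := by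
      funext w
      simp only [norm_mul, Real.norm_eq_abs, abs_of_pos (hK.pos _)]
      rw [integral_const_mul, cubeVol, e2]
    change Integrable (fun w => ∫ x, ‖K w * h (x + w)‖ ∂(cubeVol d)) _
    rw [this]
    exact (continuous_integrable_cube hK.continuous).mul_const _
  have h1 : ∫ x in unitCube d, conv K h x = ∫ x in unitCube d, ∫ w in unitCube d, K w * h (x + w) := by
    congr 1; funext x; exact conv_eq_shift hK.periodic hp x
  rw [h1]
  refine (integral_integral_swap hInt0).trans ?_
  change ∫ w in unitCube d, ∫ x in unitCube d, K w * h (x + w) = _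
  simp only [integral_const_mul, e]
  rw [integral_mul_const, hK.int_one, one_mul]

/-- constant for the energy difference -/
def CD (d : ℕ) (γ : ℝ) : ℝ := d + kappa γ * γ / (γ - 1) * 2 ^ (pE γ + 1)

theorem CD_nonneg (d : ℕ) {γ : ℝ} (hγ : 1 < γ) : 0 ≤ CD d γ := by
  have := kappa_pos hγ
  have : 0 < γ := by linarith
  have : 0 < γ - 1 := by linarith
  unfold CD; positivity

theorem Slice.dens_le (S : Slice d γ c r u) (hK : IsKer d L K) {ε δ : ℝ} (hε : 0 < ε)
    (hδ : 0 < δ) (x : Fin d → ℝ) :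
    |((1/2) * (∑ j, conv K (fun y => r y * u y j * u y j) x) + 1 / (γ - 1) * conv K (fun y => kappa γ * r y ^ γ) x)
      - eDens K γ r u x| ≤ CD d γ * (δ ^ 2 + ε) * TX K γ ε δ r u x := by
  have := hK.isProb
  have hD := S.dat hK x
  have hT := S.TX_nonneg hK hε hδ x
  have hPe := hK.conv_eq S.pr x
  have hk := kappa_pos S.hγ
  have hγ := S.hγ
  have hγ1 : 0 < γ - 1 := by linarith
  have b2 := hD.bd2 hε hδ (fun w => |r (x+w) - conv K r x|) (fun w => abs_nonneg _)
  have bp := hD.bdP1 hε hδ hPe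
  have hC := fun i j => S.cov_le hK i j x
  have hQ := S.pres_le hK x
  change _ ≤ δ ^ 2 * TX K γ ε δ r u x at b2
  change _ ≤ _ * TX K γ ε δ r u x at bp
  set A := ∫ w, r (x + w) * ‖u (x + w) - u x‖ ^ 2 ∂(kerMeas K)
  set B := ∫ w, |r (x + w) - conv K r x| * (r (x + w) + conv K r x) ^ (γ - 1) ∂(kerMeas K)
  set t := TX K γ ε δ r u x
  set Q := conv K (fun y => kappa γ * r y ^ γ) x
  have e : ((1/2) * (∑ j, conv K (fun y => r y * u y j * u y j) x) + 1 / (γ - 1) * Q) - eDens K γ r u x =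
    (1/2) * (∑ j, (conv K (fun y => r y * u y j * u y j) x -
    conv K (fun y => r y * u y j) x * (conv K (fun y => r y * u y j) x / conv K r x))) +
     1 / (γ - 1) * (Q - kappa γ * conv K r x ^ γ) := by
    unfold eDens
    rw [Finset.sum_sub_distrib]
    have : ∀ j, conv K (fun y => r y * u y j) x * (conv K (fun y => r y * u y j) x / conv K r x) =
      conv K (fun y => r y * u y j) x ^ 2 / conv K r x := fun j => by ring
    simp only [this]
    ring
  rw [e]
  refine (abs_add_le _ _).trans ?_
  rw [abs_mul, abs_mul, abs_of_pos (by positivity : 0 < 1 / (γ - 1)), abs_of_pos (by norm_num : (0:ℝ) < 1/2)]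
  have h1 : |∑ j, (conv K (fun y => r y * u y j * u y j) x -
    conv K (fun y => r y * u y j) x * (conv K (fun y => r y * u y j) x / conv K r x))| ≤ d * (2 * (δ ^ 2 * t)) := by
    calc _ ≤ ∑ j : Fin d, 2 * (δ ^ 2 * t) := (Finset.abs_sum_le_sum_abs _ _).trans
          (Finset.sum_le_sum fun j _ => (hC j j).trans (by linarith))
      _ = _ := by simp
  have h2 : 1 / (γ - 1) * |Q - kappa γ * conv K r x ^ γ| ≤ 1 / (γ - 1) * (kappa γ * γ * (2 ^ (pE γ + 1) * ε * t)) :=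
    mul_le_mul_of_nonneg_left (hQ.trans (mul_le_mul_of_nonneg_left bp (by positivity))) (by positivity)
  have e3 : CD d γ * (δ ^ 2 + ε) * t = 1/2 * (d * (2 * (δ ^ 2 * t))) + 1 / (γ - 1) * (kappa γ * γ * (2 ^ (pE γ + 1) * ε * t))
     + (d * (ε * t) + kappa γ * γ / (γ - 1) * 2 ^ (pE γ + 1) * (δ ^ 2 * t)) := by
    unfold CD; ring
  rw [e3]
  have f1 : 0 ≤ (d * (ε * t) + kappa γ * γ / (γ - 1) * 2 ^ (pE γ + 1) * (δ ^ 2 * t)) := by positivity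
  linarith

theorem Slice.c_dens (S : Slice d γ c r u) (hK : IsKer d L K) : Continuous (eDens K γ r u) := by
  have h3 := S.cPow hK γ
  have h1 := conv_continuous hK.periodic hK.continuous S.i1
  have h5 := fun i => conv_continuous hK.periodic hK.continuous (S.iM i)
  unfold eDens
  exact (continuous_const.mul (continuous_finsetSum _ fun j _ => ((h5 j).pow 2).div h1
    fun x => (S.hc.trans_le (S.P_lower hK x)).ne')).add (continuous_const.mul h3)

theorem ofReal_abs_integral_le {Ω : Type*} [MeasurableSpace Ω] {μ : Measure Ω} {f : Ω → ℝ} {T : Ω → ℝ≥0∞} {a : ℝ≥0∞}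
    (ha : a ≠ ∞) (h : ∀ x, ENNReal.ofReal |f x| ≤ a * T x) :
    ENNReal.ofReal |∫ x, f x ∂μ| ≤ a * ∫⁻ x, T x ∂μ := by
  rw [← lintegral_const_mul' _ _ ha]
  refine le_trans ?_ (lintegral_mono h)
  have := enorm_integral_le_lintegral_enorm (μ := μ) f
  simpa only [Real.enorm_eq_ofReal_abs] using this

theorem Slice.flux_bd (S : Slice d γ c r u) (hK : IsKer d L K) (hL : 0 ≤ L) {ε δ : ℝ} (hε : 0 < ε) (hε1 : ε ≤ 1)
    (hδ : 0 < δ) :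
    ENNReal.ofReal |∫ x in unitCube d, flux K γ r u x| ≤
      ENNReal.ofReal (CE d γ * L * (δ ^ 3 + ε * δ) * 2 ^ (pE γ + 1)) * ∫⁻ x in unitCube d, TL K γ ε δ r u x := by
  rw [S.int_flux hK, abs_neg]
  refine ofReal_abs_integral_le ENNReal.ofReal_ne_top fun x => ?_
  have h0 : 0 ≤ CE d γ * L * (δ ^ 3 + ε * δ) := mul_nonneg (mul_nonneg (CE_nonneg d S.hγ) hL) (by positivity)
  refine (ENNReal.ofReal_le_ofReal (S.err_le hK hL hε hε1 hδ x)).trans ?_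
  rw [ENNReal.ofReal_mul h0, ENNReal.ofReal_mul h0, mul_assoc (ENNReal.ofReal _) (ENNReal.ofReal _)]
  refine mul_le_mul_right ?_ _
  exact S.TT_le hK hε hδ x

theorem Slice.energy_bd (S : Slice d γ c r u) (hK : IsKer d L K) {ε δ : ℝ} (hε : 0 < ε)
    (hδ : 0 < δ) :
    ENNReal.ofReal |(∫ x in unitCube d, ((1 / 2 : ℝ) * r x * euNorm (u x) ^ 2 + (kappa γ / (γ - 1)) * r x ^ γ)) -
        ∫ x in unitCube d, eDens K γ r u x| ≤
      ENNReal.ofReal (CD d γ * (δ ^ 2 + ε) * 2 ^ (pE γ + 1)) * ∫⁻ x in unitCube d, TL K γ ε δ r u x := by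
  have c1 := fun j => conv_continuous hK.periodic hK.continuous (S.iF j j)
  have c2 := conv_continuous hK.periodic hK.continuous S.iQ
  have i1 := fun j => continuous_integrable_cube (c1 j)
  have i2 := continuous_integrable_cube c2
  have mF : ∀ j, Measurable fun y => r y * u y j * u y j := fun j =>
    (S.mr.mul ((measurable_pi_apply j).comp S.mu)).mul ((measurable_pi_apply j).comp S.mu)
  have mQ : Measurable fun y => kappa γ * r y ^ γ := (S.mr.pow_const _).const_mul _
  have e1 : ∫ x in unitCube d, ((1/2) * (∑ j, conv K (fun y => r y * u y j * u y j) x) + 1 / (γ - 1) * conv K (fun y => kappa γ * r y ^ γ) x) =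
     ∫ x in unitCube d, ((1/2) * (∑ j, r x * u x j * u x j) + 1 / (γ - 1) * (kappa γ * r x ^ γ)) := by
    refine (integral_add ((integrable_finsetSum _ fun j _ => i1 j).const_mul _) (i2.const_mul _)).trans ?_
    refine Eq.trans ?_ (integral_add ((integrable_finsetSum _ fun j _ => S.iF j j).const_mul _) (S.iQ.const_mul _)).symm
    rw [integral_const_mul, integral_const_mul, integral_const_mul, integral_const_mul,
      integral_finsetSum _ fun j _ => i1 j, integral_finsetSum _ fun j _ => S.iF j j]
    congr 2
    · exact Finset.sum_congr rfl fun j _ => integral_conv hK (mF j) (S.pF j j) (S.iF j j)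
    · exact integral_conv hK mQ S.pQ S.iQ
  have e2 : ∀ x, (1 / 2 : ℝ) * r x * euNorm (u x) ^ 2 + (kappa γ / (γ - 1)) * r x ^ γ =
      ((1/2) * (∑ j, r x * u x j * u x j) + 1 / (γ - 1) * (kappa γ * r x ^ γ)) := fun x => by
    unfold euNorm
    rw [Real.sq_sqrt (Finset.sum_nonneg fun j _ => sq_nonneg _), mul_assoc, Finset.mul_sum]
    congr 1
    · congr 1; exact Finset.sum_congr rfl fun j _ => by ring
    · ring
  simp only [e2]
  rw [← e1]
  have e3 := integral_sub (((integrable_finsetSum Finset.univ fun j _ => i1 j).const_mul (1/2)).add (i2.const_mul (1/(γ - 1)))) (continuous_integrable_cube (S.c_dens hK))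
  have e4 : (∫ x in unitCube d, ((1/2) * (∑ j, conv K (fun y => r y * u y j * u y j) x) + 1 / (γ - 1) * conv K (fun y => kappa γ * r y ^ γ) x)) -
    ∫ x in unitCube d, eDens K γ r u x = ∫ x in unitCube d, (((1/2) * (∑ j, conv K (fun y => r y * u y j * u y j) x) + 1 / (γ - 1) * conv K (fun y => kappa γ * r y ^ γ) x) - eDens K γ r u x) := e3.symm
  rw [e4]
  refine ofReal_abs_integral_le ENNReal.ofReal_ne_top fun x => ?_
  have h0 : 0 ≤ CD d γ * (δ ^ 2 + ε) := mul_nonneg (CD_nonneg d S.hγ) (by positivity)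
  refine (ENNReal.ofReal_le_ofReal (S.dens_le hK hε hδ x)).trans ?_
  rw [ENNReal.ofReal_mul h0, ENNReal.ofReal_mul h0, mul_assoc (ENNReal.ofReal _) (ENNReal.ofReal _)]
  refine mul_le_mul_right ?_ _
  exact S.TT_le hK hε hδ x

end slice2

end part11

section part12

theorem TL_measurable {d : ℕ} {γ ε δ L : ℝ} {K : (Fin d → ℝ) → ℝ} (hK : IsKer d L K)
    {ρ : ℝ → (Fin d → ℝ) → ℝ} (hρm : Measurable (Function.uncurry ρ))
    {v : ℝ → (Fin d → ℝ) → Fin d → ℝ} (hvm : Measurable (Function.uncurry v)) :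
    Measurable (fun z : (ℝ × (Fin d → ℝ)) × (Fin d → ℝ) => 1 + ENNReal.ofReal (ρ z.1.1 (z.1.2 + z.2) ^ pE γ) +
      ENNReal.ofReal ((|ρ z.1.1 (z.1.2 + z.2) - ρ z.1.1 z.1.2| / ε) ^ pE γ) +
      ENNReal.ofReal ((‖v z.1.1 (z.1.2 + z.2) - v z.1.1 z.1.2‖ / δ) ^ qE γ)) ∧
    Measurable (fun z : ℝ × (Fin d → ℝ) => TL K γ ε δ (ρ z.1) (v z.1) z.2) := by
  have := hK.isProb
  have a1 : Measurable (fun z : (ℝ × (Fin d → ℝ)) × (Fin d → ℝ) => ρ z.1.1 (z.1.2 + z.2)) :=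
    hρm.comp (Measurable.prodMk (measurable_fst.comp measurable_fst) ((measurable_snd.comp measurable_fst).add measurable_snd))
  have a2 : Measurable (fun z : (ℝ × (Fin d → ℝ)) × (Fin d → ℝ) => ρ z.1.1 z.1.2) := hρm.comp measurable_fst
  have b1 : Measurable (fun z : (ℝ × (Fin d → ℝ)) × (Fin d → ℝ) => v z.1.1 (z.1.2 + z.2)) :=
    hvm.comp (Measurable.prodMk (measurable_fst.comp measurable_fst) ((measurable_snd.comp measurable_fst).add measurable_snd))
  have b2 : Measurable (fun z : (ℝ × (Fin d → ℝ)) × (Fin d → ℝ) => v z.1.1 z.1.2) := hvm.comp measurable_fst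
  have h := ((measurable_const (a := (1:ℝ≥0∞))).add (a1.pow_const (pE γ)).ennreal_ofReal).add
    ((((a1.sub a2).abs).div_const ε).pow_const (pE γ)).ennreal_ofReal
  have h' := h.add ((((b1.sub b2).norm).div_const δ).pow_const (qE γ)).ennreal_ofReal
  exact ⟨h', Measurable.lintegral_prod_right' (ν := kerMeas K) h'⟩

theorem TL_bound {d : ℕ} {T γ α : ℝ} (hγ : 1 < γ) (hα : 0 < α)
    {ρ : ℝ → (Fin d → ℝ) → ℝ} (hρm : Measurable (Function.uncurry ρ)) (hρp : ∀ t, SpacePeriodic (ρ t))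
    {v : ℝ → (Fin d → ℝ) → Fin d → ℝ} (hvm : Measurable (Function.uncurry v))
    {Rp G V : ℝ≥0∞} (hRt : Rp ≠ ∞) (hGt : G ≠ ∞) (hVt : V ≠ ∞)
    (hR : ∫⁻ z, ENNReal.ofReal (ρ z.1 z.2 ^ pE γ) ∂(spaceTime d T) ≤ Rp)
    (hG : ∀ y : Fin d → ℝ, ∫⁻ z, ENNReal.ofReal (|ρ z.1 (z.2 + y) - ρ z.1 z.2| ^ pE γ) ∂(spaceTime d T) ≤ G * ENNReal.ofReal (tN y ^ pE γ))
    (hV : ∀ w : Fin d → ℝ, ∫⁻ z, ENNReal.ofReal (‖v z.1 (z.2 + w) - v z.1 z.2‖ ^ qE γ) ∂(spaceTime d T) ≤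
      V * ENNReal.ofReal (tN w ^ (α * qE γ))) :
    ∃ C : ℝ≥0∞, C ≠ ∞ ∧ ∀ ε : ℝ, 0 < ε → ε ≤ 1 →
      ∫⁻ t in Set.Ioo 0 T, ∫⁻ x in unitCube d, TL (ker d ε) γ ε (ε ^ α) (ρ t) (v t) x ≤ C := by
  have hp : 0 < pE γ := by linarith [pE_gt hγ]
  have hq : 0 < qE γ := by linarith [qE_gt hγ]
  obtain ⟨C1, hC10, hC1⟩ := ker_moment d hp
  obtain ⟨C2, hC20, hC2⟩ := ker_moment d (mul_pos hα hq)
  refine ⟨ENNReal.ofReal T + Rp + G * ENNReal.ofReal C1 + V * ENNReal.ofReal C2, by finiteness, fun ε hε hε1 => ?_⟩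
  have hK := ker_isKer (d := d) hε hε1
  have := hK.isProb
  have := spaceTime_finite d T
  have hδ : 0 < ε ^ α := Real.rpow_pos_of_pos hε _
  obtain ⟨m1, m2⟩ := TL_measurable (γ := γ) (ε := ε) (δ := ε ^ α) hK hρm hvm
  rw [← lintegral_spaceTime m2]
  unfold TL
  rw [lintegral_lintegral_swap m1.aemeasurable]
  have hvol : (spaceTime d T) Set.univ = ENNReal.ofReal T := by
    rw [spaceTime, ← Set.univ_prod_univ, Measure.prod_prod]; simp
  have key : ∀ w : Fin d → ℝ, ∫⁻ z, (1 + ENNReal.ofReal (ρ z.1 (z.2 + w) ^ pE γ) +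
      ENNReal.ofReal ((|ρ z.1 (z.2 + w) - ρ z.1 z.2| / ε) ^ pE γ) +
      ENNReal.ofReal ((‖v z.1 (z.2 + w) - v z.1 z.2‖ / ε ^ α) ^ qE γ)) ∂(spaceTime d T) ≤
      ENNReal.ofReal T + Rp + G * (ENNReal.ofReal ((ε ^ pE γ)⁻¹) * ENNReal.ofReal (tN w ^ pE γ)) +
       V * (ENNReal.ofReal (((ε ^ α) ^ qE γ)⁻¹) * ENNReal.ofReal (tN w ^ (α * qE γ))) := by
    intro w
    have a1 : Measurable (fun z : (ℝ × (Fin d → ℝ)) => ρ z.1 (z.2 + w)) :=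
      hρm.comp (Measurable.prodMk measurable_fst (measurable_snd.add_const w))
    have b1 : Measurable (fun z : (ℝ × (Fin d → ℝ)) => v z.1 (z.2 + w)) :=
      hvm.comp (Measurable.prodMk measurable_fst (measurable_snd.add_const w))
    have A1 := (a1.pow_const (pE γ)).ennreal_ofReal
    have A2 := (((a1.sub hρm).abs.div_const ε).pow_const (pE γ)).ennreal_ofReal
    have A3 := (((a1.sub hρm).abs).pow_const (pE γ)).ennreal_ofReal
    have A4 := (((b1.sub hvm).norm).pow_const (qE γ)).ennreal_ofReal
    rw [lintegral_add_left (by exact ((measurable_const (a := (1:ℝ≥0∞))).add A1).add A2),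
      lintegral_add_left (by exact (measurable_const (a := (1:ℝ≥0∞))).add A1),
      lintegral_add_left measurable_const, lintegral_const, one_mul, hvol]
    refine add_le_add (add_le_add (add_le_add le_rfl ?_) ?_) ?_
    · refine le_trans (le_of_eq ?_) hR
      refine lintegral_spaceTime_shift (f := fun z => ENNReal.ofReal (ρ z.1 z.2 ^ pE γ)) (hρm.pow_const _).ennreal_ofReal ?_ w
      intro t x n; simp only [hρp t x n]
    · have : ∀ z : ℝ × (Fin d → ℝ), ENNReal.ofReal ((|ρ z.1 (z.2 + w) - ρ z.1 z.2| / ε) ^ pE γ) =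
        ENNReal.ofReal ((ε ^ pE γ)⁻¹) * ENNReal.ofReal (|ρ z.1 (z.2 + w) - ρ z.1 z.2| ^ pE γ) := fun z => by
        rw [← ENNReal.ofReal_mul (by positivity), Real.div_rpow (abs_nonneg _) hε.le, div_eq_inv_mul]
      simp only [this]
      rw [lintegral_const_mul _ (by exact A3), mul_left_comm]
      exact mul_le_mul_right (hG w) _
    · have : ∀ z : ℝ × (Fin d → ℝ), ENNReal.ofReal ((‖v z.1 (z.2 + w) - v z.1 z.2‖ / ε ^ α) ^ qE γ) =
        ENNReal.ofReal (((ε ^ α) ^ qE γ)⁻¹) * ENNReal.ofReal (‖v z.1 (z.2 + w) - v z.1 z.2‖ ^ qE γ) := fun z => by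
        rw [← ENNReal.ofReal_mul (by positivity), Real.div_rpow (norm_nonneg _) hδ.le, div_eq_inv_mul]
      simp only [this]
      rw [lintegral_const_mul _ (by exact A4), mul_left_comm]
      exact mul_le_mul_right (hV w) _
  refine (lintegral_mono key).trans ?_
  have t1 : Measurable fun w : Fin d → ℝ => ENNReal.ofReal (tN w ^ pE γ) := (tN_measurable.pow_const _).ennreal_ofReal
  have t2 : Measurable fun w : Fin d → ℝ => ENNReal.ofReal (tN w ^ (α * qE γ)) := (tN_measurable.pow_const _).ennreal_ofReal
  rw [lintegral_add_left (by fun_prop), lintegral_add_left (by fun_prop), lintegral_const, measure_univ, mul_one,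
    lintegral_const_mul _ (by fun_prop), lintegral_const_mul _ (by fun_prop), lintegral_const_mul _ (by fun_prop), lintegral_const_mul _ (by fun_prop)]
  refine add_le_add (add_le_add le_rfl (mul_le_mul_right ?_ _)) (mul_le_mul_right ?_ _)
  · refine (mul_le_mul_right (hC1 ε hε hε1) _).trans ?_
    rw [← ENNReal.ofReal_mul (by positivity)]
    refine ENNReal.ofReal_le_ofReal (le_of_eq ?_)
    have : ε ^ pE γ ≠ 0 := by positivity
    field_simp
  · refine (mul_le_mul_right (hC2 ε hε hε1) _).trans ?_
    rw [← ENNReal.ofReal_mul (by positivity), Real.rpow_mul hε.le]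
    refine ENNReal.ofReal_le_ofReal (le_of_eq ?_)
    have : (ε ^ α) ^ qE γ ≠ 0 := by positivity
    field_simp

theorem LpLq_lintegral {d : ℕ} {E : Type*} [NormedAddCommGroup E] {T p : ℝ} (hp : 0 < p) (f : ℝ → (Fin d → ℝ) → E)
    (h : MemLpLq T (ENNReal.ofReal p) (ENNReal.ofReal p) f) :
    ∫⁻ t in Set.Ioo 0 T, ∫⁻ x in unitCube d, ‖f t x‖ₑ ^ p < ∞ := by
  unfold MemLpLq LpLqNorm at h
  rw [timeLpOn_ofReal hp] at h
  have h2 := (ENNReal.rpow_lt_top_iff_of_pos (by positivity : 0 < 1 / p)).1 h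
  refine lt_of_le_of_lt (lintegral_mono fun t => ?_) h2
  rw [eLpNorm_ofReal hp, ← ENNReal.rpow_mul, one_div_mul_cancel hp.ne', ENNReal.rpow_one]
  exact le_rfl

theorem LpBesov_lintegral {d : ℕ} {E : Type*} [NormedAddCommGroup E] {T p α : ℝ} (hp : 0 < p) (f : ℝ → (Fin d → ℝ) → E)
    (h : MemLpBesov T (ENNReal.ofReal p) α (ENNReal.ofReal p) f) :
    ∫⁻ t in Set.Ioo 0 T, besovNorm α (ENNReal.ofReal p) (f t) ^ p < ∞ := by
  unfold MemLpBesov LpBesovNorm at h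
  rw [timeLpOn_ofReal hp] at h
  exact (ENNReal.rpow_lt_top_iff_of_pos (by positivity : 0 < 1 / p)).1 h

theorem besov_lintegral {d : ℕ} {E : Type*} [NormedAddCommGroup E] {T p α : ℝ} (hp : 0 < p) (f : ℝ → (Fin d → ℝ) → E)
    (h : MemLpBesov T (ENNReal.ofReal p) α (ENNReal.ofReal p) f) :
    ∫⁻ t in Set.Ioo 0 T, ∫⁻ x in unitCube d, ‖f t x‖ₑ ^ p < ∞ := by
  refine lt_of_le_of_lt (lintegral_mono fun t => ?_) (LpBesov_lintegral hp f h)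
  have : eLpNorm (f t) (ENNReal.ofReal p) (cubeVol d) ≤ besovNorm α (ENNReal.ofReal p) (f t) := le_self_add
  refine le_trans (le_of_eq ?_) (ENNReal.rpow_le_rpow this hp.le)
  rw [eLpNorm_ofReal hp, ← ENNReal.rpow_mul, one_div_mul_cancel hp.ne', ENNReal.rpow_one]
  rfl

/-- Everything about good time slices -/
theorem ae_slice {d : ℕ} {T γ α c : ℝ} (hγ : 1 < γ) (hc : 0 < c)
    {ρ : ℝ → (Fin d → ℝ) → ℝ} (hρm : Measurable (Function.uncurry ρ)) (hρp : ∀ t, SpacePeriodic (ρ t))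
    (hρ0 : ∀ t x, 0 ≤ ρ t x)
    {v : ℝ → (Fin d → ℝ) → Fin d → ℝ} (hvm : Measurable (Function.uncurry v)) (hvp : ∀ t, SpacePeriodic (v t))
    (hlow : ∀ᵐ z ∂(spaceTime d T), c ≤ ρ z.1 z.2)
    (hρ : MemLpLq T (ENNReal.ofReal (pE γ)) (ENNReal.ofReal (pE γ)) ρ)
    (hv : MemLpBesov T (ENNReal.ofReal (qE γ)) α (ENNReal.ofReal (qE γ)) v) :
    ∀ᵐ t ∂(volume.restrict (Set.Ioo 0 T)), Slice d γ c (ρ t) (v t) := by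
  have hp : 0 < pE γ := by linarith [pE_gt hγ]
  have hq : 0 < qE γ := by linarith [qE_gt hγ]
  have h1 : ∀ᵐ t ∂(volume.restrict (Set.Ioo 0 T)), ∀ᵐ x ∂(cubeVol d), c ≤ ρ t x :=
    Measure.ae_ae_of_ae_prod hlow
  have mm : Measurable fun t => ∫⁻ x in unitCube d, ‖ρ t x‖ₑ ^ pE γ :=
    Measurable.lintegral_prod_right' (ν := cubeVol d) (f := fun z : ℝ × (Fin d → ℝ) => ‖ρ z.1 z.2‖ₑ ^ pE γ) (hρm.enorm.pow_const _)
  have mm2 : Measurable fun t => ∫⁻ x in unitCube d, ‖v t x‖ₑ ^ qE γ :=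
    Measurable.lintegral_prod_right' (ν := cubeVol d) (f := fun z : ℝ × (Fin d → ℝ) => ‖v z.1 z.2‖ₑ ^ qE γ) (hvm.enorm.pow_const _)
  have h2 := ae_lt_top mm (LpLq_lintegral hp ρ hρ).ne
  have h3 := ae_lt_top mm2 (besov_lintegral hq v hv).ne
  filter_upwards [h1, h2, h3] with t t1 t2 t3
  have mr : Measurable (ρ t) := hρm.comp measurable_prodMk_left
  have mu : Measurable (v t) := hvm.comp measurable_prodMk_left
  refine ⟨hγ, hc, mr, mu, hρp t, hvp t, hρ0 t, t1, ⟨(mr.pow_const _).aestronglyMeasurable, ?_⟩,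
    ⟨(mu.norm.pow_const _).aestronglyMeasurable, ?_⟩⟩
  · refine lt_of_le_of_lt (lintegral_mono fun x => ?_) t2
    rw [Real.enorm_rpow_of_nonneg (hρ0 t x) hp.le]
  · refine lt_of_le_of_lt (lintegral_mono fun x => ?_) t3
    rw [Real.enorm_rpow_of_nonneg (norm_nonneg _) hq.le, enorm_norm]

end part12

section part13

/-- Energy density as a function of density and momentum. -/
def Fen {d : ℕ} (γ : ℝ) (z : Option (Fin d) → ℝ) : ℝ :=
  (1/2) * (∑ j, z (some j) ^ 2 / z none) + kappa γ / (γ - 1) * z none ^ γ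

/-- Its derivative. -/
def Fen' {d : ℕ} (γ : ℝ) (z : Option (Fin d) → ℝ) : (Option (Fin d) → ℝ) →L[ℝ] ℝ :=
  (-(1/2) * (∑ j, (z (some j) / z none) ^ 2) + kappa γ * γ / (γ - 1) * z none ^ (γ - 1)) •
      ContinuousLinearMap.proj (R := ℝ) (φ := fun _ : Option (Fin d) => ℝ) none +
    ∑ j, (z (some j) / z none) • ContinuousLinearMap.proj (R := ℝ) (φ := fun _ : Option (Fin d) => ℝ) (some j)

theorem Fen_hasFDerivAt {d : ℕ} {γ : ℝ} (z : Option (Fin d) → ℝ) (hz : 0 < z none) :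
    HasFDerivAt (Fen γ) (Fen' γ z) z := by
  have h0 : HasFDerivAt (fun z : Option (Fin d) → ℝ => z none)
    (ContinuousLinearMap.proj (R := ℝ) (φ := fun _ : Option (Fin d) => ℝ) none) z := hasFDerivAt_apply none z
  have hj : ∀ j, HasFDerivAt (fun z : Option (Fin d) → ℝ => z (some j))
    (ContinuousLinearMap.proj (R := ℝ) (φ := fun _ : Option (Fin d) => ℝ) (some j)) z := fun j => hasFDerivAt_apply _ z
  have h1 : ∀ j ∈ Finset.univ, HasFDerivAt (fun z : Option (Fin d) → ℝ => z (some j) ^ 2 * (z none)⁻¹)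
     _ z := fun j _ => ((hj j).pow 2).mul ((hasDerivAt_inv hz.ne').comp_hasFDerivAt z h0)
  have h2 := (HasFDerivAt.fun_sum h1).const_mul (1/2 : ℝ)
  have h3 := (h0.rpow_const (p := γ) (Or.inl hz.ne')).const_mul (kappa γ / (γ - 1))
  have h4 := h2.add h3
  unfold Fen
  simp only [div_eq_mul_inv (_ ^ 2)]
  refine h4.congr_fderiv ?_
  ext w
  have hz' := hz.ne'
  simp [Fen']
  rw [add_mul, Finset.mul_sum, Finset.mul_sum, neg_mul, Finset.sum_mul, ← Finset.sum_neg_distrib]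
  rw [add_right_comm, ← Finset.sum_add_distrib]
  congr 1
  · refine Finset.sum_congr rfl fun j _ => ?_
    field_simp
  · ring

theorem Fen'_cont {d : ℕ} {γ : ℝ} {s : Set (Option (Fin d) → ℝ)} (hs : ∀ z ∈ s, 0 < z none) :
    ContinuousOn (Fen' γ) s := by
  intro z hz
  have hz0 := (hs z hz).ne'
  have e0 : ContinuousAt (fun z : Option (Fin d) → ℝ => z none) z := (continuous_apply none).continuousAt
  have ej : ∀ j, ContinuousAt (fun z : Option (Fin d) → ℝ => z (some j) / z none) z := fun j =>
    ((continuous_apply (some j)).continuousAt).div e0 hz0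
  have es : ContinuousAt (fun z : Option (Fin d) → ℝ => ∑ j, (z (some j) / z none) ^ 2) z :=
    tendsto_finsetSum _ fun j _ => (ej j).pow 2
  have es2 : ContinuousAt (fun z : Option (Fin d) → ℝ => ∑ j, (z (some j) / z none) • ContinuousLinearMap.proj (R := ℝ) (φ := fun _ : Option (Fin d) => ℝ) (some j)) z :=
    tendsto_finsetSum _ fun j _ => ((ej j).smul continuousAt_const)
  have ep : ContinuousAt (fun z : Option (Fin d) → ℝ => z none ^ (γ - 1)) z := e0.rpow_const (Or.inl hz0)
  exact ((((continuousAt_const.mul es).add (continuousAt_const.mul ep)).smul continuousAt_const).add es2).continuousWithinAt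

theorem conv_meas {d : ℕ} {K : (Fin d → ℝ) → ℝ} (hc : Continuous K) {h : ℝ → (Fin d → ℝ) → ℝ}
    (hm : Measurable (Function.uncurry h)) :
    Measurable (fun z : ℝ × (Fin d → ℝ) => conv K (h z.1) z.2) := by
  have m : Measurable (fun p : (ℝ × (Fin d → ℝ)) × (Fin d → ℝ) => K (p.2 - p.1.2) * h p.1.1 p.2) :=
    (hc.measurable.comp (measurable_snd.sub (measurable_snd.comp measurable_fst))).mul
      (hm.comp (Measurable.prodMk (measurable_fst.comp measurable_fst) measurable_snd))
  exact (m.stronglyMeasurable.integral_prod_right' (ν := cubeVol d)).measurable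

theorem good_set {d : ℕ} {T γ c : ℝ}
    {ρ : ℝ → (Fin d → ℝ) → ℝ}
    {v : ℝ → (Fin d → ℝ) → Fin d → ℝ}
    (hp : MemLpLq T ∞ 1 fun t x => ρ t x ^ γ) (hk : MemLpLq T ∞ 1 fun t x => ρ t x * euNorm (v t x) ^ 2)
    (hS : ∀ᵐ t ∂(volume.restrict (Set.Ioo 0 T)), Slice d γ c (ρ t) (v t)) :
    ∃ A : ℝ, 0 ≤ A ∧ ∃ S : Set ℝ, MeasurableSet S ∧ (∀ᵐ t ∂(volume.restrict (Set.Ioo 0 T)), t ∈ S) ∧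
      ∀ t ∈ S, Slice d γ c (ρ t) (v t) ∧ ∫ x in unitCube d, |ρ t x| ≤ A ∧
        (∀ j, ∫ x in unitCube d, |ρ t x * v t x j| ≤ A) ∧
        (∀ i j, ∫ x in unitCube d, |ρ t x * v t x i * v t x j| ≤ A) ∧
        ∫ x in unitCube d, |kappa γ * ρ t x ^ γ| ≤ A := by
  have e1 : ∀ᵐ t ∂(volume.restrict (Set.Ioo 0 T)), eLpNorm (fun x => ρ t x ^ γ) 1 (cubeVol d) ≤
      LpLqNorm T ∞ 1 fun t x => ρ t x ^ γ := by
    unfold LpLqNorm timeLpOn; rw [if_pos rfl]; exact ENNReal.ae_le_essSup _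
  have e2 : ∀ᵐ t ∂(volume.restrict (Set.Ioo 0 T)), eLpNorm (fun x => ρ t x * euNorm (v t x) ^ 2) 1 (cubeVol d) ≤
      LpLqNorm T ∞ 1 fun t x => ρ t x * euNorm (v t x) ^ 2 := by
    unfold LpLqNorm timeLpOn; rw [if_pos rfl]; exact ENNReal.ae_le_essSup _
  set A1 := LpLqNorm T ∞ 1 fun t x => ρ t x ^ γ with hA1
  set A2 := LpLqNorm T ∞ 1 fun t x => ρ t x * euNorm (v t x) ^ 2 with hA2
  have ht1 : A1 ≠ ∞ := ne_of_lt hp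
  have ht2 : A2 ≠ ∞ := ne_of_lt hk
  have hκ0 : 0 ≤ |kappa γ| := abs_nonneg _
  have key : ∀ᵐ t ∂(volume.restrict (Set.Ioo 0 T)), Slice d γ c (ρ t) (v t) ∧
        eLpNorm (fun x => ρ t x ^ γ) 1 (cubeVol d) ≤ A1 ∧ eLpNorm (fun x => ρ t x * euNorm (v t x) ^ 2) 1 (cubeVol d) ≤ A2 := by
    filter_upwards [hS, e1, e2] with t a b c using ⟨a, b, c⟩
  refine ⟨(1 + |kappa γ|) * (1 + A1.toReal + A2.toReal), by positivity, (toMeasurable (volume.restrict (Set.Ioo 0 T)) {t | ¬ (Slice d γ c (ρ t) (v t) ∧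
        eLpNorm (fun x => ρ t x ^ γ) 1 (cubeVol d) ≤ A1 ∧ eLpNorm (fun x => ρ t x * euNorm (v t x) ^ 2) 1 (cubeVol d) ≤ A2)})ᶜ, (measurableSet_toMeasurable _ _).compl, ?_, ?_⟩
  · rw [ae_iff]
    simp only [Set.mem_compl_iff, not_not, Set.ofPred_mem_eq]
    rw [measure_toMeasurable]
    exact key
  intro t ht
  obtain ⟨S, b1, b2⟩ : Slice d γ c (ρ t) (v t) ∧
        eLpNorm (fun x => ρ t x ^ γ) 1 (cubeVol d) ≤ A1 ∧ eLpNorm (fun x => ρ t x * euNorm (v t x) ^ 2) 1 (cubeVol d) ≤ A2 := by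
    by_contra hcon
    exact ht (subset_toMeasurable _ _ hcon)
  have hκ := kappa_pos S.hγ
  have eun : ∀ x, euNorm (v t x) ^ 2 = ∑ i, v t x i ^ 2 := fun x => by
    unfold euNorm; rw [Real.sq_sqrt (Finset.sum_nonneg fun i _ => sq_nonneg _)]
  have i1 : Integrable (fun x => ρ t x ^ γ) (cubeVol d) := by
    have := S.iQ.const_mul (kappa γ)⁻¹
    refine this.congr (ae_of_all _ fun x => ?_)
    field_simp
  have i2 : Integrable (fun x => ρ t x * euNorm (v t x) ^ 2) (cubeVol d) := by
    simp only [eun, Finset.mul_sum]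
    refine integrable_finsetSum _ fun i _ => ?_
    refine (S.iF i i).congr (ae_of_all _ fun x => ?_)
    simp only []; ring
  have I1 : ∫ x in unitCube d, ρ t x ^ γ ≤ A1.toReal := by
    have : ∫ x, ‖ρ t x ^ γ‖ ∂(cubeVol d) ≤ A1.toReal := by
      rw [integral_norm_eq_lintegral_enorm i1.1, ← eLpNorm_one_eq_lintegral_enorm]
      exact ENNReal.toReal_mono ht1 b1
    exact (integral_mono i1 i1.norm fun x => le_abs_self _).trans this
  have I2 : ∫ x in unitCube d, ρ t x * euNorm (v t x) ^ 2 ≤ A2.toReal := by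
    have : ∫ x, ‖ρ t x * euNorm (v t x) ^ 2‖ ∂(cubeVol d) ≤ A2.toReal := by
      rw [integral_norm_eq_lintegral_enorm i2.1, ← eLpNorm_one_eq_lintegral_enorm]
      exact ENNReal.toReal_mono ht2 b2
    exact (integral_mono i2 i2.norm fun x => le_abs_self _).trans this
  have W : ∀ f : (Fin d → ℝ) → ℝ, Integrable f (cubeVol d) → (∀ x, |f x| ≤ (1 + |kappa γ|) * (1 + ρ t x ^ γ + ρ t x * euNorm (v t x) ^ 2)) →
      ∫ x in unitCube d, |f x| ≤ (1 + |kappa γ|) * (1 + A1.toReal + A2.toReal) := by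
    intro f hf hb
    refine (integral_mono (μ := cubeVol d) hf.abs ((((integrable_const (1:ℝ)).add i1).add i2).const_mul _) hb).trans ?_
    simp only [Pi.add_apply]
    rw [integral_const_mul, integral_add (f := fun x => 1 + ρ t x ^ γ) (((integrable_const (1:ℝ)).add i1)) i2, integral_add (integrable_const (1:ℝ)) i1]
    simp only [integral_const, probReal_univ, smul_eq_mul, mul_one]
    unfold cubeVol
    gcongr
  have hp0 : ∀ x, 0 ≤ ρ t x ^ γ := fun x => Real.rpow_nonneg (S.r0 x) _
  have hk0 : ∀ x, 0 ≤ ρ t x * euNorm (v t x) ^ 2 := fun x => mul_nonneg (S.r0 x) (sq_nonneg _)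
  have hr1 : ∀ x, ρ t x ≤ 1 + ρ t x ^ γ := fun x => by
    rcases le_total (ρ t x) 1 with h | h
    · linarith [hp0 x]
    · linarith [Real.self_le_rpow_of_one_le h S.hγ.le]
  have hvj : ∀ x j, |v t x j| ^ 2 ≤ euNorm (v t x) ^ 2 := fun x j => by
    rw [eun, sq_abs]; exact Finset.single_le_sum (f := fun i => v t x i ^ 2) (fun i _ => sq_nonneg _) (Finset.mem_univ j)
  have up : ∀ a b : ℝ, 0 ≤ b → a ≤ b → a ≤ (1 + |kappa γ|) * b := fun a b hb h => by nlinarith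
  refine ⟨S, W _ S.i1 ?_, fun j => W _ (S.iM j) ?_, fun i j => W _ (S.iF i j) ?_, W _ S.iQ ?_⟩
  · intro x
    refine up _ _ (by linarith [hp0 x, hk0 x]) ?_
    rw [abs_of_nonneg (S.r0 x)]; linarith [hr1 x, hk0 x]
  · intro x
    refine up _ _ (by linarith [hp0 x, hk0 x]) ?_
    rw [abs_mul, abs_of_nonneg (S.r0 x)]
    have : |v t x j| ≤ 1 + euNorm (v t x) ^ 2 := by nlinarith [hvj x j, abs_nonneg (v t x j)]
    nlinarith [mul_le_mul_of_nonneg_left this (S.r0 x), hr1 x]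
  · intro x
    refine up _ _ (by linarith [hp0 x, hk0 x]) ?_
    rw [abs_mul, abs_mul, abs_of_nonneg (S.r0 x), mul_assoc]
    have : |v t x i| * |v t x j| ≤ euNorm (v t x) ^ 2 := by nlinarith [hvj x j, hvj x i, sq_nonneg (|v t x i| - |v t x j|)]
    nlinarith [mul_le_mul_of_nonneg_left this (S.r0 x), hp0 x]
  · intro x
    rw [abs_mul, abs_of_nonneg (hp0 x)]
    have := hp0 x; have := hk0 x
    nlinarith [mul_nonneg hκ0 (hk0 x)]

/-- Passing from the distributional identity to a one-dimensional weak derivative. -/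
theorem weak_of_inner {T B : ℝ} {r g F : ℝ → ℝ} (hr : Measurable r) (hg : Measurable g)
    (hrB : ∀ t, |r t| ≤ B) (hgB : ∀ t, |g t| ≤ B) {ψ : ℝ → ℝ} (hψ : IsTest1 T ψ)
    (hF : ∀ᵐ t ∂(volume.restrict (Set.Ioo 0 T)), F t = deriv ψ t * r t + ψ t * g t)
    (h0 : ∫ t in Set.Ioo 0 T, F t = 0) : ∫ t, deriv ψ t * r t = - ∫ t, ψ t * g t := by
  obtain ⟨hs, a, b, ha, hb, hsupp⟩ := hψ
  have hcs : HasCompactSupport ψ := HasCompactSupport.intro isCompact_Icc hsupp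
  have hcd : Continuous (deriv ψ) := hs.continuous_deriv (by simp)
  have z1 : ∀ t, t ∉ Set.Ioo 0 T → ψ t = 0 := fun t ht => hsupp t fun h => ht ⟨by linarith [h.1], by linarith [h.2]⟩
  have z2 : ∀ t, t ∉ Set.Ioo 0 T → deriv ψ t = 0 := fun t ht => by
    by_contra hne
    have : t ∈ tsupport ψ := support_deriv_subset hne
    have h2 : tsupport ψ ⊆ Set.Icc a b := closure_minimal (fun s hs => by
      by_contra h; exact hs (hsupp s h)) isClosed_Icc
    have h := h2 this
    exact ht ⟨by linarith [h.1], by linarith [h.2]⟩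
  have J1 : Integrable (fun t => deriv ψ t * r t) :=
    ((hcd.integrable_of_hasCompactSupport hcs.deriv).mul_bdd (c := B) hr.aestronglyMeasurable (ae_of_all _ hrB))
  have J2 : Integrable (fun t => ψ t * g t) :=
    ((hs.continuous.integrable_of_hasCompactSupport hcs).mul_bdd (c := B) hg.aestronglyMeasurable (ae_of_all _ hgB))
  rw [integral_congr_ae hF, integral_add J1.integrableOn J2.integrableOn,
    setIntegral_eq_integral_of_forall_compl_eq_zero (fun t ht => by rw [z2 t ht, zero_mul]),
    setIntegral_eq_integral_of_forall_compl_eq_zero (fun t ht => by rw [z1 t ht, zero_mul])] at h0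
  linarith

end part13

section part14

/-- Mollified conserved quantities. -/
def cq {d : ℕ} (K : (Fin d → ℝ) → ℝ) (r : (Fin d → ℝ) → ℝ) (u : (Fin d → ℝ) → Fin d → ℝ) (x : Fin d → ℝ) :
    Option (Fin d) → ℝ
  | none => conv K r x
  | some j => conv K (fun y => r y * u y j) x

/-- Their time derivatives. -/
def cg {d : ℕ} (K : (Fin d → ℝ) → ℝ) (γ : ℝ) (r : (Fin d → ℝ) → ℝ) (u : (Fin d → ℝ) → Fin d → ℝ) (x : Fin d → ℝ) :
    Option (Fin d) → ℝ
  | none => - ∑ i, conv (fun w => - dKer K i w) (fun y => r y * u y i) x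
  | some j => - ((∑ i, conv (fun w => - dKer K i w) (fun y => r y * u y i * u y j) x) +
      conv (fun w => - dKer K j w) (fun y => kappa γ * r y ^ γ) x)

theorem eDens_eq {d : ℕ} (K : (Fin d → ℝ) → ℝ) (γ : ℝ) (r : (Fin d → ℝ) → ℝ) (u : (Fin d → ℝ) → Fin d → ℝ) (x : Fin d → ℝ) :
    eDens K γ r u x = Fen γ (cq K r u x) := rfl

theorem flux_eq {d : ℕ} (K : (Fin d → ℝ) → ℝ) (γ : ℝ) (r : (Fin d → ℝ) → ℝ) (u : (Fin d → ℝ) → Fin d → ℝ) (x : Fin d → ℝ) :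
    flux K γ r u x = - Fen' γ (cq K r u x) (cg K γ r u x) := by
  simp only [flux, Fen', cq, cg, _root_.add_apply, _root_.smul_apply, _root_.sum_apply,
    ContinuousLinearMap.proj_apply, smul_eq_mul, mul_neg, Finset.sum_neg_distrib]
  ring

theorem cq_meas {d : ℕ} {L : ℝ} {K : (Fin d → ℝ) → ℝ} (hK : IsKer d L K)
    {ρ : ℝ → (Fin d → ℝ) → ℝ} (hρm : Measurable (Function.uncurry ρ))
    {v : ℝ → (Fin d → ℝ) → Fin d → ℝ} (hvm : Measurable (Function.uncurry v)) (k : Option (Fin d)) :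
    Measurable (fun z : ℝ × (Fin d → ℝ) => cq K (ρ z.1) (v z.1) z.2 k) := by
  cases k with
  | none => exact conv_meas hK.continuous hρm
  | some j =>
    exact conv_meas hK.continuous (h := fun t y => ρ t y * v t y j) (hρm.mul ((measurable_pi_apply j).comp hvm))

theorem cg_meas {d : ℕ} {L γ : ℝ} {K : (Fin d → ℝ) → ℝ} (hK : IsKer d L K)
    {ρ : ℝ → (Fin d → ℝ) → ℝ} (hρm : Measurable (Function.uncurry ρ))
    {v : ℝ → (Fin d → ℝ) → Fin d → ℝ} (hvm : Measurable (Function.uncurry v)) (k : Option (Fin d)) :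
    Measurable (fun z : ℝ × (Fin d → ℝ) => cg K γ (ρ z.1) (v z.1) z.2 k) := by
  have hv : ∀ j, Measurable (Function.uncurry fun t y => v t y j) := fun j => (measurable_pi_apply j).comp hvm
  have hd : ∀ i, Continuous (fun w => - dKer K i w) := fun i => (hK.d_continuous i).neg
  cases k with
  | none =>
    exact (Finset.measurable_sum _ fun i _ => conv_meas (hd i) (h := fun t y => ρ t y * v t y i) (hρm.mul (hv i))).neg
  | some j =>
    exact ((Finset.measurable_sum _ fun i _ => conv_meas (hd i) (h := fun t y => ρ t y * v t y i * v t y j) ((hρm.mul (hv i)).mul (hv j))).add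
      (conv_meas (hd j) (h := fun t y => kappa γ * ρ t y ^ γ) (measurable_const.mul (hρm.pow_const _)))).neg

theorem eDens_meas {d : ℕ} {L γ : ℝ} {K : (Fin d → ℝ) → ℝ} (hK : IsKer d L K)
    {ρ : ℝ → (Fin d → ℝ) → ℝ} (hρm : Measurable (Function.uncurry ρ))
    {v : ℝ → (Fin d → ℝ) → Fin d → ℝ} (hvm : Measurable (Function.uncurry v)) :
    Measurable (fun z : ℝ × (Fin d → ℝ) => eDens K γ (ρ z.1) (v z.1) z.2) := by
  have h := cq_meas hK hρm hvm
  exact (measurable_const.mul (Finset.measurable_sum _ fun j _ => ((h (some j)).pow_const 2).div (h none))).add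
    (measurable_const.mul ((h none).pow_const γ))

theorem flux_meas {d : ℕ} {L γ : ℝ} {K : (Fin d → ℝ) → ℝ} (hK : IsKer d L K)
    {ρ : ℝ → (Fin d → ℝ) → ℝ} (hρm : Measurable (Function.uncurry ρ))
    {v : ℝ → (Fin d → ℝ) → Fin d → ℝ} (hvm : Measurable (Function.uncurry v)) :
    Measurable (fun z : ℝ × (Fin d → ℝ) => flux K γ (ρ z.1) (v z.1) z.2) := by
  have h := cq_meas hK hρm hvm
  have g := cg_meas (γ := γ) hK hρm hvm
  simp only [flux_eq, Fen', _root_.add_apply, _root_.smul_apply, _root_.sum_apply,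
    ContinuousLinearMap.proj_apply, smul_eq_mul]
  exact (((measurable_const.mul (Finset.measurable_sum _ fun j _ => ((h (some j)).div (h none)).pow_const 2)).add
    (measurable_const.mul ((h none).pow_const _))).mul (g none)).add
    (Finset.measurable_sum _ fun j _ => ((h (some j)).div (h none)).mul (g (some j))) |>.neg

/-- The bounds on a slice. -/
def SB (d : ℕ) (γ c A : ℝ) (r : (Fin d → ℝ) → ℝ) (u : (Fin d → ℝ) → Fin d → ℝ) : Prop :=
  Slice d γ c r u ∧ ∫ x in unitCube d, |r x| ≤ A ∧
        (∀ j, ∫ x in unitCube d, |r x * u x j| ≤ A) ∧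
        (∀ i j, ∫ x in unitCube d, |r x * u x i * u x j| ≤ A) ∧
        ∫ x in unitCube d, |kappa γ * r x ^ γ| ≤ A

theorem ker_bounded {d : ℕ} {L : ℝ} {K : (Fin d → ℝ) → ℝ} (hK : IsKer d L K) :
    ∃ B, 0 ≤ B ∧ (∀ x, |K x| ≤ B) ∧ ∀ i x, |- dKer K i x| ≤ B := by
  obtain ⟨B, hB0, hB⟩ := periodic_bounded hK.periodic hK.continuous
  choose B' h0 hB' using fun i => periodic_bounded (dK_per hK i) (hK.d_continuous i).neg
  refine ⟨B + ∑ i, B' i, add_nonneg hB0 (Finset.sum_nonneg fun i _ => h0 i), fun x => ?_, fun i x => ?_⟩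
  · exact (hB x).trans (le_add_of_nonneg_right (Finset.sum_nonneg fun i _ => h0 i))
  · exact (hB' i x).trans ((Finset.single_le_sum (f := B') (fun i _ => h0 i) (Finset.mem_univ i)).trans (le_add_of_nonneg_left hB0))

/-- lower corner -/
def loB (d : ℕ) (c D : ℝ) : Option (Fin d) → ℝ
  | none => c
  | some _ => -D

/-- upper corner -/
def hiB (d : ℕ) (c D : ℝ) : Option (Fin d) → ℝ
  | none => max c D
  | some _ => D

theorem SB.bounds {d : ℕ} {γ c A L B : ℝ} {K : (Fin d → ℝ) → ℝ} (hK : IsKer d L K) (hB0 : 0 ≤ B)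
    (hB : ∀ x, |K x| ≤ B) (hB' : ∀ i x, |- dKer K i x| ≤ B)
    {r : (Fin d → ℝ) → ℝ} {u : (Fin d → ℝ) → Fin d → ℝ} (S : SB d γ c A r u) (x : Fin d → ℝ) :
    (∀ k, cq K r u x k ∈ Set.Icc (loB d c (B * A) k) (hiB d c (B * A) k)) ∧
    ∀ k, |cg K γ r u x k| ≤ d * (B * A) + B * A := by
  obtain ⟨S, a1, a2, a3, a4⟩ := S
  have hA : 0 ≤ A := le_trans (integral_nonneg fun x => abs_nonneg _) a1
  constructor
  · intro k
    cases k with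
    | none =>
      have := (conv_abs_le hB S.i1 x).trans (mul_le_mul_of_nonneg_left a1 hB0)
      exact ⟨S.P_lower hK x, ((le_abs_self _).trans this).trans (le_max_right _ _)⟩
    | some j =>
      have := (conv_abs_le hB (S.iM j) x).trans (mul_le_mul_of_nonneg_left (a2 j) hB0)
      exact abs_le.1 this
  · intro k
    cases k with
    | none =>
      simp only [cg, abs_neg]
      refine (Finset.abs_sum_le_sum_abs _ _).trans ?_
      refine (Finset.sum_le_sum (g := fun _ => B * A) fun i _ => ?_).trans ?_
      · exact (conv_abs_le (hB' i) (S.iM i) x).trans (mul_le_mul_of_nonneg_left (a2 i) hB0)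
      · simp; positivity
    | some j =>
      simp only [cg, abs_neg]
      refine (abs_add_le _ _).trans (add_le_add ?_ ?_)
      · refine (Finset.abs_sum_le_sum_abs _ _).trans ?_
        refine (Finset.sum_le_sum (g := fun _ => B * A) fun i _ => ?_).trans ?_
        · exact (conv_abs_le (hB' i) (S.iF i j) x).trans (mul_le_mul_of_nonneg_left (a3 i j) hB0)
        · simp
      · exact (conv_abs_le (hB' j) S.iQ x).trans (mul_le_mul_of_nonneg_left a4 hB0)

theorem box_pos {d : ℕ} {c D : ℝ} (hc : 0 < c) : ∀ z ∈ Set.Icc (loB d c D) (hiB d c D), 0 < z none :=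
  fun z hz => lt_of_lt_of_le hc (hz.1 none)

theorem SB.unif {d : ℕ} {γ c A L : ℝ} {K : (Fin d → ℝ) → ℝ} (hK : IsKer d L K) (hc : 0 < c) :
    ∃ C, 0 ≤ C ∧ ∀ (r : (Fin d → ℝ) → ℝ) (u : (Fin d → ℝ) → Fin d → ℝ), SB d γ c A r u → ∀ x,
      |eDens K γ r u x| ≤ C ∧ |flux K γ r u x| ≤ C := by
  obtain ⟨B, hB0, hB, hB'⟩ := ker_bounded hK
  have hcpt : IsCompact (Set.Icc (loB d c (B * A)) (hiB d c (B * A))) := isCompact_Icc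
  have cF : ContinuousOn (Fen γ) (Set.Icc (loB d c (B * A)) (hiB d c (B * A))) := fun z hz =>
    (Fen_hasFDerivAt z (box_pos hc z hz)).continuousAt.continuousWithinAt
  obtain ⟨C1, h1⟩ := hcpt.exists_bound_of_continuousOn cF
  obtain ⟨C2, h2⟩ := hcpt.exists_bound_of_continuousOn (Fen'_cont (γ := γ) (box_pos (d := d) (D := B * A) hc))
  refine ⟨max |C1| (|C2| * |d * (B * A) + B * A|), by positivity, fun r u S x => ?_⟩
  obtain ⟨b1, b2⟩ := S.bounds hK hB0 hB hB' x
  have hm : cq K r u x ∈ Set.Icc (loB d c (B * A)) (hiB d c (B * A)) := ⟨fun k => (b1 k).1, fun k => (b1 k).2⟩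
  constructor
  · rw [eDens_eq]
    exact ((h1 _ hm).trans (le_abs_self _)).trans (le_max_left _ _)
  · rw [flux_eq, abs_neg]
    refine le_trans ((Fen' γ (cq K r u x)).le_opNorm (cg K γ r u x)) (le_trans ?_ (le_max_right _ _))
    have : ‖cg K γ r u x‖ ≤ |d * (B * A) + B * A| :=
      (pi_norm_le_iff_of_nonneg (abs_nonneg _)).2 fun k => (b2 k).trans (le_abs_self _)
    exact mul_le_mul ((h2 _ hm).trans (le_abs_self _)) this (norm_nonneg _) (abs_nonneg _)

/-- The product test function. -/
theorem test_prod {d : ℕ} {T L : ℝ} {K : (Fin d → ℝ) → ℝ} (hK : IsKer d L K) {ψ : ℝ → ℝ} (hψ : IsTest1 T ψ) (x : Fin d → ℝ) :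
    IsTestFunctionIC T (fun t y => ψ t * K (y - x)) ∧ (∀ y, ψ 0 * K (y - x) = 0) ∧
    (∀ t y, pderivT (fun t y => ψ t * K (y - x)) t y = deriv ψ t * K (y - x)) ∧
    (∀ i t y, pderivX i (fun t y => ψ t * K (y - x)) t y = ψ t * dKer K i (y - x)) := by
  obtain ⟨hs, a, b, ha, hb, hsupp⟩ := hψ
  refine ⟨⟨?_, ?_, (b + T) / 2, by linarith, ?_⟩, ?_, ?_, ?_⟩
  · have h1 : ContDiff ℝ (⊤ : ℕ∞) fun p : ℝ × (Fin d → ℝ) => ψ p.1 := hs.comp contDiff_fst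
    have h2 : ContDiff ℝ (⊤ : ℕ∞) fun p : ℝ × (Fin d → ℝ) => K (p.2 - x) := hK.smooth.comp (contDiff_snd.sub contDiff_const)
    exact h1.mul h2
  · intro t y n
    simp only []
    rw [add_sub_right_comm, hK.periodic]
  · intro t y ht
    rw [hsupp t (fun h => by linarith [h.2]), zero_mul]
  · intro y
    rw [hsupp 0 (fun h => by linarith [h.1]), zero_mul]
  · intro t y
    unfold pderivT
    exact deriv_mul_const ((hs.differentiable (by simp)) t) _
  · intro i t y
    unfold pderivX dKer
    have h2 : DifferentiableAt ℝ (fun y => K (y - x)) y := by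
      have := hK.smooth.differentiable (by simp)
      fun_prop
    rw [fderiv_const_mul h2, fderiv_comp_sub]
    simp

theorem inner_mass {d : ℕ} {γ c L : ℝ} {K : (Fin d → ℝ) → ℝ} (hK : IsKer d L K)
    {r : (Fin d → ℝ) → ℝ} {u : (Fin d → ℝ) → Fin d → ℝ} (S : Slice d γ c r u) (x : Fin d → ℝ) (a b : ℝ) :
    ∫ y in unitCube d, (r y * (a * K (y - x)) + r y * ∑ i, u y i * (b * dKer K i (y - x))) =
      a * cq K r u x none + b * cg K γ r u x none := by
  have J1 := conv_integrand_integrable hK.periodic hK.continuous S.i1 x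
  have J2 := fun i => conv_integrand_integrable (dK_per hK i) (hK.d_continuous i).neg (S.iM i) x
  have e : ∀ y, (r y * (a * K (y - x)) + r y * ∑ i, u y i * (b * dKer K i (y - x))) =
      a * (K (y - x) * r y) + b * (- ∑ i, - dKer K i (y - x) * (r y * u y i)) := fun y => by
    rw [← Finset.sum_neg_distrib, Finset.mul_sum, Finset.mul_sum]
    congr 1
    · ring
    · exact Finset.sum_congr rfl fun i _ => by ring
  simp only [e]
  have J3 := (integrable_finsetSum Finset.univ fun i _ => J2 i)
  have E := integral_add (μ := cubeVol d) (J1.const_mul a) (J3.neg.const_mul b)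
  refine E.trans ?_
  rw [integral_const_mul, integral_const_mul]
  simp only [Pi.neg_apply]
  rw [integral_neg, integral_finsetSum _ fun i _ => J2 i]
  rfl

theorem inner_mom {d : ℕ} {γ c L : ℝ} {K : (Fin d → ℝ) → ℝ} (hK : IsKer d L K)
    {r : (Fin d → ℝ) → ℝ} {u : (Fin d → ℝ) → Fin d → ℝ} (S : Slice d γ c r u) (x : Fin d → ℝ) (a b : ℝ) (j : Fin d) :
    ∫ y in unitCube d, (r y * u y j * (a * K (y - x)) + (∑ i, r y * u y i * u y j * (b * dKer K i (y - x))) +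
        kappa γ * r y ^ γ * (b * dKer K j (y - x))) =
      a * cq K r u x (some j) + b * cg K γ r u x (some j) := by
  have J1 := conv_integrand_integrable hK.periodic hK.continuous (S.iM j) x
  have J2 := fun i => conv_integrand_integrable (dK_per hK i) (hK.d_continuous i).neg (S.iF i j) x
  have J4 := conv_integrand_integrable (dK_per hK j) (hK.d_continuous j).neg S.iQ x
  have e : ∀ y, (r y * u y j * (a * K (y - x)) + (∑ i, r y * u y i * u y j * (b * dKer K i (y - x))) +
        kappa γ * r y ^ γ * (b * dKer K j (y - x))) =
      a * (K (y - x) * (r y * u y j)) + b * (- ((∑ i, - dKer K i (y - x) * (r y * u y i * u y j)) + - dKer K j (y - x) * (kappa γ * r y ^ γ))) := fun y => by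
    rw [neg_add, ← Finset.sum_neg_distrib, mul_add, Finset.mul_sum, add_assoc]
    congr 1
    · ring
    · congr 1
      · exact Finset.sum_congr rfl fun i _ => by ring
      · ring
  simp only [e]
  have J3 := (integrable_finsetSum Finset.univ fun i _ => J2 i)
  have E := integral_add (μ := cubeVol d) (J1.const_mul a) ((J3.add J4).neg.const_mul b)
  refine E.trans ?_
  rw [integral_const_mul, integral_const_mul]
  simp only [Pi.neg_apply, Pi.add_apply]
  rw [integral_neg, integral_add J3 J4, integral_finsetSum _ fun i _ => J2 i]
  rfl

end part14

section part15

set_option maxHeartbeats 1600000 in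
theorem chain_x {d : ℕ} {T γ c L A : ℝ} {K : (Fin d → ℝ) → ℝ} (hK : IsKer d L K) (hc : 0 < c)
    {ρ : ℝ → (Fin d → ℝ) → ℝ} {v : ℝ → (Fin d → ℝ) → Fin d → ℝ} {ρ₀ : (Fin d → ℝ) → ℝ}
    {v₀ : (Fin d → ℝ) → Fin d → ℝ} (hsol : IsWeakSolution d T γ ρ v ρ₀ v₀)
    {S : Set ℝ} (hSm : MeasurableSet S) (hSae : ∀ᵐ t ∂(volume.restrict (Set.Ioo 0 T)), t ∈ S)
    (hS : ∀ t ∈ S, SB d γ c A (ρ t) (v t)) {φ : ℝ → ℝ} (hφ : IsTest1 T φ) (x : Fin d → ℝ) :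
    ∫ t in Set.Ioo 0 T, deriv φ t * eDens K γ (ρ t) (v t) x =
      ∫ t in Set.Ioo 0 T, φ t * flux K γ (ρ t) (v t) x := by
  classical
  obtain ⟨B, hB0, hB, hB'⟩ := ker_bounded hK
  set D := B * |A| with hD
  have hD0 : 0 ≤ D := by positivity
  have hSA : ∀ t ∈ S, SB d γ c |A| (ρ t) (v t) := fun t ht => by
    obtain ⟨a, b1, b2, b3, b4⟩ := hS t ht
    exact ⟨a, b1.trans (le_abs_self _), fun j => (b2 j).trans (le_abs_self _), fun i j => (b3 i j).trans (le_abs_self _), b4.trans (le_abs_self _)⟩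
  have hbd := fun t (ht : t ∈ S) => (hSA t ht).bounds hK hB0 hB hB' x
  set r : Option (Fin d) → ℝ → ℝ := fun k t => if t ∈ S then cq K (ρ t) (v t) x k else hiB d c D k with hr
  set g : Option (Fin d) → ℝ → ℝ := fun k t => if t ∈ S then cg K γ (ρ t) (v t) x k else 0 with hg
  have mr : ∀ k, Measurable (r k) := fun k =>
    Measurable.ite hSm ((cq_meas hK hsol.rho_meas hsol.v_meas k).comp measurable_prodMk_right) measurable_const
  have mg : ∀ k, Measurable (g k) := fun k =>
    Measurable.ite hSm ((cg_meas hK hsol.rho_meas hsol.v_meas k).comp measurable_prodMk_right) measurable_const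
  have hlohi : ∀ k, loB d c D k ≤ hiB d c D k := fun k => by
    cases k with
    | none => exact le_max_left _ _
    | some j => simp only [loB, hiB]; linarith
  have hbox : ∀ k t, r k t ∈ Set.Icc (loB d c D k) (hiB d c D k) := fun k t => by
    by_cases ht : t ∈ S
    · simp only [hr, if_pos ht]; exact (hbd t ht).1 k
    · simp only [hr, if_neg ht]; exact ⟨hlohi k, le_rfl⟩
  have hgB : ∀ k t, |g k t| ≤ d * D + D := fun k t => by
    by_cases ht : t ∈ S
    · simp only [hg, if_pos ht]; exact (hbd t ht).2 k
    · simp only [hg, if_neg ht, abs_zero]; positivity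
  have hrB : ∀ k t, |r k t| ≤ max |loB d c D k| |hiB d c D k| := fun k t =>
    abs_le_max_abs_abs (hbox k t).1 (hbox k t).2
  have hw : ∀ k ψ, IsTest1 T ψ → ∫ t, deriv ψ t * r k t = - ∫ t, ψ t * g k t := by
    intro k ψ hψ
    obtain ⟨q1, q2, q3, q4⟩ := test_prod hK hψ x
    have W := fun F hF h0 => weak_of_inner (F := F) (mr k) (mg k) (fun t => (hrB k t).trans (le_max_left _ (d * D + D)))
        (fun t => (hgB k t).trans (le_max_right _ _)) hψ hF h0
    cases k with
    | none =>
      have hmass := hsol.mass _ q1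
      simp only [q2, q3, q4, mul_zero, integral_zero, add_zero] at hmass
      refine W _ ?_ hmass
      filter_upwards [hSae] with t ht
      simp only [hr, hg, if_pos ht]
      exact inner_mass hK (hS t ht).1 x _ _
    | some j =>
      set Φ : ℝ → (Fin d → ℝ) → Fin d → ℝ := fun s y j' => if j' = j then ψ s * K (y - x) else 0 with hΦ
      have hsame : (fun s y => Φ s y j) = fun s y => ψ s * K (y - x) := by
        funext s y; simp [hΦ]
      have hdiff : ∀ j', j' ≠ j → (fun s y => Φ s y j') = fun s y => 0 := fun j' hj => by
        funext s y; simp [hΦ, hj]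
      have htest : ∀ j', IsTestFunctionIC T fun s y => Φ s y j' := by
        intro j'
        by_cases hj : j' = j
        · rw [hj, hsame]; exact q1
        · rw [hdiff j' hj]
          obtain ⟨b, hb, hb2⟩ := q1.supp
          exact ⟨contDiff_const, fun t y n => rfl, b, hb, fun _ _ _ => rfl⟩
      have hmom := hsol.momentum Φ htest
      have z1 : ∀ j' t y, pderivT (fun s y => Φ s y j') t y = if j' = j then deriv ψ t * K (y - x) else 0 := by
        intro j' t y
        by_cases hj : j' = j
        · rw [if_pos hj, hj, hsame, q3]
        · rw [if_neg hj, hdiff j' hj]; simp [pderivT]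
      have z2 : ∀ i j' t y, pderivX i (fun s y => Φ s y j') t y = if j' = j then ψ t * dKer K i (y - x) else 0 := by
        intro i j' t y
        by_cases hj : j' = j
        · rw [if_pos hj, hj, hsame, q4]
        · rw [if_neg hj, hdiff j' hj]; simp [pderivX]
      have z3 : ∀ y j', Φ 0 y j' = 0 := fun y j' => by simp [hΦ, q2]
      simp only [z1, z2, z3, mul_zero, Finset.sum_const_zero, integral_zero, add_zero, mul_ite, Finset.sum_ite_eq', Finset.mem_univ, if_true] at hmom
      refine W _ ?_ hmom
      filter_upwards [hSae] with t ht
      simp only [hr, hg, if_pos ht]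
      exact inner_mom hK (hS t ht).1 x _ _ j
  have main := weak_chain_rule mr mg hbox hgB hw (Fen γ) (Fen' γ)
    (fun z hz => Fen_hasFDerivAt z (box_pos hc z hz)) (Fen'_cont (box_pos hc)) hφ
  obtain ⟨hs, a, b, ha, hb, hsupp⟩ := hφ
  have z1 : ∀ t, t ∉ Set.Ioo 0 T → φ t = 0 := fun t ht => hsupp t fun h => ht ⟨by linarith [h.1], by linarith [h.2]⟩
  have z2 : ∀ t, t ∉ Set.Ioo 0 T → deriv φ t = 0 := fun t ht => by
    by_contra hne
    have : t ∈ tsupport φ := support_deriv_subset hne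
    have h2 : tsupport φ ⊆ Set.Icc a b := closure_minimal (fun s hs => by
      by_contra h; exact hs (hsupp s h)) isClosed_Icc
    have h := h2 this
    exact ht ⟨by linarith [h.1], by linarith [h.2]⟩
  rw [← setIntegral_eq_integral_of_forall_compl_eq_zero (s := Set.Ioo 0 T) (fun t ht => by rw [z2 t ht, zero_mul]),
    ← setIntegral_eq_integral_of_forall_compl_eq_zero (s := Set.Ioo 0 T) (f := fun t => φ t * _) (fun t ht => by rw [z1 t ht, zero_mul]), ← integral_neg] at main
  refine Eq.trans (integral_congr_ae ?_) (main.trans (integral_congr_ae ?_))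
  · filter_upwards [hSae] with t ht
    have : (fun k => r k t) = cq K (ρ t) (v t) x := by funext k; simp only [hr, if_pos ht]
    rw [this, eDens_eq]
  · filter_upwards [hSae] with t ht
    have e1 : (fun k => r k t) = cq K (ρ t) (v t) x := by funext k; simp only [hr, if_pos ht]
    have e2 : (fun k => g k t) = cg K γ (ρ t) (v t) x := by funext k; simp only [hg, if_pos ht]
    rw [e1, e2, flux_eq]; ring

end part15

section part16

theorem bdd_integrable {d : ℕ} {T C M : ℝ} {S : Set ℝ} (hSae : ∀ᵐ t ∂(volume.restrict (Set.Ioo 0 T)), t ∈ S)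
    {e : ℝ → (Fin d → ℝ) → ℝ} (he : Measurable (fun z : ℝ × (Fin d → ℝ) => e z.1 z.2))
    (hb : ∀ t ∈ S, ∀ x, |e t x| ≤ C) {χ : ℝ → ℝ} (hχ : Continuous χ) (hM : ∀ t, |χ t| ≤ M) :
    Integrable (fun z : ℝ × (Fin d → ℝ) => χ z.1 * e z.1 z.2) (spaceTime d T) := by
  have := spaceTime_finite d T
  have h : ∀ᵐ z ∂(spaceTime d T), z.1 ∈ S := Measure.quasiMeasurePreserving_fst.ae hSae
  refine Integrable.of_bound ((hχ.measurable.comp measurable_fst).mul he).aestronglyMeasurable (M * C) ?_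
  filter_upwards [h] with z hz
  rw [Real.norm_eq_abs, abs_mul]
  exact mul_le_mul (hM _) (hb _ hz _) (abs_nonneg _) ((abs_nonneg _).trans (hM 0))

theorem ofReal_abs_integral_ae {X : Type*} [MeasurableSpace X] {μ : Measure X} {f : X → ℝ} {U : X → ℝ≥0∞} {a : ℝ≥0∞} (ha : a ≠ ∞)
    (h : ∀ᵐ x ∂μ, ENNReal.ofReal |f x| ≤ a * U x) : ENNReal.ofReal |∫ x, f x ∂μ| ≤ a * ∫⁻ x, U x ∂μ := by
  rw [← lintegral_const_mul' _ _ ha]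
  have e : ∀ y : ℝ, ENNReal.ofReal |y| = ‖y‖ₑ := fun y => by rw [Real.enorm_eq_ofReal_abs]
  rw [e]
  refine (enorm_integral_le_lintegral_enorm f).trans (lintegral_mono_ae ?_)
  filter_upwards [h] with x hx
  rw [← e]; exact hx

theorem integrated {d : ℕ} {T γ c L A : ℝ} {K : (Fin d → ℝ) → ℝ} (hK : IsKer d L K) (hc : 0 < c)
    {ρ : ℝ → (Fin d → ℝ) → ℝ} {v : ℝ → (Fin d → ℝ) → Fin d → ℝ} {ρ₀ : (Fin d → ℝ) → ℝ}
    {v₀ : (Fin d → ℝ) → Fin d → ℝ} (hsol : IsWeakSolution d T γ ρ v ρ₀ v₀)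
    {S : Set ℝ} (hSm : MeasurableSet S) (hSae : ∀ᵐ t ∂(volume.restrict (Set.Ioo 0 T)), t ∈ S)
    (hS : ∀ t ∈ S, SB d γ c A (ρ t) (v t)) {φ : ℝ → ℝ} (hφ : IsTest1 T φ) {M : ℝ}
    (hM : ∀ t, |φ t| ≤ M) (hM' : ∀ t, |deriv φ t| ≤ M) :
    Integrable (fun t => deriv φ t * ∫ x in unitCube d, eDens K γ (ρ t) (v t) x) (volume.restrict (Set.Ioo 0 T)) ∧
    ∫ t in Set.Ioo 0 T, deriv φ t * ∫ x in unitCube d, eDens K γ (ρ t) (v t) x =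
      ∫ t in Set.Ioo 0 T, φ t * ∫ x in unitCube d, flux K γ (ρ t) (v t) x := by
  obtain ⟨C, hC0, hC⟩ := SB.unif (γ := γ) (A := A) hK hc
  have I1 := bdd_integrable hSae (eDens_meas (γ := γ) hK hsol.rho_meas hsol.v_meas)
    (fun t ht x => (hC _ _ (hS t ht) x).1) (hφ.1.continuous_deriv (by simp)) hM'
  have I2 := bdd_integrable hSae (flux_meas (γ := γ) hK hsol.rho_meas hsol.v_meas)
    (fun t ht x => (hC _ _ (hS t ht) x).2) hφ.1.continuous hM
  simp only [← integral_const_mul]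
  constructor
  · exact I1.integral_prod_left
  · have s1 := integral_integral_swap (μ := volume.restrict (Set.Ioo 0 T)) (ν := cubeVol d)
      (f := fun t x => deriv φ t * eDens K γ (ρ t) (v t) x) I1
    have s2 := integral_integral_swap (μ := volume.restrict (Set.Ioo 0 T)) (ν := cubeVol d)
      (f := fun t x => φ t * flux K γ (ρ t) (v t) x) I2
    refine s1.trans (Eq.trans ?_ s2.symm)
    simp only [chain_x hK hc hsol hSm hSae hS hφ]

theorem rate_tendsto {α : ℝ} (hα : 1 / 3 < α) (a b : ℝ) :
    Filter.Tendsto (fun ε : ℝ => a * ((ε ^ α) ^ 2 + ε) + b * (Real.pi / ε * ((ε ^ α) ^ 3 + ε * ε ^ α)))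
      (nhdsWithin 0 (Set.Ioi 0)) (nhds 0) := by
  have hz : ∀ s : ℝ, 0 < s → Filter.Tendsto (fun ε : ℝ => ε ^ s) (nhdsWithin 0 (Set.Ioi 0)) (nhds 0) := fun s hs => by
    have := (Real.continuousAt_rpow_const 0 s (Or.inr hs.le)).tendsto
    rw [Real.zero_rpow hs.ne'] at this
    exact this.mono_left nhdsWithin_le_nhds
  have h1 := hz α (by linarith)
  have h2 := hz (3 * α - 1) (by linarith)
  have h3 : Filter.Tendsto (fun ε : ℝ => ε) (nhdsWithin 0 (Set.Ioi 0)) (nhds 0) :=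
    Filter.tendsto_id.mono_left nhdsWithin_le_nhds
  have h := (((h1.pow 2).add h3).const_mul a).add (((h2.add h1).const_mul Real.pi).const_mul b)
  simp only [ne_eq, OfNat.ofNat_ne_zero, not_false_eq_true, zero_pow, add_zero, mul_zero] at h
  refine h.congr' ?_
  filter_upwards [self_mem_nhdsWithin] with ε hε
  have hε' : (0:ℝ) < ε := hε
  have e1 : ε ^ (3 * α - 1) = (ε ^ α) ^ 3 / ε := by
    rw [Real.rpow_sub hε', Real.rpow_one, mul_comm, Real.rpow_mul hε'.le]
    norm_cast
  rw [e1]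
  field_simp

theorem assembly {d : ℕ} {T γ α c A : ℝ} (hγ : 1 < γ) (hα : 1 / 3 < α) (hc : 0 < c)
    {ρ : ℝ → (Fin d → ℝ) → ℝ} {v : ℝ → (Fin d → ℝ) → Fin d → ℝ} {ρ₀ : (Fin d → ℝ) → ℝ}
    {v₀ : (Fin d → ℝ) → Fin d → ℝ} (hsol : IsWeakSolution d T γ ρ v ρ₀ v₀)
    {S : Set ℝ} (hSm : MeasurableSet S) (hSae : ∀ᵐ t ∂(volume.restrict (Set.Ioo 0 T)), t ∈ S)
    (hS : ∀ t ∈ S, SB d γ c A (ρ t) (v t)) {C : ℝ≥0∞} (hC : C ≠ ∞)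
    (hTL : ∀ ε : ℝ, 0 < ε → ε ≤ 1 →
      ∫⁻ t in Set.Ioo 0 T, ∫⁻ x in unitCube d, TL (ker d ε) γ ε (ε ^ α) (ρ t) (v t) x ≤ C)
    {φ : ℝ → ℝ} (hφ : IsTest1 T φ) :
    ∫ t in Set.Ioo 0 T, deriv φ t * energyAt d γ ρ v t = 0 := by
  obtain ⟨M, hM0, hM, hM'⟩ : ∃ M, 0 ≤ M ∧ (∀ t, |φ t| ≤ M) ∧ ∀ t, |deriv φ t| ≤ M := by
    obtain ⟨hs, a, b, ha, hb, hsupp⟩ := hφ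
    have hcs : HasCompactSupport φ := HasCompactSupport.intro isCompact_Icc hsupp
    obtain ⟨M1, h1⟩ := hcs.exists_bound_of_continuous hs.continuous
    obtain ⟨M2, h2⟩ := hcs.deriv.exists_bound_of_continuous (hs.continuous_deriv (by simp))
    exact ⟨max M1 M2, ((norm_nonneg _).trans (h1 0)).trans (le_max_left _ _), fun t => (h1 t).trans (le_max_left _ _), fun t => (h2 t).trans (le_max_right _ _)⟩
  by_cases hInt0 : Integrable (fun t => deriv φ t * energyAt d γ ρ v t) (volume.restrict (Set.Ioo 0 T))
  swap
  · exact integral_undef hInt0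
  set I := ∫ t in Set.Ioo 0 T, deriv φ t * energyAt d γ ρ v t with hI
  set N : ℝ := 2 ^ (pE γ + 1) with hN
  have hN0 : 0 ≤ N := by positivity
  have hCD := CD_nonneg d hγ
  have hCE := CE_nonneg d hγ
  have key : ∀ ε : ℝ, 0 < ε → ε ≤ 1 → |I| ≤ (M * CD d γ * N * C.toReal) * ((ε ^ α) ^ 2 + ε) +
      (M * CE d γ * N * C.toReal) * (Real.pi / ε * ((ε ^ α) ^ 3 + ε * ε ^ α)) := by
    intro ε hε hε1
    have hK := ker_isKer (d := d) hε hε1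
    have hδ : 0 < ε ^ α := Real.rpow_pos_of_pos hε _
    have hpi : 0 ≤ Real.pi / ε := by positivity
    obtain ⟨J, hJ⟩ := integrated hK hc hsol hSm hSae hS hφ hM hM'
    set X1 := ∫ t in Set.Ioo 0 T, (deriv φ t * energyAt d γ ρ v t - deriv φ t * ∫ x in unitCube d, eDens (ker d ε) γ (ρ t) (v t) x) with hX1
    set X2 := ∫ t in Set.Ioo 0 T, φ t * ∫ x in unitCube d, flux (ker d ε) γ (ρ t) (v t) x with hX2
    have hsplit : I = X1 + X2 := by
      rw [hX1, integral_sub hInt0 J, hJ]; ring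
    set U := fun t => ∫⁻ x in unitCube d, TL (ker d ε) γ ε (ε ^ α) (ρ t) (v t) x with hU
    have B1 : ENNReal.ofReal |X1| ≤ ENNReal.ofReal (M * (CD d γ * ((ε ^ α) ^ 2 + ε) * N)) * ∫⁻ t in Set.Ioo 0 T, U t := by
      refine ofReal_abs_integral_ae ENNReal.ofReal_ne_top ?_
      filter_upwards [hSae] with t ht
      have := (hS t ht).1.energy_bd hK hε hδ
      rw [← mul_sub, abs_mul, ENNReal.ofReal_mul (abs_nonneg _), ENNReal.ofReal_mul hM0, mul_assoc]
      exact mul_le_mul' (ENNReal.ofReal_le_ofReal (hM' t)) this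
    have B2 : ENNReal.ofReal |X2| ≤ ENNReal.ofReal (M * (CE d γ * (Real.pi / ε) * ((ε ^ α) ^ 3 + ε * ε ^ α) * N)) * ∫⁻ t in Set.Ioo 0 T, U t := by
      refine ofReal_abs_integral_ae ENNReal.ofReal_ne_top ?_
      filter_upwards [hSae] with t ht
      have := (hS t ht).1.flux_bd hK hpi hε hε1 hδ
      rw [abs_mul, ENNReal.ofReal_mul (abs_nonneg _), ENNReal.ofReal_mul hM0, mul_assoc]
      exact mul_le_mul' (ENNReal.ofReal_le_ofReal (hM t)) this
    have conv1 : ∀ X a : ℝ, 0 ≤ a → ENNReal.ofReal |X| ≤ ENNReal.ofReal a * ∫⁻ t in Set.Ioo 0 T, U t → |X| ≤ a * C.toReal := by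
      intro X a ha h
      have h2 := h.trans (mul_le_mul_right (hTL ε hε hε1) _)
      rw [← ENNReal.ofReal_toReal hC, ← ENNReal.ofReal_mul ha] at h2
      exact (ENNReal.ofReal_le_ofReal_iff (by positivity)).1 h2
    have C1 := conv1 _ _ (by positivity) B1
    have C2 := conv1 _ _ (by positivity) B2
    rw [hsplit]
    refine (abs_add_le _ _).trans ((add_le_add C1 C2).trans (le_of_eq ?_))
    ring
  have hlim := rate_tendsto hα (M * CD d γ * N * C.toReal) (M * CE d γ * N * C.toReal)
  have hle : |I| ≤ 0 := by
    refine ge_of_tendsto hlim ?_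
    have : Set.Ioc (0:ℝ) 1 ∈ nhdsWithin (0:ℝ) (Set.Ioi 0) := Ioc_mem_nhdsGT one_pos
    filter_upwards [this] with ε hε using key ε hε.1 hε.2
  exact abs_eq_zero.1 (le_antisymm hle (abs_nonneg _))

theorem final {d : ℕ} {T γ α : ℝ} (hγ : 1 < γ) (hα : 1 / 3 < α)
    {ρ : ℝ → (Fin d → ℝ) → ℝ} {v : ℝ → (Fin d → ℝ) → Fin d → ℝ}
    {ρ₀ : (Fin d → ℝ) → ℝ} {v₀ : (Fin d → ℝ) → Fin d → ℝ}
    (hsol : IsWeakSolution d T γ ρ v ρ₀ v₀)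
    {c : ℝ} (hc : 0 < c)
    (hlow : ∀ᵐ z ∂(spaceTime d T), c ≤ ρ z.1 z.2)
    (hρ : MemLpLq T (ENNReal.ofReal (pE γ)) (ENNReal.ofReal (pE γ)) ρ)
    (hgradρ : GradInLpLq T (ENNReal.ofReal (pE γ)) (ENNReal.ofReal (pE γ)) ρ)
    (hv : MemLpBesov T (ENNReal.ofReal (qE γ)) α (ENNReal.ofReal (qE γ)) v)
    {φ : ℝ → ℝ} (hφ : IsTest1 T φ) :
    ∫ t in Set.Ioo 0 T, deriv φ t * energyAt d γ ρ v t = 0 := by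
  have hp1 : 1 < pE γ := by linarith [pE_gt hγ]
  have hp : 0 < pE γ := by linarith
  have hq : 0 < qE γ := by linarith [qE_gt hγ]
  have hα0 : 0 < α := by linarith
  have := spaceTime_finite d T
  have hR : ∫⁻ z, ENNReal.ofReal (ρ z.1 z.2 ^ pE γ) ∂(spaceTime d T) < ∞ := by
    have h := LpLq_lintegral hp ρ hρ
    rw [lintegral_spaceTime (f := fun z => ENNReal.ofReal (ρ z.1 z.2 ^ pE γ)) (hsol.rho_meas.pow_const _).ennreal_ofReal]
    refine lt_of_le_of_lt (lintegral_mono fun t => lintegral_mono fun x => ?_) h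
    rw [← Real.enorm_rpow_of_nonneg (hsol.rho_nonneg t x) hp.le, Real.enorm_of_nonneg (Real.rpow_nonneg (hsol.rho_nonneg t x) _)]
  have hρi : Integrable (Function.uncurry ρ) (spaceTime d T) := by
    have h1 : Integrable (fun z : ℝ × (Fin d → ℝ) => ρ z.1 z.2 ^ pE γ) (spaceTime d T) := by
      refine ⟨(hsol.rho_meas.pow_const _).aestronglyMeasurable, ?_⟩
      refine lt_of_le_of_lt (lintegral_mono fun z => ?_) hR
      rw [Real.enorm_of_nonneg (Real.rpow_nonneg (hsol.rho_nonneg z.1 z.2) _)]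
    refine ((integrable_const (1:ℝ)).add h1).mono' hsol.rho_meas.aestronglyMeasurable (ae_of_all _ fun z => ?_)
    have h0 := hsol.rho_nonneg z.1 z.2
    simp only [Function.uncurry, Real.norm_eq_abs, abs_of_nonneg h0, Pi.add_apply]
    rcases le_total (ρ z.1 z.2) 1 with h | h
    · linarith [Real.rpow_nonneg h0 (pE γ)]
    · linarith [Real.self_le_rpow_of_one_le h hp1.le]
  obtain ⟨G, hG, hGfin⟩ := hgradρ
  have hGb := grad_shift_bound_tN (Real.HolderConjugate.conjExponent hp1) hsol.rho_meas hρi hsol.rho_periodic hG hGfin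
  have hVb := besov_shift_bound (T := T) hq hα0 hsol.v_meas hsol.v_periodic
  obtain ⟨C, hC, hTL⟩ := TL_bound hγ hα0 hsol.rho_meas hsol.rho_periodic hsol.v_meas hR.ne ENNReal.ofReal_ne_top
    (LpBesov_lintegral hq v hv).ne le_rfl hGb hVb
  have hsl := ae_slice hγ hc hsol.rho_meas hsol.rho_periodic hsol.rho_nonneg hsol.v_meas hsol.v_periodic hlow hρ hv
  obtain ⟨A, hA, S, hSm, hSae, hS⟩ := good_set hsol.pressure_int hsol.kinetic_int hsl
  exact assembly hγ hα hc hsol hSm hSae hS hC hTL hφ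

end part16

/-- **Corollary (2)** of Theorem 1.1: local energy conservation when
`ρ, ∂ₜρ, ∇ρ ∈ L^{(3γ-1)/2}(0,T;L^{(3γ-1)/2}(𝕋^d))` and
`v ∈ L^{(3γ-1)/(γ-1)}(0,T;B^α_{(3γ-1)/(γ-1),∞}(𝕋^d))`, `α > 1/3`. -/
theorem local_energy_conservation_corollary_two
    (d : ℕ) (hd : 2 ≤ d) (T : ℝ) (hT : 0 < T) (γ : ℝ) (hγ : 1 < γ)
    (α : ℝ) (hα : 1 / 3 < α)
    (ρ : ℝ → (Fin d → ℝ) → ℝ) (v : ℝ → (Fin d → ℝ) → Fin d → ℝ)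
    (ρ₀ : (Fin d → ℝ) → ℝ) (v₀ : (Fin d → ℝ) → Fin d → ℝ)
    (hsol : IsWeakSolution d T γ ρ v ρ₀ v₀)
    (c : ℝ) (hc : 0 < c)
    (hlow : ∀ᵐ z ∂(spaceTime d T), c ≤ ρ z.1 z.2)
    (hρ : MemLpLq T (ENNReal.ofReal ((3 * γ - 1) / 2)) (ENNReal.ofReal ((3 * γ - 1) / 2)) ρ)
    (hdtρ : DtInLpLq T (ENNReal.ofReal ((3 * γ - 1) / 2)) (ENNReal.ofReal ((3 * γ - 1) / 2)) ρ)
    (hgradρ : GradInLpLq T (ENNReal.ofReal ((3 * γ - 1) / 2)) (ENNReal.ofReal ((3 * γ - 1) / 2)) ρ)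
    (hv : MemLpBesov T (ENNReal.ofReal ((3 * γ - 1) / (γ - 1))) α
      (ENNReal.ofReal ((3 * γ - 1) / (γ - 1))) v) :
    ∀ φ : ℝ → ℝ, ContDiff ℝ (⊤ : ℕ∞) φ →
      (∃ a b : ℝ, 0 < a ∧ b < T ∧ ∀ t, t ∉ Set.Icc a b → φ t = 0) →
      ∫ t in Set.Ioo 0 T, deriv φ t * energyAt d γ ρ v t = 0 := by
  intro φ h1 h2
  exact final hγ hα hsol hc hlow hρ hgradρ hv ⟨h1, h2⟩

end CompressibleEuler
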